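/- With the above hypotheses, the bigraded Betti numbers of S/J over S are: β_{i,(a,b)}^S(S/J) = C(m,i) if 0 ≤ i ≤ n−1 and a = b = i; β_{i,(a,b)}^S(S/J) = r(i,a) if 1 ≤ i ≤ m, b = n+i−1−a, and max{0, i−(m−n+1)} ≤ a ≤ min{i−1, n−1}, where r(i,a) = C(n+i−2a−2, i−1−a)·C(n+i−1−a, a)·C(m, n+i−1−a); and β_{i,(a,b)}^S(S/J) = 0 otherwise. -/

import Mathlib

open MvPolynomial

noncomputable section

/-- The bigraded polynomial ring `S = k[x₁,…,xₙ,y₁,…,y_p]`. -/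
abbrev PolyS (k : Type) [Field k] (n p : ℕ) : Type := MvPolynomial (Fin n ⊕ Fin p) k

/-- The bigrading with `deg xᵢ = (1,0)` and `deg yⱼ = (0,1)`. -/
def bideg (n p : ℕ) : (Fin n ⊕ Fin p) → ℤ × ℤ :=
  Sum.elim (fun _ => ((1 : ℤ), (0 : ℤ))) (fun _ => ((0 : ℤ), (1 : ℤ)))

/-- The bihomogeneous component of `S` of bidegree `d`. -/
def piece (k : Type) [Field k] (n p : ℕ) (d : ℤ × ℤ) : Submodule k (PolyS k n p) :=
  weightedHomogeneousSubmodule k (bideg n p) d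

/-- The sequence `z` defined by `[z₁ … z_m] = [x₁ … xₙ]·φ`. -/
def zseq (k : Type) [Field k] (n m p : ℕ) (φ : Matrix (Fin n) (Fin m) (PolyS k n p))
    (j : Fin m) : PolyS k n p :=
  ∑ i : Fin n, X (Sum.inl i) * φ i j

/-- The ideal of `t × t` minors of a matrix. -/
def minorsIdeal {R : Type} [CommRing R] {a b : ℕ} (t : ℕ) (φ : Matrix (Fin a) (Fin b) R) :
    Ideal R :=
  Ideal.span { d : R | ∃ (r : Fin t ↪ Fin a) (c : Fin t ↪ Fin b),
    d = (φ.submatrix r c).det }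

/-- `J = (z₁,…,z_m) + Iₙ(φ)`. -/
def resJ (k : Type) [Field k] (n m p : ℕ) (φ : Matrix (Fin n) (Fin m) (PolyS k n p)) :
    Ideal (PolyS k n p) :=
  Ideal.span (Set.range (zseq k n m p φ)) ⊔ minorsIdeal n φ

/-- The height of an ideal. -/
def idealHeight {R : Type} [CommRing R] (I : Ideal R) : ℕ∞ :=
  ⨅ (P : PrimeSpectrum R) (_ : I ≤ P.asIdeal), Order.height P

/-- `grade I ≥ t`: there is a regular sequence of length `t` inside `I`. -/
def gradeGE {R : Type} [CommRing R] (I : Ideal R) (t : ℕ) : Prop :=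
  ∃ rs : List R, rs.length = t ∧ (∀ r ∈ rs, r ∈ I) ∧ RingTheory.Sequence.IsRegular R rs

/-- The ideal `(x₁,…,xₙ)` of `S`. -/
def xIdeal (k : Type) [Field k] (n p : ℕ) : Ideal (PolyS k n p) :=
  Ideal.span (Set.range fun i : Fin n => (X (Sum.inl i) : PolyS k n p))

/-- The geometric residual intersection condition: `(z)_𝔭 = (x)_𝔭` for all primes
`𝔭 ⊇ (x)` of height at most `m`. -/
def geomResCond (k : Type) [Field k] (n m p : ℕ)
    (φ : Matrix (Fin n) (Fin m) (PolyS k n p)) : Prop :=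
  ∀ P : PrimeSpectrum (PolyS k n p), xIdeal k n p ≤ P.asIdeal →
    Order.height P ≤ (m : ℕ∞) →
    Ideal.map (algebraMap (PolyS k n p) (Localization.AtPrime P.asIdeal))
        (Ideal.span (Set.range (zseq k n m p φ)))
      = Ideal.map (algebraMap (PolyS k n p) (Localization.AtPrime P.asIdeal))
          (xIdeal k n p)

/-- The multiplicity `r(i,j)`. -/
def rMult (n m i j : ℕ) : ℕ :=
  (n + i - 2 * j - 2).choose (i - 1 - j) * (n + i - 1 - j).choose j *
    m.choose (n + i - 1 - j)

/-- The predicted bigraded Betti numbers of `S/J`: `C(m,i)` in bidegree `(i,i)` for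
`0 ≤ i ≤ n-1`, and `r(i,a)` in bidegree `(a, n+i-1-a)` for `1 ≤ i ≤ m` and
`max{0, i-(m-n+1)} ≤ a ≤ min{i-1, n-1}`. -/
def bettiFormula (n m : ℕ) (i : ℕ) (d : ℤ × ℤ) : ℕ :=
  if i ≤ n - 1 ∧ d.1 = (i : ℤ) ∧ d.2 = (i : ℤ) then m.choose i
  else if 1 ≤ i ∧ i ≤ m ∧ ((i - (m - n + 1) : ℕ) : ℤ) ≤ d.1 ∧
      d.1 ≤ ((min (i - 1) (n - 1) : ℕ) : ℤ) ∧ d.2 = (n : ℤ) + (i : ℤ) - 1 - d.1 then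
    rMult n m i d.1.toNat
  else 0

/-- Index type of the free bigraded module with multiplicities `β i`. -/
def RIdx (β : ℕ → ℤ × ℤ → ℕ) (i : ℕ) : Type := { q : (ℤ × ℤ) × ℕ // q.2 < β i q.1 }

/-- The free bigraded `S`-module `⊕_{(a,b)} S(-a,-b)^{β i (a,b)}`. -/
abbrev FMod (k : Type) [Field k] (n p : ℕ) (β : ℕ → ℤ × ℤ → ℕ) (i : ℕ) : Type :=
  RIdx β i →₀ PolyS k n p

/-- `v` lies in the bigraded component of bidegree `d` of `FMod β i`
(the generator indexed by `q` sits in bidegree `q.1.1`, so its coefficient must lie in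
`S(-q.1.1)_d = S_{d - q.1.1}`). -/
def inPiece (k : Type) [Field k] (n p : ℕ) (β : ℕ → ℤ × ℤ → ℕ) (i : ℕ) (d : ℤ × ℤ)
    (v : FMod k n p β i) : Prop :=
  ∀ q : RIdx β i, v q ∈ piece k n p (d - q.1.1)

/-- The irrelevant ideal of `S`, generated by all the variables. -/
def varIdeal (k : Type) [Field k] (n p : ℕ) : Ideal (PolyS k n p) :=
  Ideal.span (Set.range (X : (Fin n ⊕ Fin p) → PolyS k n p))

/-- `β` records the shifts of a bigraded free resolution of `S/J` over `S`:
there are bidegree-preserving `S`-linear maps forming an exact sequence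
`⋯ → F_{i+1} → F_i → ⋯ → F_0 → S/J → 0` where `F_i = ⊕ S(-a,-b)^{β i (a,b)}`
(since `β i = 0` for large `i`, this is a finite resolution). -/
def IsBigradedFreeRes (k : Type) [Field k] (n p : ℕ) (J : Ideal (PolyS k n p))
    (β : ℕ → ℤ × ℤ → ℕ) : Prop :=
  ∃ (f : ∀ i : ℕ, FMod k n p β (i + 1) →ₗ[PolyS k n p] FMod k n p β i)
    (π : FMod k n p β 0 →ₗ[PolyS k n p] (PolyS k n p ⧸ J)),
    Function.Surjective π ∧ Function.Exact (f 0) π ∧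
    (∀ i, Function.Exact (f (i + 1)) (f i)) ∧
    (∀ i d v, inPiece k n p β (i + 1) d v → inPiece k n p β i d (f i v)) ∧
    (∀ d v, inPiece k n p β 0 d v →
      π v ∈ (piece k n p d).map (Ideal.Quotient.mkₐ k J).toLinearMap)

/-- `β` records the shifts of a *minimal* bigraded free resolution of `S/J` over `S`,
i.e. a bigraded free resolution whose differentials have image inside `𝔪·F` where `𝔪`
is the ideal generated by all the variables.  The multiplicities `β i (a,b)` of a
minimal bigraded free resolution are exactly the bigraded Betti numbers
`β_{i,(a,b)}(S/J) = dim_k Tor_i(S/J, k)_{(a,b)}`. -/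
def IsMinBigradedFreeRes (k : Type) [Field k] (n p : ℕ) (J : Ideal (PolyS k n p))
    (β : ℕ → ℤ × ℤ → ℕ) : Prop :=
  ∃ (f : ∀ i : ℕ, FMod k n p β (i + 1) →ₗ[PolyS k n p] FMod k n p β i)
    (π : FMod k n p β 0 →ₗ[PolyS k n p] (PolyS k n p ⧸ J)),
    Function.Surjective π ∧ Function.Exact (f 0) π ∧
    (∀ i, Function.Exact (f (i + 1)) (f i)) ∧
    (∀ i d v, inPiece k n p β (i + 1) d v → inPiece k n p β i d (f i v)) ∧
    (∀ d v, inPiece k n p β 0 d v →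
      π v ∈ (piece k n p d).map (Ideal.Quotient.mkₐ k J).toLinearMap) ∧
    (∀ i, LinearMap.range (f i) ≤
      (varIdeal k n p) • (⊤ : Submodule (PolyS k n p) (FMod k n p β i)))

set_option linter.unusedSectionVars false

namespace Koszul

section Basic

variable {k M α : Type*} [CommRing k] [AddCommGroup M] [Module k M] [LinearOrder α]

/-- The sign of `e_i ∧ e_T`. -/
def sgn (i : α) (T : Finset α) : ℤ := (-1) ^ (T.filter (· < i)).card

lemma sgn_mul_self (i : α) (T : Finset α) : sgn i T * sgn i T = 1 := by
  unfold sgn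
  rw [← pow_add, ← two_mul, pow_mul]
  simp

lemma sgn_insert (i j : α) (T : Finset α) (h : j ∉ T) :
    sgn i (insert j T) = if j < i then -sgn i T else sgn i T := by
  unfold sgn
  rw [Finset.filter_insert]
  split_ifs with hj
  · rw [Finset.card_insert_of_notMem (by simp [h]), pow_succ]
    ring
  · rfl

lemma sgn_insert_self (i : α) (T : Finset α) : sgn i (insert i T) = sgn i T := by
  unfold sgn
  rw [Finset.filter_insert, if_neg (lt_irrefl i)]

lemma sgn_mul_sgn_insert {i j : α} {T : Finset α} (hij : i ≠ j) (hi : i ∉ T) (hj : j ∉ T) :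
    sgn i T * sgn j (insert i T) = -(sgn j T * sgn i (insert j T)) := by
  rw [sgn_insert _ _ _ hi, sgn_insert _ _ _ hj]
  rcases lt_or_gt_of_ne hij with h | h
  · rw [if_pos h, if_neg (not_lt.2 h.le)]; ring
  · rw [if_neg (not_lt.2 h.le), if_pos h]; ring

variable (k M) in
/-- Contraction by the `i`-th dual basis vector. -/
def contr (i : α) : (Finset α → M) →ₗ[k] (Finset α → M) where
  toFun c T := if i ∈ T then 0 else sgn i T • c (insert i T)
  map_add' c c' := by
    funext T
    simp only [Pi.add_apply]
    split_ifs <;> simp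
  map_smul' r c := by
    funext T
    simp only [Pi.smul_apply, RingHom.id_apply]
    split_ifs
    · simp
    · exact smul_comm _ _ _

variable (k M) in
/-- Exterior multiplication by the `i`-th basis vector. -/
def wedge (i : α) : (Finset α → M) →ₗ[k] (Finset α → M) where
  toFun c T := if i ∈ T then sgn i T • c (T.erase i) else 0
  map_add' c c' := by
    funext T
    simp only [Pi.add_apply]
    split_ifs <;> simp
  map_smul' r c := by
    funext T
    simp only [Pi.smul_apply, RingHom.id_apply]
    split_ifs
    · exact smul_comm _ _ _
    · simp

lemma contr_apply (i : α) (c : Finset α → M) (T : Finset α) :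
    contr k M i c T = if i ∈ T then 0 else sgn i T • c (insert i T) := rfl

lemma wedge_apply (i : α) (c : Finset α → M) (T : Finset α) :
    wedge k M i c T = if i ∈ T then sgn i T • c (T.erase i) else 0 := rfl

lemma contr_contr (i j : α) (c : Finset α → M) :
    contr k M i (contr k M j c) = -contr k M j (contr k M i c) := by
  funext T
  simp only [contr_apply, Pi.neg_apply]
  by_cases hij : i = j
  · subst hij; simp
  by_cases hi : i ∈ T
  · simp [hi]
  by_cases hj : j ∈ T
  · simp [hi, hj]
  simp only [hi, hj, if_false, Finset.mem_insert, hij, Ne.symm hij, false_or, smul_smul]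
  rw [sgn_mul_sgn_insert hij hi hj, Finset.insert_comm, neg_smul]

lemma contr_self (i : α) (c : Finset α → M) : contr k M i (contr k M i c) = 0 := by
  funext T
  simp [contr_apply]

lemma contr_wedge {i j : α} (hij : i ≠ j) (c : Finset α → M) :
    contr k M i (wedge k M j c) = -wedge k M j (contr k M i c) := by
  funext T
  simp only [contr_apply, wedge_apply, Pi.neg_apply]
  by_cases hj : j ∈ T
  · obtain ⟨T, hjT, rfl⟩ : ∃ T', j ∉ T' ∧ insert j T' = T :=
      ⟨T.erase j, Finset.notMem_erase j T, Finset.insert_erase hj⟩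
    by_cases hi : i ∈ T
    · simp [hi, hij]
    · have h1 : (insert i (insert j T)).erase j = insert i T := by
        rw [Finset.insert_comm, Finset.erase_insert (by simp [hjT, Ne.symm hij])]
      have h2 : (insert j T).erase j = T := Finset.erase_insert hjT
      simp only [Finset.mem_insert, hij, hi, or_self, if_false, true_or, or_true, if_true, h1, h2,
        smul_smul]
      rw [← neg_smul]
      congr 1
      rw [Finset.insert_comm, sgn_insert_self, sgn_insert_self, sgn_insert _ _ _ hi,
        sgn_insert _ _ _ hjT]
      rcases lt_or_gt_of_ne hij with h | h
      · rw [if_pos h, if_neg (not_lt.2 h.le)]; ring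
      · rw [if_neg (not_lt.2 h.le), if_pos h]; ring
  · by_cases hi : i ∈ T
    · simp [hi, hj]
    · simp [hi, hj, Ne.symm hij]

lemma contr_wedge_self (i : α) (c : Finset α → M) (T : Finset α) :
    contr k M i (wedge k M i c) T = if i ∈ T then 0 else c T := by
  simp only [contr_apply, wedge_apply]
  split_ifs with h h2
  · rfl
  · rw [sgn_insert_self, smul_smul, sgn_mul_self, one_smul, Finset.erase_insert h]
  · simp at h2

lemma wedge_contr_self (i : α) (c : Finset α → M) (T : Finset α) :
    wedge k M i (contr k M i c) T = if i ∈ T then c T else 0 := by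
  simp only [contr_apply, wedge_apply]
  split_ifs with h h2
  · simp at h2
  · rw [Finset.insert_erase h, smul_smul]
    obtain ⟨T, hjT, rfl⟩ : ∃ T', i ∉ T' ∧ insert i T' = T :=
      ⟨T.erase i, Finset.notMem_erase i T, Finset.insert_erase h⟩
    rw [sgn_insert_self, Finset.erase_insert hjT, sgn_mul_self, one_smul]
  · rfl

/-- Apply an endomorphism to all coefficients. -/
def coef {N : Type*} [AddCommGroup N] [Module k N] (g : M →ₗ[k] N) :
    (Finset α → M) →ₗ[k] (Finset α → N) where
  toFun c T := g (c T)
  map_add' c c' := by funext T; simp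
  map_smul' r c := by funext T; simp

@[simp] lemma coef_apply {N : Type*} [AddCommGroup N] [Module k N] (g : M →ₗ[k] N)
    (c : Finset α → M) (T : Finset α) : coef g c T = g (c T) := rfl

lemma coef_contr {N : Type*} [AddCommGroup N] [Module k N] (g : M →ₗ[k] N) (i : α)
    (c : Finset α → M) : coef g (contr k M i c) = contr k N i (coef g c) := by
  funext T
  simp only [contr_apply, coef_apply]
  split_ifs <;> simp

lemma coef_wedge {N : Type*} [AddCommGroup N] [Module k N] (g : M →ₗ[k] N) (i : α)
    (c : Finset α → M) : coef g (wedge k M i c) = wedge k N i (coef g c) := by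
  funext T
  simp only [wedge_apply, coef_apply]
  split_ifs <;> simp

end Basic

section Differential

variable {k M α : Type*} [CommRing k] [AddCommGroup M] [Module k M] [LinearOrder α] [Fintype α]

/-- The Koszul differential of a family of endomorphisms. -/
def kd (F : α → Module.End k M) : (Finset α → M) →ₗ[k] (Finset α → M) :=
  ∑ i, coef (F i) ∘ₗ contr k M i

lemma kd_eq (F : α → Module.End k M) (c : Finset α → M) :
    kd F c = ∑ i, coef (F i) (contr k M i c) := by
  simp [kd]

lemma kd_apply (F : α → Module.End k M) (c : Finset α → M) (T : Finset α) :
    kd F c T = ∑ i, F i (contr k M i c T) := by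
  simp [kd_eq]

lemma kd_apply' (F : α → Module.End k M) (c : Finset α → M) (T : Finset α) :
    kd F c T = ∑ i ∈ Finset.univ.filter (· ∉ T), sgn i T • F i (c (insert i T)) := by
  rw [kd_apply, Finset.sum_filter]
  refine Finset.sum_congr rfl fun i _ => ?_
  rw [contr_apply]
  by_cases h : i ∈ T <;> simp [h]

lemma kd_kd (F : α → Module.End k M) (hF : ∀ i j, Commute (F i) (F j)) (c : Finset α → M) :
    kd F (kd F c) = 0 := by
  have h1 : kd F (kd F c) = ∑ x : α × α, coef (F x.1) (coef (F x.2)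
      (contr k M x.1 (contr k M x.2 c))) := by
    rw [kd_eq F c, map_sum, Fintype.sum_prod_type_right]
    refine Finset.sum_congr rfl fun j _ => ?_
    rw [kd_eq]
    refine Finset.sum_congr rfl fun i _ => ?_
    rw [← coef_contr]
  rw [h1]
  refine Finset.sum_involution (fun x _ => x.swap) ?_ ?_ (by simp) (by simp)
  · rintro ⟨i, j⟩ -
    have : coef (F i) (coef (F j) (contr k M i (contr k M j c))) =
        coef (F j) (coef (F i) (contr k M i (contr k M j c))) := by
      funext T
      exact LinearMap.congr_fun (hF i j) _
    simp only [Prod.swap_prod_mk]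
    rw [this, contr_contr]
    simp
  · rintro ⟨i, j⟩ - h hij
    simp only [Prod.swap_prod_mk, Prod.mk.injEq] at hij
    obtain ⟨rfl, -⟩ := hij
    rw [contr_self] at h
    simp at h

lemma coef_kd {N : Type*} [AddCommGroup N] [Module k N] (F : α → Module.End k M)
    (F' : α → Module.End k N) (g : M →ₗ[k] N) (h : ∀ i x, g (F i x) = F' i (g x))
    (c : Finset α → M) : coef g (kd F c) = kd F' (coef g c) := by
  rw [kd_eq, kd_eq, map_sum]
  refine Finset.sum_congr rfl fun i _ => ?_
  rw [← coef_contr]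
  funext T
  exact h _ _

/-- The homotopy formula for `e_i ∧ D`. -/
lemma kd_wedge_add (F : α → Module.End k M) (i : α) (D : Module.End k M)
    (hD : ∀ j, j ≠ i → Commute (F j) D) (c : Finset α → M) (T : Finset α) :
    kd F (wedge k M i (coef D c)) T + wedge k M i (coef D (kd F c)) T =
      if i ∈ T then D (F i (c T)) else F i (D (c T)) := by
  have h1 : coef D (kd F c) = ∑ j, coef D (coef (F j) (contr k M j c)) := by
    rw [kd_eq, map_sum]
  have h2 : ∀ j, j ≠ i → coef (F j) (contr k M j (wedge k M i (coef D c))) +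
      wedge k M i (coef D (coef (F j) (contr k M j c))) = 0 := by
    intro j hj
    have : coef D (coef (F j) (contr k M j c)) = coef (F j) (coef D (contr k M j c)) := by
      funext T
      exact (LinearMap.congr_fun (hD j hj) _).symm
    rw [contr_wedge hj, this, ← coef_wedge, coef_contr, map_neg, neg_add_cancel]
  have h3 : kd F (wedge k M i (coef D c)) + wedge k M i (coef D (kd F c)) =
      coef (F i) (contr k M i (wedge k M i (coef D c))) +
      wedge k M i (coef D (coef (F i) (contr k M i c))) := by
    rw [h1, map_sum, kd_eq, ← Finset.sum_add_distrib]
    exact Finset.sum_eq_single i (fun j _ hj => h2 j hj) (by simp)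
  rw [← Pi.add_apply, h3, Pi.add_apply, ← coef_wedge D (i := i) (c := coef (F i) _),
    ← coef_wedge (F i)]
  simp only [coef_apply, contr_wedge_self, wedge_contr_self]
  split_ifs <;> simp

end Differential

section Graded

variable {k M α Δ : Type*} [CommRing k] [AddCommGroup M] [Module k M] [LinearOrder α]
  [AddCommGroup Δ]

/-- Koszul chains of homological degree `p` and internal degree `d`. -/
def KP (deg : α → Δ) (G : Δ → Submodule k M) (p : ℕ) (d : Δ) : Submodule k (Finset α → M) where
  carrier := {c | ∀ T, (T.card = p → c T ∈ G (d - ∑ i ∈ T, deg i)) ∧ (T.card ≠ p → c T = 0)}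
  add_mem' h h' T := ⟨fun e => add_mem ((h T).1 e) ((h' T).1 e),
    fun e => by simp [(h T).2 e, (h' T).2 e]⟩
  zero_mem' T := ⟨fun _ => zero_mem _, fun _ => rfl⟩
  smul_mem' r c h T := ⟨fun e => Submodule.smul_mem _ _ ((h T).1 e), fun e => by simp [(h T).2 e]⟩

lemma mem_KP {deg : α → Δ} {G : Δ → Submodule k M} {p : ℕ} {d : Δ} {c : Finset α → M} :
    c ∈ KP deg G p d ↔
      ∀ T, (T.card = p → c T ∈ G (d - ∑ i ∈ T, deg i)) ∧ (T.card ≠ p → c T = 0) := Iff.rfl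

lemma KP_mono {deg : α → Δ} {G G' : Δ → Submodule k M} (h : ∀ e, G e ≤ G' e) (p : ℕ) (d : Δ) :
    KP deg G p d ≤ KP deg G' p d := fun _ hc T => ⟨fun e => h _ ((hc T).1 e), (hc T).2⟩

lemma KP_coef {N : Type*} [AddCommGroup N] [Module k N] {deg : α → Δ} {G : Δ → Submodule k M}
    {G' : Δ → Submodule k N} {p : ℕ} {d e : Δ} (g : M →ₗ[k] N)
    (h : ∀ e' x, x ∈ G e' → g x ∈ G' (e' + e)) {c : Finset α → M} (hc : c ∈ KP deg G p d) :
    coef g c ∈ KP deg G' p (d + e) := by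
  intro T
  refine ⟨fun hT => ?_, fun hT => ?_⟩
  · have := h _ _ ((hc T).1 hT)
    rwa [sub_add_eq_add_sub] at this
  · simp [(hc T).2 hT]

lemma contr_mem {deg : α → Δ} {G : Δ → Submodule k M} {p : ℕ} {d : Δ} {c : Finset α → M}
    (hc : c ∈ KP deg G (p + 1) d) (i : α) : contr k M i c ∈ KP deg G p (d - deg i) := by
  intro T
  rw [contr_apply]
  split_ifs with hi
  · exact ⟨fun _ => zero_mem _, fun _ => rfl⟩
  · have hcard := Finset.card_insert_of_notMem hi
    refine ⟨fun hT => ?_, fun hT => ?_⟩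
    · have := (hc (insert i T)).1 (by omega)
      rw [Finset.sum_insert hi, ← sub_sub] at this
      exact zsmul_mem this _
    · rw [(hc (insert i T)).2 (by omega), smul_zero]

lemma wedge_mem {deg : α → Δ} {G : Δ → Submodule k M} {p : ℕ} {d : Δ} {c : Finset α → M}
    (hc : c ∈ KP deg G p d) (i : α) : wedge k M i c ∈ KP deg G (p + 1) (d + deg i) := by
  intro T
  rw [wedge_apply]
  split_ifs with hi
  · have hcard := Finset.card_erase_add_one hi
    refine ⟨fun hT => ?_, fun hT => ?_⟩
    · have := (hc (T.erase i)).1 (by omega)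
      rw [← Finset.add_sum_erase _ _ hi, add_comm (deg i), add_sub_add_right_eq_sub]
      exact zsmul_mem this _
    · rw [(hc (T.erase i)).2 (by omega), smul_zero]
  · exact ⟨fun _ => zero_mem _, fun _ => rfl⟩

variable [Fintype α]

lemma kd_mem {F : α → Module.End k M} {deg : α → Δ} {G : Δ → Submodule k M}
    (hG : ∀ i e x, x ∈ G e → F i x ∈ G (e + deg i)) {p : ℕ} {d : Δ} {c : Finset α → M}
    (hc : c ∈ KP deg G (p + 1) d) : kd F c ∈ KP deg G p d := by
  rw [kd_eq]
  refine Submodule.sum_mem _ fun i _ => ?_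
  have := KP_coef (F i) (hG i) (contr_mem hc i)
  rwa [sub_add_cancel] at this

lemma kd_zero {F : α → Module.End k M} {deg : α → Δ} {G : Δ → Submodule k M} {d : Δ}
    {c : Finset α → M} (hc : c ∈ KP deg G 0 d) : kd F c = 0 := by
  funext T
  rw [kd_apply']
  refine Finset.sum_eq_zero fun i hi => ?_
  rw [(hc _).2, map_zero, smul_zero]
  exact (Finset.card_pos.2 (Finset.insert_nonempty i T)).ne'

/-- Exactness of the Koszul complex at a given spot. -/
def KEx (F : α → Module.End k M) (deg : α → Δ) (G : Δ → Submodule k M) (p : ℕ) (d : Δ) : Prop :=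
  ∀ c ∈ KP deg G p d, kd F c = 0 → ∃ b ∈ KP deg G (p + 1) d, kd F b = c

end Graded

end Koszul

namespace Koszul

section DoubleComplex

variable {k W : Type*} [CommRing k] [AddCommGroup W] [Module k W]

/-- A first quadrant commuting double complex inside an ambient module. -/
structure DC (Y : ℕ → ℕ → Submodule k W) (d1 d2 : W →ₗ[k] W) : Prop where
  m1 : ∀ p q c, c ∈ Y (p + 1) q → d1 c ∈ Y p q
  z1 : ∀ q c, c ∈ Y 0 q → d1 c = 0
  m2 : ∀ p q c, c ∈ Y p (q + 1) → d2 c ∈ Y p q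
  z2 : ∀ p c, c ∈ Y p 0 → d2 c = 0
  sq1 : ∀ c, d1 (d1 c) = 0
  sq2 : ∀ c, d2 (d2 c) = 0
  comm : ∀ c, d1 (d2 c) = d2 (d1 c)

/-- Exactness at a submodule of a sequence of maps. -/
def ExAt (Y' Y : Submodule k W) (d : W →ₗ[k] W) : Prop :=
  ∀ c ∈ Y, d c = 0 → ∃ b ∈ Y', d b = c

lemma DC.swap {Y : ℕ → ℕ → Submodule k W} {d1 d2 : W →ₗ[k] W} (h : DC Y d1 d2) :
    DC (fun p q => Y q p) d2 d1 :=
  ⟨fun _ _ => h.m2 _ _, h.z2, fun _ _ => h.m1 _ _, h.z1, h.sq2, h.sq1, fun c => (h.comm c).symm⟩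

lemma DC.split {Y : ℕ → ℕ → Submodule k W} {d1 d2 : W →ₗ[k] W} (h : DC Y d1 d2) (p q : ℕ)
    (u : W) (hu : u ∈ Y p q) (hdu : d2 (d1 u) = 0)
    (h2 : ∀ p' q', p' + q' + 1 = p + q → p' < p → ExAt (Y p' (q' + 1)) (Y p' q') d2)
    (h1 : ∀ p' q', p' + q' = p + q → q ≤ q' → ExAt (Y (p' + 1) q') (Y p' q') d1) :
    ∃ w ∈ Y (p + 1) q, ∃ v ∈ Y p (q + 1), u = d1 w + d2 v := by
  induction p generalizing q u with
  | zero =>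
    obtain ⟨w, hw, rfl⟩ := h1 0 q (by omega) le_rfl u hu (h.z1 _ _ hu)
    exact ⟨w, hw, 0, zero_mem _, by simp⟩
  | succ p ih =>
    obtain ⟨u', hu', e⟩ := h2 p q (by omega) (by omega) (d1 u) (h.m1 _ _ _ hu) hdu
    obtain ⟨w', hw', v', hv', rfl⟩ := ih (q + 1) u' hu'
      (by rw [← h.comm, e, h.sq1]) (fun p' q' h' h'' => h2 p' q' (by omega) (by omega))
      (fun p' q' h' h'' => h1 p' q' (by omega) (by omega))
    obtain ⟨w, hw, e'⟩ := h1 (p + 1) q (by omega) le_rfl (u - d2 w')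
      (sub_mem hu (h.m2 _ _ _ hw'))
      (by rw [map_sub, ← e, map_add, h.sq2, h.comm, add_zero, sub_self])
    exact ⟨w, hw, w', hw', by rw [e']; abel⟩

end DoubleComplex

section KDC

variable {k M α β Δ : Type*} [CommRing k] [AddCommGroup M] [Module k M] [LinearOrder α]
  [Fintype α] [LinearOrder β] [Fintype β] [AddCommGroup Δ]

/-- The differential in the first direction. -/
abbrev dd1 (β : Type*) (F : α → Module.End k M) :
    (Finset α → Finset β → M) →ₗ[k] (Finset α → Finset β → M) :=
  kd (fun i => (coef (F i) : Module.End k (Finset β → M)))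

/-- The differential in the second direction. -/
abbrev dd2 (α : Type*) (H : β → Module.End k M) :
    (Finset α → Finset β → M) →ₗ[k] (Finset α → Finset β → M) :=
  coef (kd H)

/-- The bigraded pieces of the Koszul double complex. -/
abbrev KY (dα : α → Δ) (dβ : β → Δ) (G : Δ → Submodule k M) (d : Δ) (p q : ℕ) :
    Submodule k (Finset α → Finset β → M) :=
  KP dα (fun e => KP dβ G q e) p d

lemma dd1_apply (F : α → Module.End k M) (c : Finset α → Finset β → M) (T : Finset α)
    (U : Finset β) : dd1 β F c T U = kd F (fun T => c T U) T := by
  have := coef_kd (fun i => (coef (F i) : Module.End k (Finset β → M))) F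
    (LinearMap.proj (R := k) (φ := fun _ => M) U) (fun i x => rfl) c
  exact congrFun this T

lemma kdc_DC {F : α → Module.End k M} {H : β → Module.End k M} {dα : α → Δ} {dβ : β → Δ}
    {G : Δ → Submodule k M} (hF : ∀ i j, Commute (F i) (F j)) (hH : ∀ i j, Commute (H i) (H j))
    (hFH : ∀ i j, Commute (F i) (H j))
    (hFG : ∀ i e x, x ∈ G e → F i x ∈ G (e + dα i))
    (hHG : ∀ i e x, x ∈ G e → H i x ∈ G (e + dβ i)) (d : Δ) :
    DC (KY dα dβ G d) (dd1 β F) (dd2 α H) where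
  m1 p q c hc := kd_mem (fun i e x hx => KP_coef _ (hFG i) hx) hc
  z1 q c hc := kd_zero hc
  m2 p q c hc T := ⟨fun hT => kd_mem hHG ((hc T).1 hT), fun hT => by
    simp [(hc T).2 hT]⟩
  z2 p c hc := by
    funext T
    by_cases hT : T.card = p
    · exact kd_zero ((hc T).1 hT)
    · simp [(hc T).2 hT]
  sq1 c := kd_kd _ (fun i j => by
    refine LinearMap.ext fun x => funext fun T => ?_
    exact LinearMap.congr_fun (hF i j) _) c
  sq2 c := by
    funext T
    exact kd_kd _ hH _
  comm c := by
    symm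
    refine coef_kd _ _ _ (fun i x => ?_) c
    symm
    exact coef_kd _ _ _ (fun j x => LinearMap.congr_fun (hFH i j) _) x

lemma dd1_exact {F : α → Module.End k M} {dα : α → Δ} {dβ : β → Δ}
    {G : Δ → Submodule k M} {d : Δ} {p q : ℕ}
    (h : ∀ U : Finset β, U.card = q → KEx F dα G p (d - ∑ i ∈ U, dβ i)) :
    ExAt (KY dα dβ G d (p + 1) q) (KY dα dβ G d p q) (dd1 β F) := by
  intro c hc hdc
  have key : ∀ U : Finset β, ∃ b : Finset α → M,
      (U.card = q → b ∈ KP dα G (p + 1) (d - ∑ i ∈ U, dβ i)) ∧ (U.card ≠ q → b = 0) ∧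
      kd F b = fun T => c T U := by
    intro U
    by_cases hU : U.card = q
    · obtain ⟨b, hb, hb'⟩ := h U hU (fun T => c T U)
        (fun T => ⟨fun hT => by
          have := (((hc T).1 hT) U).1 hU
          rwa [sub_right_comm] at this, fun hT => by simp [(hc T).2 hT]⟩)
        (by
          funext T
          rw [← dd1_apply, hdc]; rfl)
      exact ⟨b, fun _ => hb, fun h => absurd hU h, hb'⟩
    · refine ⟨0, fun h => absurd h hU, fun _ => rfl, ?_⟩
      rw [map_zero]
      funext T
      by_cases hT : T.card = p
      · exact ((((hc T).1 hT) U).2 hU).symm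
      · simp [(hc T).2 hT]
  choose b hb1 hb2 hb3 using key
  refine ⟨fun T U => b U T, fun T => ⟨fun hT U => ⟨fun hU => ?_, fun hU => ?_⟩, fun hT => ?_⟩, ?_⟩
  · have := (hb1 U hU T).1 hT
    rwa [sub_right_comm] at this
  · simp [hb2 U hU]
  · funext U
    by_cases hU : U.card = q
    · exact (hb1 U hU T).2 hT
    · simp [hb2 U hU]
  · funext T U
    rw [dd1_apply]
    exact congrFun (hb3 U) T

lemma dd2_exact {H : β → Module.End k M} {dα : α → Δ} {dβ : β → Δ}
    {G : Δ → Submodule k M} {d : Δ} {p q : ℕ}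
    (h : ∀ T : Finset α, T.card = p → KEx H dβ G q (d - ∑ i ∈ T, dα i)) :
    ExAt (KY dα dβ G d p (q + 1)) (KY dα dβ G d p q) (dd2 α H) := by
  intro c hc hdc
  have key : ∀ T : Finset α, ∃ b : Finset β → M,
      (T.card = p → b ∈ KP dβ G (q + 1) (d - ∑ i ∈ T, dα i)) ∧ (T.card ≠ p → b = 0) ∧
      kd H b = c T := by
    intro T
    by_cases hT : T.card = p
    · obtain ⟨b, hb, hb'⟩ := h T hT (c T) ((hc T).1 hT) (congrFun hdc T)
      exact ⟨b, fun _ => hb, fun h => absurd hT h, hb'⟩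
    · exact ⟨0, fun h => absurd h hT, fun _ => rfl, by rw [map_zero, (hc T).2 hT]⟩
  choose b hb1 hb2 hb3 using key
  exact ⟨b, fun T => ⟨hb1 T, hb2 T⟩, funext hb3⟩

end KDC

section Edge

variable {k M N α β Δ : Type*} [CommRing k] [AddCommGroup M] [Module k M] [AddCommGroup N]
  [Module k N] [LinearOrder α] [Fintype α] [LinearOrder β] [Fintype β] [AddCommGroup Δ]
  {F : α → Module.End k M} {H : β → Module.End k M} {dα : α → Δ} {dβ : β → Δ}
  {G : Δ → Submodule k M} {F' : α → Module.End k N} {G' : Δ → Submodule k N} {π : M →ₗ[k] N}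

/-- The augmentation of the double complex. -/
def aug (α β : Type*) (π : M →ₗ[k] N) : (Finset α → Finset β → M) →ₗ[k] (Finset α → N) :=
  coef (π ∘ₗ LinearMap.proj ∅)

@[simp] lemma aug_apply (c : Finset α → Finset β → M) (T : Finset α) :
    aug α β π c T = π (c T ∅) := rfl

lemma aug_dd1 (hπF : ∀ i x, π (F i x) = F' i (π x)) (c : Finset α → Finset β → M) :
    aug α β π (dd1 β F c) = kd F' (aug α β π c) :=
  coef_kd (fun i => (coef (F i) : Module.End k (Finset β → M))) F'
    (π ∘ₗ LinearMap.proj ∅) (fun i _ => hπF i _) c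

lemma aug_dd2 (hπH : ∀ j x, π (H j x) = 0) (c : Finset α → Finset β → M) :
    aug α β π (dd2 α H c) = 0 := by
  funext T
  simp only [aug_apply, coef_apply, kd_apply, map_sum, hπH, Finset.sum_const_zero, Pi.zero_apply]

lemma exists_aug_eq {d : Δ} {i : ℕ} {x : Finset α → N} (hx : x ∈ KP dα G' i d)
    (hs : ∀ T : Finset α, T.card = i → ∀ y ∈ G' (d - ∑ j ∈ T, dα j),
      ∃ z ∈ G (d - ∑ j ∈ T, dα j), π z = y) :
    ∃ u ∈ KY dα dβ G d i 0, aug α β π u = x := by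
  have key : ∀ T : Finset α, ∃ z : M, (T.card = i → z ∈ G (d - ∑ j ∈ T, dα j)) ∧
      (T.card ≠ i → z = 0) ∧ π z = x T := by
    intro T
    by_cases hT : T.card = i
    · obtain ⟨z, hz, hz'⟩ := hs T hT _ ((hx T).1 hT)
      exact ⟨z, fun _ => hz, fun h => absurd hT h, hz'⟩
    · exact ⟨0, fun h => absurd h hT, fun _ => rfl, by rw [map_zero, (hx T).2 hT]⟩
  choose z h1 h2 h3 using key
  refine ⟨fun T U => if U = ∅ then z T else 0, fun T => ⟨fun hT U => ⟨fun hU => ?_, fun hU => ?_⟩,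
    fun hT => ?_⟩, ?_⟩
  · obtain rfl := Finset.card_eq_zero.1 hU
    simpa using h1 T hT
  · refine if_neg ?_
    rintro rfl
    exact hU rfl
  · funext U
    simp [h2 T hT]
  · funext T
    simp [h3]

lemma exists_dd2_eq {d : Δ} {i : ℕ} {u : Finset α → Finset β → M} (hu : u ∈ KY dα dβ G d i 0)
    (hau : aug α β π u = 0)
    (hs : ∀ T : Finset α, T.card = i → ∀ y ∈ G (d - ∑ j ∈ T, dα j), π y = 0 →
      ∃ b ∈ KP dβ G 1 (d - ∑ j ∈ T, dα j), kd H b ∅ = y)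
    (hHG : ∀ i e x, x ∈ G e → H i x ∈ G (e + dβ i)) :
    ∃ v ∈ KY dα dβ G d i 1, dd2 α H v = u := by
  have key : ∀ T : Finset α, ∃ b : Finset β → M,
      (T.card = i → b ∈ KP dβ G 1 (d - ∑ j ∈ T, dα j)) ∧
      (T.card ≠ i → b = 0) ∧ kd H b = u T := by
    intro T
    by_cases hT : T.card = i
    · obtain ⟨b, hb, hb'⟩ := hs T hT (u T ∅) (by simpa using (((hu T).1 hT) ∅).1 rfl)
        (congrFun hau T)
      refine ⟨b, fun _ => hb, fun h => absurd hT h, ?_⟩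
      funext U
      by_cases hU : U.card = 0
      · rw [Finset.card_eq_zero.1 hU, hb']
      · rw [(((hu T).1 hT) U).2 hU, (kd_mem hHG hb U).2 hU]
    · exact ⟨0, fun h => absurd h hT, fun _ => rfl, by rw [map_zero, (hu T).2 hT]⟩
  choose b hb1 hb2 hb3 using key
  exact ⟨b, fun T => ⟨hb1 T, hb2 T⟩, funext hb3⟩

/-- Transfer of exactness from a double complex to its augmentation; the spot `(0, i)` is only
required to be exact up to total cycles with trivial augmentation. -/
lemma edge_exact' (hF : ∀ i j, Commute (F i) (F j)) (hH : ∀ i j, Commute (H i) (H j))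
    (hFH : ∀ i j, Commute (F i) (H j))
    (hFG : ∀ i e x, x ∈ G e → F i x ∈ G (e + dα i))
    (hHG : ∀ i e x, x ∈ G e → H i x ∈ G (e + dβ i))
    (hπG : ∀ e x, x ∈ G e → π x ∈ G' e)
    (hπF : ∀ i x, π (F i x) = F' i (π x)) (hπH : ∀ j x, π (H j x) = 0) {i : ℕ} {d : Δ}
    (hsurj : ∀ T : Finset α, T.card = i → ∀ y ∈ G' (d - ∑ j ∈ T, dα j),
      ∃ z ∈ G (d - ∑ j ∈ T, dα j), π z = y)
    (hker : ∀ T : Finset α, T.card + 1 = i → ∀ y ∈ G (d - ∑ j ∈ T, dα j), π y = 0 →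
      ∃ b ∈ KP dβ G 1 (d - ∑ j ∈ T, dα j), kd H b ∅ = y)
    (h2 : ∀ T : Finset α, ∀ q, 1 ≤ q → T.card + q + 1 = i → KEx H dβ G q (d - ∑ j ∈ T, dα j))
    (h1 : ∀ U : Finset β, ∀ p, 1 ≤ p → p + U.card = i → KEx F dα G p (d - ∑ j ∈ U, dβ j))
    (h0 : ∀ u ∈ KY dα dβ G d 0 i, ∃ t : ℕ → Finset α → Finset β → M,
      (∀ p q, p + q = i → t p ∈ KY dα dβ G d p q) ∧
      (∀ p, p < i → dd1 β F (t (p + 1)) = dd2 α H (t p)) ∧ aug α β π (t i) = 0 ∧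
      ∃ w ∈ KY dα dβ G d 1 i, u = dd1 β F w + t 0) :
    KEx F' dα G' i d := by
  have hdc := kdc_DC hF hH hFH hFG hHG d
  have hd1 : ∀ p q, p + q = i → 1 ≤ p →
      ExAt (KY dα dβ G d (p + 1) q) (KY dα dβ G d p q) (dd1 β F) := fun p q hpq hp =>
    dd1_exact fun U hU => h1 U p hp (by omega)
  have hd2 : ∀ p q, p + q + 1 = i → 1 ≤ q →
      ExAt (KY dα dβ G d p (q + 1)) (KY dα dβ G d p q) (dd2 α H) := fun p q hpq hq =>
    dd2_exact fun T hT => h2 T q hq (by omega)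
  -- the splitting with corrections by total cycles
  have main : ∀ p q u, p + q = i → u ∈ KY dα dβ G d p q → dd2 α H (dd1 β F u) = 0 →
      (1 ≤ q ∨ p = 0) → ∃ t : ℕ → Finset α → Finset β → M,
      (∀ p q, p + q = i → t p ∈ KY dα dβ G d p q) ∧
      (∀ p, p < i → dd1 β F (t (p + 1)) = dd2 α H (t p)) ∧ aug α β π (t i) = 0 ∧
      ∃ w ∈ KY dα dβ G d (p + 1) q, ∃ v ∈ KY dα dβ G d p (q + 1),
        u = dd1 β F w + dd2 α H v + t p := by
    intro p
    induction p with
    | zero =>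
      intro q u hpq hu _ _
      obtain rfl : q = i := by omega
      obtain ⟨t, ht1, ht2, ht3, w, hw, e⟩ := h0 u hu
      exact ⟨t, ht1, ht2, ht3, w, hw, 0, zero_mem _, by simpa using e⟩
    | succ p ih =>
      intro q u hpq hu hdu hq
      obtain ⟨u', hu', e⟩ := hd2 p q (by omega) (by omega) _ (hdc.m1 _ _ _ hu) hdu
      obtain ⟨t, ht1, ht2, ht3, w', hw', v', hv', e'⟩ := ih (q + 1) u' (by omega) hu'
        (by rw [← hdc.comm, e, hdc.sq1]) (by omega)
      obtain ⟨w, hw, e''⟩ := hd1 (p + 1) q (by omega) (by omega)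
        (u - dd2 α H w' - t (p + 1))
        (sub_mem (sub_mem hu (hdc.m2 _ _ _ hw')) (ht1 _ _ hpq))
        (by
          rw [map_sub, map_sub, ← e, e', ht2 p (by omega), map_add, map_add, hdc.sq2,
            hdc.comm]
          abel)
      exact ⟨t, ht1, ht2, ht3, w, hw, w', hw', by rw [e'']; abel⟩
  intro x hx hdx
  obtain ⟨u, hu, rfl⟩ := exists_aug_eq (dβ := dβ) hx hsurj
  suffices hu' : ∃ w ∈ KY dα dβ G d (i + 1) 0, aug α β π u = aug α β π (dd1 β F w) by
    obtain ⟨w, hw, e⟩ := hu'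
    refine ⟨aug α β π w, fun T => ⟨fun hT => hπG _ _ ?_, fun hT => by simp [(hw T).2 hT]⟩, ?_⟩
    · simpa using (((hw T).1 hT) ∅).1 rfl
    · rw [e, aug_dd1 hπF]
  obtain _ | i := i
  · obtain ⟨t, -, -, ht, w, hw, e⟩ := h0 u hu
    exact ⟨w, hw, by rw [e, map_add, ht, add_zero]⟩
  · obtain ⟨u', hu', e⟩ := exists_dd2_eq (π := π) (hdc.m1 _ _ _ hu) (by rw [aug_dd1 hπF, hdx])
      (fun T hT => hker T (by omega)) hHG
    obtain ⟨t, ht1, ht2, ht3, w', hw', v', hv', e'⟩ := main i 1 u' rfl hu'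
      (by rw [← hdc.comm, e, hdc.sq1]) (by omega)
    obtain ⟨w, hw, e''⟩ := hd1 (i + 1) 0 (by omega) (by omega)
      (u - dd2 α H w' - t (i + 1))
      (sub_mem (sub_mem hu (hdc.m2 _ _ _ hw')) (ht1 _ _ rfl))
      (by
        rw [map_sub, map_sub, ← e, e', ht2 i (by omega), map_add, map_add, hdc.sq2,
          hdc.comm]
        abel)
    exact ⟨w, hw, by rw [e'', map_sub, map_sub, aug_dd2 hπH, ht3, sub_zero, sub_zero]⟩

lemma edge_exact (hF : ∀ i j, Commute (F i) (F j)) (hH : ∀ i j, Commute (H i) (H j))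
    (hFH : ∀ i j, Commute (F i) (H j))
    (hFG : ∀ i e x, x ∈ G e → F i x ∈ G (e + dα i))
    (hHG : ∀ i e x, x ∈ G e → H i x ∈ G (e + dβ i))
    (hπG : ∀ e x, x ∈ G e → π x ∈ G' e)
    (hπF : ∀ i x, π (F i x) = F' i (π x)) (hπH : ∀ j x, π (H j x) = 0) {i : ℕ} {d : Δ}
    (hsurj : ∀ T : Finset α, T.card = i → ∀ y ∈ G' (d - ∑ j ∈ T, dα j),
      ∃ z ∈ G (d - ∑ j ∈ T, dα j), π z = y)
    (hker : ∀ T : Finset α, T.card + 1 = i → ∀ y ∈ G (d - ∑ j ∈ T, dα j), π y = 0 →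
      ∃ b ∈ KP dβ G 1 (d - ∑ j ∈ T, dα j), kd H b ∅ = y)
    (h2 : ∀ T : Finset α, ∀ q, 1 ≤ q → T.card + q + 1 = i → KEx H dβ G q (d - ∑ j ∈ T, dα j))
    (h1 : ∀ U : Finset β, ∀ p, p + U.card = i → KEx F dα G p (d - ∑ j ∈ U, dβ j)) :
    KEx F' dα G' i d := by
  refine edge_exact' hF hH hFH hFG hHG hπG hπF hπH hsurj hker h2 (fun U p _ => h1 U p)
    fun u hu => ?_
  obtain ⟨w, hw, e⟩ := dd1_exact (q := i) (fun U hU => h1 U 0 (by omega)) u hu (kd_zero hu)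
  exact ⟨0, fun _ _ _ => zero_mem _, fun _ _ => by simp, by simp, w, hw, by simp [e]⟩

end Edge

section TopEdge

variable {k M α β Δ : Type*} [CommRing k] [AddCommGroup M] [Module k M] [LinearOrder α]
  [Fintype α] [LinearOrder β] [Fintype β] [AddCommGroup Δ]
  {F : α → Module.End k M} {H : β → Module.End k M} {dα : α → Δ} {dβ : β → Δ}
  {G : Δ → Submodule k M}

/-- Transfer of exactness to the top edge `K(F)_i ⊗ e_β` of the double complex. -/
lemma top_edge_exact (hF : ∀ i j, Commute (F i) (F j)) (hH : ∀ i j, Commute (H i) (H j))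
    (hFH : ∀ i j, Commute (F i) (H j))
    (hFG : ∀ i e x, x ∈ G e → F i x ∈ G (e + dα i))
    (hHG : ∀ i e x, x ∈ G e → H i x ∈ G (e + dβ i)) {i : ℕ} {d : Δ}
    (h1 : ∀ U : Finset β, ∀ p, p + U.card + 1 = i + Fintype.card β → U.card < Fintype.card β →
      KEx F dα G p (d + ∑ j, dβ j - ∑ j ∈ U, dβ j))
    (h2 : ∀ T : Finset α, ∀ q, T.card + q = i + Fintype.card β → i ≤ T.card →
      KEx H dβ G q (d + ∑ j, dβ j - ∑ j ∈ T, dα j)) :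
    KEx F dα G i d := by
  intro c hc hdc
  have hdc' := (kdc_DC hF hH hFH hFG hHG (d + ∑ j, dβ j)).swap
  let u : Finset α → Finset β → M := fun T U => if U = Finset.univ then c T else 0
  have hu : u ∈ KY dα dβ G (d + ∑ j, dβ j) i (Fintype.card β) := by
    refine fun T => ⟨fun hT U => ⟨fun hU => ?_, fun hU => if_neg ?_⟩, fun hT => ?_⟩
    · obtain rfl := (Finset.card_eq_iff_eq_univ U).1 hU
      simp only [u, if_true]
      rw [sub_right_comm, add_sub_cancel_right]
      exact (hc T).1 hT
    · rintro rfl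
      exact hU Finset.card_univ
    · funext U
      simp [u, (hc T).2 hT]
  have hdu : dd1 β F u = 0 := by
    funext T U
    rw [dd1_apply]
    by_cases hU : U = Finset.univ
    · simp only [u, hU, if_true]
      exact congrFun hdc T
    · simp only [u, hU, if_false]
      exact congrFun (map_zero (kd F)) T
  obtain ⟨v, hv, w, hw, e⟩ := hdc'.split (Fintype.card β) i u hu
    (by rw [← hdc'.comm, hdu, map_zero])
    (fun q p h h' => dd1_exact fun U hU => h1 U p (by omega) (by omega))
    (fun q p h h' => dd2_exact fun T hT => h2 T q (by omega) (by omega))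
  have hv0 : dd2 α H v = 0 := by
    have : v = 0 := by
      funext T
      by_cases hT : T.card = i
      · funext U
        exact (((hv T).1 hT) U).2 (by have := Finset.card_le_univ U; omega)
      · exact (hv T).2 hT
    rw [this, map_zero]
  rw [hv0, zero_add] at e
  refine ⟨fun T => w T Finset.univ, fun T => ⟨fun hT => ?_, fun hT => by simp [(hw T).2 hT]⟩, ?_⟩
  · have := (((hw T).1 hT) Finset.univ).1 Finset.card_univ
    rwa [sub_right_comm, add_sub_cancel_right] at this
  · funext T
    rw [← dd1_apply, ← e]
    simp [u]

end TopEdge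

end Koszul

namespace Koszul

section Reduction

variable {k M α Δ : Type*} [CommRing k] [AddCommGroup M] [Module k M] [LinearOrder α]
  [Fintype α] [AddCommGroup Δ] {F D : α → Module.End k M} {deg : α → Δ} {G : Δ → Submodule k M}

/-- Reduction of a cycle by left inverses of some of the operators. -/
lemma exists_reduced (hF : ∀ i j, Commute (F i) (F j)) (hDF : ∀ i x, D i (F i x) = x)
    (hFD : ∀ i j, i ≠ j → Commute (F i) (D j)) (hD : ∀ i j, Commute (D i) (D j))
    (hFG : ∀ i e x, x ∈ G e → F i x ∈ G (e + deg i)) (s : Finset α)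
    (hDG : ∀ i ∈ s, ∀ e x, x ∈ G e → D i x ∈ G (e - deg i)) {p : ℕ} {d : Δ} {c : Finset α → M}
    (hc : c ∈ KP deg G p d) (hdc : kd F c = 0) :
    ∃ b ∈ KP deg G (p + 1) d, (∀ i ∈ s, ∀ T, i ∈ T → c T = kd F b T) ∧
      (∀ i ∈ s, ∀ T, D i (c T - kd F b T) = 0) := by
  induction s using Finset.induction_on with
  | empty => exact ⟨0, zero_mem _, by simp, by simp⟩
  | insert i s hi ih =>
    obtain ⟨b, hb, h1, h2⟩ := ih fun j hj => hDG j (Finset.mem_insert_of_mem hj)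
    set c' := c - kd F b with hc'
    have hc'm : c' ∈ KP deg G p d := sub_mem hc (kd_mem hFG hb)
    have hdc' : kd F c' = 0 := by rw [hc', map_sub, hdc, kd_kd F hF, sub_zero]
    have hw : wedge k M i (coef (D i) c') ∈ KP deg G (p + 1) d := by
      have := wedge_mem (KP_coef (e := -deg i) (D i) (fun e x hx => by
        rw [← sub_eq_add_neg]
        exact hDG i (Finset.mem_insert_self _ _) e x hx) hc'm) i
      rwa [neg_add_cancel_right] at this
    have key : ∀ T, kd F (wedge k M i (coef (D i) c')) T =
        if i ∈ T then c' T else F i (D i (c' T)) := by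
      intro T
      have := kd_wedge_add F i (D i) (fun j hj => hFD j i hj) c' T
      rw [hdc', map_zero, map_zero, Pi.zero_apply, add_zero, hDF] at this
      exact this
    refine ⟨b + wedge k M i (coef (D i) c'), add_mem hb hw, ?_, ?_⟩
    · intro j hj T hT
      rw [map_add, Pi.add_apply, key]
      rcases Finset.mem_insert.1 hj with rfl | hj
      · rw [if_pos hT]
        simp [hc']
      · have h0 : c' T = 0 := by simp [hc', h1 j hj T hT]
        rw [h0, map_zero, map_zero, ite_self, add_zero, h1 j hj T hT]
    · intro j hj T
      have e : c T - kd F (b + wedge k M i (coef (D i) c')) T =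
          c' T - if i ∈ T then c' T else F i (D i (c' T)) := by
        rw [map_add, Pi.add_apply, key, ← sub_sub]; rfl
      rw [e]
      split_ifs
      · simp
      rcases Finset.mem_insert.1 hj with rfl | hj'
      · rw [map_sub, hDF, sub_self]
      · have hji : i ≠ j := by rintro rfl; exact hi hj'
        have h3 : D j (F i (D i (c' T))) = F i (D i (D j (c' T))) := by
          have h5 : D i (D j (c' T)) = D j (D i (c' T)) := LinearMap.congr_fun (hD i j) (c' T)
          rw [h5]
          exact (LinearMap.congr_fun (hFD i j hji) _).symm
        have h4 : D j (c' T) = 0 := h2 j hj' T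
        rw [map_sub, h3, h4, map_zero, map_zero, sub_zero]

end Reduction

end Koszul

namespace ResInt

open Koszul

/-- Multiplication by an element. -/
def op (k : Type*) {A : Type*} [CommRing k] [CommRing A] [Algebra k A] (a : A) :
    Module.End k A := LinearMap.mulLeft k a

@[simp] lemma op_apply {k A : Type*} [CommRing k] [CommRing A] [Algebra k A] (a b : A) :
    op k a b = a * b := rfl

lemma op_commute {k A : Type*} [CommRing k] [CommRing A] [Algebra k A] (a b : A) :
    Commute (op k a) (op k b) := LinearMap.ext fun x => mul_left_comm a b x

variable {k : Type} [Field k] {n p : ℕ}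

/-- The bidegree of a monomial. -/
def mdeg (μ : Fin n ⊕ Fin p →₀ ℕ) : ℤ × ℤ :=
  ((∑ i, μ (Sum.inl i) : ℕ), (∑ i, μ (Sum.inr i) : ℕ))

lemma weight_bideg (μ : Fin n ⊕ Fin p →₀ ℕ) : Finsupp.weight (bideg n p) μ = mdeg μ := by
  rw [Finsupp.weight_apply, Finsupp.sum_fintype _ _ (by simp)]
  simp [bideg, mdeg, Prod.ext_iff, Prod.fst_sum, Prod.snd_sum]

lemma mem_piece {d : ℤ × ℤ} {f : PolyS k n p} :
    f ∈ piece k n p d ↔ ∀ μ, coeff μ f ≠ 0 → mdeg μ = d := by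
  simp only [← weight_bideg]
  exact Iff.rfl

lemma mdeg_add (μ ν : Fin n ⊕ Fin p →₀ ℕ) : mdeg (μ + ν) = mdeg μ + mdeg ν := by
  simp [mdeg, Finset.sum_add_distrib]

lemma mdeg_zero : mdeg (0 : Fin n ⊕ Fin p →₀ ℕ) = 0 := by
  simp [mdeg]

lemma mdeg_single (s : Fin n ⊕ Fin p) (N : ℕ) :
    mdeg (Finsupp.single s N) = N • bideg n p s := by
  rw [← weight_bideg, Finsupp.weight_single]

lemma mdeg_nonneg (μ : Fin n ⊕ Fin p →₀ ℕ) : 0 ≤ (mdeg μ).1 ∧ 0 ≤ (mdeg μ).2 :=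
  ⟨Int.natCast_nonneg _, Int.natCast_nonneg _⟩

lemma mul_mem_piece {d e : ℤ × ℤ} {f g : PolyS k n p} (hf : f ∈ piece k n p d)
    (hg : g ∈ piece k n p e) : f * g ∈ piece k n p (d + e) :=
  IsWeightedHomogeneous.mul hf hg

lemma X_mem_piece (s : Fin n ⊕ Fin p) : (X s : PolyS k n p) ∈ piece k n p (bideg n p s) :=
  isWeightedHomogeneous_X _ _ _

lemma X_pow_mem_piece (s : Fin n ⊕ Fin p) (N : ℕ) :
    (X s ^ N : PolyS k n p) ∈ piece k n p (N • bideg n p s) :=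
  (isWeightedHomogeneous_X _ _ _).pow N

lemma C_mem_piece (a : k) : (C a : PolyS k n p) ∈ piece k n p 0 := isWeightedHomogeneous_C _ _

lemma piece_eq_bot {d : ℤ × ℤ} (hd : d.1 < 0 ∨ d.2 < 0) {f : PolyS k n p}
    (hf : f ∈ piece k n p d) : f = 0 := by
  ext μ
  by_contra h
  have h1 := mem_piece.1 hf μ h
  have := mdeg_nonneg μ
  rw [h1] at this
  omega

/-- Division by a power of a variable. -/
def divX (k : Type) [Field k] {n p : ℕ} (s : Fin n ⊕ Fin p) (N : ℕ) :
    Module.End k (PolyS k n p) where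
  toFun f := divMonomial f (Finsupp.single s N)
  map_add' f g := add_divMonomial f g _
  map_smul' r f := by
    ext μ
    simp

@[simp] lemma coeff_divX (s : Fin n ⊕ Fin p) (N : ℕ) (f : PolyS k n p)
    (μ : Fin n ⊕ Fin p →₀ ℕ) : coeff μ (divX k s N f) = coeff (Finsupp.single s N + μ) f := rfl

lemma divX_X_pow_mul (s : Fin n ⊕ Fin p) (N : ℕ) (f : PolyS k n p) :
    divX k s N (X s ^ N * f) = f := by
  rw [X_pow_eq_monomial]
  exact divMonomial_monomial_mul _ _

lemma commute_X_pow_divX {s t : Fin n ⊕ Fin p} (hst : s ≠ t) (N N' : ℕ) :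
    Commute (op k (X s ^ N : PolyS k n p)) (divX k t N') := by
  refine LinearMap.ext fun f => ?_
  change X s ^ N * divX k t N' f = divX k t N' (X s ^ N * f)
  ext μ
  rw [coeff_divX, X_pow_eq_monomial, coeff_monomial_mul', coeff_monomial_mul']
  have h1 : Finsupp.single s N ≤ Finsupp.single t N' + μ ↔ Finsupp.single s N ≤ μ := by
    rw [Finsupp.single_le_iff, Finsupp.single_le_iff, Finsupp.add_apply,
      Finsupp.single_eq_of_ne hst, zero_add]
  by_cases h : Finsupp.single s N ≤ μ
  · rw [if_pos h, if_pos (h1.2 h), coeff_divX, add_tsub_assoc_of_le h]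
  · rw [if_neg h, if_neg (h1.not.2 h)]

lemma commute_divX (s t : Fin n ⊕ Fin p) (N N' : ℕ) : Commute (divX k s N) (divX k t N') := by
  refine LinearMap.ext fun f => ?_
  change divX k s N (divX k t N' f) = divX k t N' (divX k s N f)
  ext μ
  simp only [coeff_divX]
  rw [add_left_comm]

lemma divX_mem_piece (s : Fin n ⊕ Fin p) (N : ℕ) {e : ℤ × ℤ} {f : PolyS k n p}
    (hf : f ∈ piece k n p e) : divX k s N f ∈ piece k n p (e - N • bideg n p s) := by
  rw [mem_piece] at hf ⊢
  intro μ hμ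
  have := hf _ hμ
  rw [mdeg_add, mdeg_single] at this
  rw [← this, add_sub_cancel_left]

lemma lt_of_divX_eq_zero {s : Fin n ⊕ Fin p} {N : ℕ} {f : PolyS k n p} (h : divX k s N f = 0)
    {μ : Fin n ⊕ Fin p →₀ ℕ} (hμ : coeff μ f ≠ 0) : μ s < N := by
  by_contra! hN
  apply hμ
  have h1 : Finsupp.single s N + (μ - Finsupp.single s N) = μ :=
    add_tsub_cancel_of_le (Finsupp.single_le_iff.2 hN)
  rw [← h1, ← coeff_divX, h, coeff_zero]

/-- Truncation of a graded family to first degree at least `c`. -/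
def trunc (c : ℤ) {M : Type*} [AddCommGroup M] [Module k M] (G : ℤ × ℤ → Submodule k M)
    (e : ℤ × ℤ) : Submodule k M := if c ≤ e.1 then G e else ⊥

lemma trunc_of_le {c : ℤ} {M : Type*} [AddCommGroup M] [Module k M]
    {G : ℤ × ℤ → Submodule k M} {e : ℤ × ℤ} (h : c ≤ e.1) : trunc c G e = G e := if_pos h

lemma trunc_of_lt {c : ℤ} {M : Type*} [AddCommGroup M] [Module k M]
    {G : ℤ × ℤ → Submodule k M} {e : ℤ × ℤ} (h : e.1 < c) : trunc c G e = ⊥ :=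
  if_neg (not_le.2 h)

lemma trunc_le {c : ℤ} {M : Type*} [AddCommGroup M] [Module k M]
    {G : ℤ × ℤ → Submodule k M} (e : ℤ × ℤ) : trunc c G e ≤ G e := by
  unfold trunc
  split_ifs
  · exact le_rfl
  · exact bot_le

lemma trunc_map {c : ℤ} {M N : Type*} [AddCommGroup M] [Module k M] [AddCommGroup N] [Module k N]
    {G : ℤ × ℤ → Submodule k M} {G' : ℤ × ℤ → Submodule k N} (g : M →ₗ[k] N) {e δ : ℤ × ℤ}
    (hδ : 0 ≤ δ.1)
    (h : ∀ x ∈ G e, g x ∈ G' (e + δ)) (x : M) (hx : x ∈ trunc c G e) :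
    g x ∈ trunc c G' (e + δ) := by
  by_cases hc : c ≤ e.1
  · rw [trunc_of_le hc] at hx
    rw [trunc_of_le (by simpa using by omega)]
    exact h x hx
  · rw [trunc_of_lt (not_le.1 hc)] at hx
    rw [(Submodule.mem_bot k).1 hx, map_zero]
    exact zero_mem _

/-- The index type of all variables, linearly ordered. -/
abbrev Vars (n p : ℕ) : Type := Fin n ⊕ₗ Fin p

/-- Degrees of the Koszul generators for the variables. -/
def vdeg (n p : ℕ) (i : Vars n p) : ℤ × ℤ := bideg n p (ofLex i)

/-- Degrees of the Koszul generators for the `N`-th powers of the `x`-variables. -/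
def xdeg (n N : ℕ) (_ : Fin n) : ℤ × ℤ := ((N : ℤ), 0)

/-- The `N`-th powers of the `x`-variables acting on `S`. -/
def xop (k : Type) [Field k] (n p N : ℕ) (i : Fin n) : Module.End k (PolyS k n p) :=
  op k (X (Sum.inl i) ^ N)

/-- The variables acting on `S`. -/
def vop (k : Type) [Field k] (n p : ℕ) (i : Vars n p) : Module.End k (PolyS k n p) :=
  op k (X (ofLex i))

lemma smul_bideg_inl (N : ℕ) (i : Fin n) : N • bideg n p (Sum.inl i) = xdeg n N i := by
  simp [bideg, xdeg]

lemma xop_mem (N : ℕ) (i : Fin n) (e : ℤ × ℤ) (x : PolyS k n p) (hx : x ∈ piece k n p e) :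
    xop k n p N i x ∈ piece k n p (e + xdeg n N i) := by
  rw [add_comm, ← smul_bideg_inl (p := p)]
  exact mul_mem_piece (X_pow_mem_piece _ _) hx

lemma vop_mem (i : Vars n p) (e : ℤ × ℤ) (x : PolyS k n p) (hx : x ∈ piece k n p e) :
    vop k n p i x ∈ piece k n p (e + vdeg n p i) := by
  rw [add_comm]
  exact mul_mem_piece (X_mem_piece _) hx

lemma x_reduced (N q : ℕ) {d : ℤ × ℤ} {c : Finset (Fin n) → PolyS k n p}
    (hc : c ∈ KP (xdeg n N) (piece k n p) q d) (hdc : kd (xop k n p N) c = 0) :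
    ∃ b ∈ KP (xdeg n N) (piece k n p) (q + 1) d,
      (∀ T, T.Nonempty → c T = kd (xop k n p N) b T) ∧
      (∀ i T, divX k (Sum.inl i) N (c T - kd (xop k n p N) b T) = 0) := by
  obtain ⟨b, hb, h1, h2⟩ := exists_reduced (F := xop k n p N)
    (D := fun i => divX k (Sum.inl i) N) (fun i j => op_commute _ _)
    (fun i x => divX_X_pow_mul _ _ _)
    (fun i j hij => commute_X_pow_divX (by simpa using hij) _ _) (fun i j => commute_divX _ _ _ _)
    (xop_mem N) Finset.univ
    (fun i _ e x hx => by
      rw [← smul_bideg_inl (p := p)]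
      exact divX_mem_piece _ _ hx) hc hdc
  exact ⟨b, hb, fun T ⟨i, hi⟩ => h1 i (Finset.mem_univ _) T hi, fun i => h2 i (Finset.mem_univ _)⟩

lemma kex_x (N q : ℕ) (d : ℤ × ℤ) (h : 1 ≤ q ∨ (n * (N - 1) : ℕ) < d.1) :
    KEx (xop k n p N) (xdeg n N) (piece k n p) q d := by
  intro c hc hdc
  obtain ⟨b, hb, h1, h2⟩ := x_reduced N q hc hdc
  refine ⟨b, hb, ?_⟩
  have hm := sub_mem hc (kd_mem (xop_mem N) hb)
  funext T
  by_cases hT : T.Nonempty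
  · exact (h1 T hT).symm
  rw [Finset.not_nonempty_iff_eq_empty] at hT
  subst hT
  symm
  rw [← sub_eq_zero]
  rcases Nat.eq_zero_or_pos q with rfl | hq
  · have hm' := (hm ∅).1 rfl
    ext μ
    by_contra hμ
    have h3 : (mdeg μ).1 = d.1 := by
      rw [mem_piece.1 hm' μ hμ]; simp
    have h4 : ∑ i : Fin n, μ (Sum.inl i) ≤ ∑ i : Fin n, (N - 1) :=
      Finset.sum_le_sum fun i _ => by
        have := lt_of_divX_eq_zero (h2 i ∅) hμ
        omega
    simp only [Finset.sum_const, Finset.card_univ, Fintype.card_fin, smul_eq_mul] at h4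
    simp only [mdeg] at h3
    omega
  · exact (hm ∅).2 (by simp; omega)

lemma trunc_vop_mem (c0 : ℤ) (i : Vars n p) (e : ℤ × ℤ) (x : PolyS k n p)
    (hx : x ∈ trunc c0 (piece k n p) e) :
    vop k n p i x ∈ trunc c0 (piece k n p) (e + vdeg n p i) := by
  refine trunc_map _ ?_ (fun x hx => vop_mem i e x hx) x hx
  unfold vdeg
  rcases ofLex i with j | j <;> simp [bideg]

lemma v_reduced (s : Finset (Vars n p)) (q : ℕ) {d : ℤ × ℤ} {G : ℤ × ℤ → Submodule k (PolyS k n p)}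
    (hG : ∀ i e x, x ∈ G e → vop k n p i x ∈ G (e + vdeg n p i))
    (hDG : ∀ i ∈ s, ∀ e, ∀ x ∈ G e, divX k (ofLex i) 1 x ∈ G (e - vdeg n p i))
    {c : Finset (Vars n p) → PolyS k n p}
    (hc : c ∈ KP (vdeg n p) G q d) (hdc : kd (vop k n p) c = 0) :
    ∃ b ∈ KP (vdeg n p) G (q + 1) d,
      (∀ i ∈ s, ∀ T, i ∈ T → c T = kd (vop k n p) b T) ∧
      (∀ i ∈ s, ∀ T, divX k (ofLex i) 1 (c T - kd (vop k n p) b T) = 0) := by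
  refine exists_reduced (F := vop k n p)
    (D := fun i => divX k (ofLex i) 1) (fun i j => op_commute _ _)
    (fun i x => ?_) (fun i j hij => ?_) (fun i j => commute_divX _ _ _ _) hG s hDG hc hdc
  · have := divX_X_pow_mul (k := k) (ofLex i) 1 x
    rwa [pow_one] at this
  · have := commute_X_pow_divX (k := k) (s := ofLex i) (t := ofLex j)
      (fun h => hij (ofLex.injective h)) 1 1
    rwa [pow_one] at this

lemma divX_vdeg_mem (i : Vars n p) (e : ℤ × ℤ) (x : PolyS k n p) (hx : x ∈ piece k n p e) :
    divX k (ofLex i) 1 x ∈ piece k n p (e - vdeg n p i) := by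
  have := divX_mem_piece (ofLex i) 1 hx
  rwa [one_smul] at this

lemma kex_v (q : ℕ) (d : ℤ × ℤ) (h : 1 ≤ q ∨ d ≠ 0) :
    KEx (vop k n p) (vdeg n p) (piece k n p) q d := by
  intro c hc hdc
  obtain ⟨b, hb, h1, h2⟩ := v_reduced Finset.univ q vop_mem (fun i _ => divX_vdeg_mem i) hc hdc
  refine ⟨b, hb, ?_⟩
  have hm := sub_mem hc (kd_mem vop_mem hb)
  funext T
  by_cases hT : T.Nonempty
  · obtain ⟨i, hi⟩ := hT
    exact (h1 i (Finset.mem_univ _) T hi).symm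
  rw [Finset.not_nonempty_iff_eq_empty] at hT
  subst hT
  symm
  rw [← sub_eq_zero]
  rcases Nat.eq_zero_or_pos q with rfl | hq
  · have hm' := (hm ∅).1 rfl
    ext μ
    by_contra hμ
    have h3 : mdeg μ = d := by
      rw [mem_piece.1 hm' μ hμ]; simp
    have h4 : μ = 0 := by
      ext s
      have := lt_of_divX_eq_zero (h2 (toLex s) (Finset.mem_univ _) ∅) hμ
      simp at this
      simpa using this
    rw [h4, mdeg_zero] at h3
    exact (h.resolve_left (by omega)) h3.symm
  · exact (hm ∅).2 (by simp; omega)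

lemma sum_vdeg (T : Finset (Vars n p)) : ∑ i ∈ T, vdeg n p i =
    (((T.filter fun i => (ofLex i).isLeft).card : ℤ),
      ((T.filter fun i => ¬ (ofLex i).isLeft).card : ℤ)) := by
  rw [Finset.card_filter, Finset.card_filter]
  push_cast
  refine Prod.ext ?_ ?_
  · rw [Prod.fst_sum]
    refine Finset.sum_congr rfl fun i _ => ?_
    unfold vdeg
    rcases ofLex i with j | j <;> simp [bideg]
  · rw [Prod.snd_sum]
    refine Finset.sum_congr rfl fun i _ => ?_
    unfold vdeg
    rcases ofLex i with j | j <;> simp [bideg]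

lemma card_left_le (T : Finset (Vars n p)) : (T.filter fun i => (ofLex i).isLeft).card ≤ n := by
  have : (T.filter fun i => (ofLex i).isLeft) ⊆
      (Finset.univ : Finset (Fin n)).image fun i => toLex (Sum.inl i) := by
    intro i hi
    rw [Finset.mem_filter] at hi
    obtain ⟨j, hj⟩ := Sum.isLeft_iff.1 hi.2
    exact Finset.mem_image.2 ⟨j, Finset.mem_univ _, by rw [← hj]; rfl⟩
  exact (Finset.card_le_card this).trans (Finset.card_image_le.trans (by simp))

lemma card_left_add (T : Finset (Vars n p)) : (T.filter fun i => (ofLex i).isLeft).card +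
    (T.filter fun i => ¬ (ofLex i).isLeft).card = T.card :=
  Finset.card_filter_add_card_filter_not _

/-- A chain in second degree zero does not involve the `y`-generators. -/
lemma mem_KP_trunc {M : Type*} [AddCommGroup M] [Module k M] {G : ℤ × ℤ → Submodule k M}
    (hG : ∀ e : ℤ × ℤ, e.2 < 0 → G e = ⊥) {r : ℕ} {d : ℤ × ℤ} {a : ℤ}
    (h : (r : ℤ) ≤ a ∨ (n : ℤ) ≤ a) {c : Finset (Vars n p) → M}
    (hc : c ∈ KP (vdeg n p) G r d) : c ∈ KP (vdeg n p) (trunc (d.1 - a) G) r d := by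
  refine fun T => ⟨fun hT => ?_, (hc T).2⟩
  have h0 := (hc T).1 hT
  have h1 := card_left_add T
  have h2 := card_left_le T
  by_cases hy : (d - ∑ i ∈ T, vdeg n p i).2 < 0
  · rw [hG _ hy, Submodule.mem_bot] at h0
    rw [h0]
    exact zero_mem _
  · rwa [trunc_of_le]
    rw [sum_vdeg]
    simp only [Prod.fst_sub]
    omega

lemma kex_v_trunc (q : ℕ) (d : ℤ × ℤ) (a : ℤ) (hd : 0 < d.1)
    (h : d.2 ≠ 0 ∨ (q : ℤ) ≠ a ∨ (n : ℤ) ≤ a) :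
    KEx (vop k n p) (vdeg n p) (trunc (d.1 - a) (piece k n p)) q d := by
  have hbot : ∀ e : ℤ × ℤ, e.2 < 0 → piece k n p e = ⊥ := fun e he => by
    rw [Submodule.eq_bot_iff]
    exact fun x hx => piece_eq_bot (Or.inr he) hx
  intro c hc hdc
  by_cases hd2 : d.2 = 0
  · by_cases hq : (q : ℤ) + 1 ≤ a ∨ (n : ℤ) ≤ a
    · obtain ⟨b, hb, e⟩ := kex_v q d (Or.inr (by rintro rfl; exact lt_irrefl _ hd)) c
        (KP_mono trunc_le _ _ hc) hdc
      exact ⟨b, mem_KP_trunc hbot (by push_cast; exact hq) hb, e⟩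
    · refine ⟨0, zero_mem _, ?_⟩
      rw [map_zero]
      symm
      funext T
      by_cases hT : T.card = q
      · have h0 := (hc T).1 hT
        have h1 := card_left_add T
        by_cases hy : (d - ∑ i ∈ T, vdeg n p i).2 < 0
        · have := trunc_le _ h0
          rw [hbot _ hy] at this
          exact this
        · rw [trunc_of_lt] at h0
          · exact h0
          · rw [sum_vdeg] at hy ⊢
            simp only [Prod.snd_sub, Prod.fst_sub] at hy ⊢
            omega
      · exact (hc T).2 hT
  · obtain ⟨b, hb, h1, h2⟩ := v_reduced (Finset.univ.filter fun i => ¬ (ofLex i).isLeft) q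
      (trunc_vop_mem _) (fun i hi e x hx => by
        have hi' : (-vdeg n p i).1 = 0 := by
          unfold vdeg
          rw [Finset.mem_filter] at hi
          obtain ⟨j, hj⟩ := Sum.isRight_iff.1 (by simpa using hi.2)
          rw [hj]
          simp [bideg]
        rw [sub_eq_add_neg]
        exact trunc_map _ hi'.ge
          (fun x hx => by rw [← sub_eq_add_neg]; exact divX_vdeg_mem i e x hx) x hx) hc hdc
    refine ⟨b, hb, ?_⟩
    have hm := sub_mem hc (kd_mem (trunc_vop_mem _) hb)
    funext T
    by_cases hT : ∃ i ∈ T, ¬ (ofLex i).isLeft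
    · obtain ⟨i, hi, hi'⟩ := hT
      exact (h1 i (by simpa using hi') T hi).symm
    push Not at hT
    symm
    rw [← sub_eq_zero]
    by_cases hTq : T.card = q
    · have hm' := trunc_le _ ((hm T).1 hTq)
      ext μ
      by_contra hμ
      have h3 : mdeg μ = _ := mem_piece.1 hm' μ hμ
      have h4 : (mdeg μ).2 = 0 := by
        simp only [mdeg, Nat.cast_eq_zero, Finset.sum_eq_zero_iff, Finset.mem_univ, true_imp_iff]
        intro j
        have := lt_of_divX_eq_zero (h2 (toLex (Sum.inr j)) (by simp) T) hμ
        simpa using this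
      have h5 : (T.filter fun i => ¬ (ofLex i).isLeft).card = 0 := by
        rw [Finset.card_eq_zero, Finset.filter_eq_empty_iff]
        exact fun i hi => not_not.2 (hT i hi)
      rw [h3, sum_vdeg, h5] at h4
      simp only [Prod.snd_sub, Nat.cast_zero, sub_zero] at h4
      exact hd2 h4
    · exact (hm T).2 hTq

end ResInt

namespace Nagata

section

open Polynomial MvPolynomial Ideal Nat RingHom List

variable {k : Type*} [Field k] {n : ℕ} (f : MvPolynomial (Fin (n + 1)) k)
variable (v w : Fin (n + 1) →₀ ℕ)



variable {f v} in
lemma lt_up (vlt : ∀ i, v i < (2 + f.totalDegree)) : ∀ l ∈ ofFn v, l < (2 + f.totalDegree) := by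
  grind


abbrev T1 (c : k) :
    MvPolynomial (Fin (n + 1)) k →ₐ[k] MvPolynomial (Fin (n + 1)) k :=
  aeval fun i ↦ if i = 0 then X 0 else X i + c • X 0 ^ (fun (i : Fin (n + 1)) ↦ (2 + f.totalDegree) ^ i.1) i

lemma t1_comp_t1_neg (c : k) : (T1 f c).comp (T1 f (-c)) = AlgHom.id _ _ := by
  rw [comp_aeval, ← MvPolynomial.aeval_X_left]
  ext i v
  cases i using Fin.cases <;> simp

abbrev T := AlgEquiv.ofAlgHom (T1 f 1) (T1 f (-1))
  (t1_comp_t1_neg f 1) (by simpa using t1_comp_t1_neg f (-1))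

lemma sum_r_mul_ne (vlt : ∀ i, v i < (2 + f.totalDegree)) (wlt : ∀ i, w i < (2 + f.totalDegree)) (ne : v ≠ w) :
    ∑ x : Fin (n + 1), (fun (i : Fin (n + 1)) ↦ (2 + f.totalDegree) ^ i.1) x * v x ≠ ∑ x : Fin (n + 1), (fun (i : Fin (n + 1)) ↦ (2 + f.totalDegree) ^ i.1) x * w x := by
  intro h
  refine ne <| Finsupp.ext <| congrFun <| ofFn_inj.mp ?_
  apply ofDigits_inj_of_len_eq (Nat.lt_add_right f.totalDegree one_lt_two)
    (by simp) (lt_up vlt) (lt_up wlt)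
  simpa only [ofDigits_eq_sum_mapIdx, mapIdx_eq_ofFn, get_ofFn, length_ofFn,
    Fin.val_cast, mul_comm, sum_ofFn] using! h

lemma degreeOf_zero_t {a : k} (ha : a ≠ 0) : ((T f) (monomial v a)).degreeOf 0 =
    ∑ i : Fin (n + 1), ((fun (i : Fin (n + 1)) ↦ (2 + f.totalDegree) ^ i.1) i) * v i := by
  rw [← natDegree_finSuccEquiv, monomial_eq, Finsupp.prod_pow v fun a ↦ X a]
  simp only [Fin.prod_univ_succ, Fin.sum_univ_succ, map_mul, map_prod, map_pow,
    AlgEquiv.ofAlgHom_apply, MvPolynomial.aeval_C, MvPolynomial.aeval_X, if_pos, Fin.succ_ne_zero,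
    ite_false, one_smul, map_add, finSuccEquiv_X_zero, finSuccEquiv_X_succ, algebraMap_eq]
  have h (i : Fin n) :
      (Polynomial.C (X (R := k) i) + Polynomial.X ^ (fun (i : Fin (n + 1)) ↦ (2 + f.totalDegree) ^ i.1) i.succ) ^ v i.succ ≠ 0 :=
    pow_ne_zero (v i.succ) (leadingCoeff_ne_zero.mp <| by simp [add_comm, leadingCoeff_X_pow_add_C])
  rw [natDegree_mul (by simp [ha]) (mul_ne_zero (by simp) (Finset.prod_ne_zero_iff.mpr
    (fun i _ ↦ h i))), natDegree_mul (by simp) (Finset.prod_ne_zero_iff.mpr (fun i _ ↦ h i)),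
    natDegree_prod _ _ (fun i _ ↦ h i), natDegree_finSuccEquiv, degreeOf_C]
  simpa only [natDegree_pow, zero_add, natDegree_X, mul_one, Fin.val_zero, pow_zero, one_mul,
    add_right_inj] using Finset.sum_congr rfl (fun i _ ↦ by
    rw [add_comm (Polynomial.C _), natDegree_X_pow_add_C, mul_comm])

lemma degreeOf_t_ne_of_ne (hv : v ∈ f.support) (hw : w ∈ f.support) (ne : v ≠ w) :
    (T f <| monomial v <| coeff v f).degreeOf 0 ≠
    (T f <| monomial w <| coeff w f).degreeOf 0 := by
  rw [degreeOf_zero_t _ _ <| mem_support_iff.mp hv, degreeOf_zero_t _ _ <| mem_support_iff.mp hw]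
  refine sum_r_mul_ne f v w (fun i ↦ ?_) (fun i ↦ ?_) ne <;>
  exact lt_of_le_of_lt ((monomial_le_degreeOf i ‹_›).trans (degreeOf_le_totalDegree f i))
    (by lia)

lemma leadingCoeff_finSuccEquiv_t :
    (finSuccEquiv k n ((T f) ((monomial v) (coeff v f)))).leadingCoeff =
    algebraMap k _ (coeff v f) := by
  rw [monomial_eq, Finsupp.prod_fintype]
  · simp only [map_mul, map_prod, leadingCoeff_mul, leadingCoeff_prod]
    rw [AlgEquiv.ofAlgHom_apply, algHom_C, algebraMap_eq, finSuccEquiv_apply,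
      eval₂Hom_C, coe_comp]
    simp only [AlgEquiv.ofAlgHom_apply, Function.comp_apply, leadingCoeff_C, map_pow,
      leadingCoeff_pow, algebraMap_eq]
    have : ∀ j, ((finSuccEquiv k n) ((T1 f) 1 (X j))).leadingCoeff = 1 := fun j ↦ by
      by_cases h : j = 0
      · simp [h, finSuccEquiv_apply]
      · simp only [aeval_eq_bind₁, bind₁_X_right, if_neg h, one_smul, map_add, map_pow]
        obtain ⟨i, rfl⟩ := Fin.exists_succ_eq.mpr h
        simp [finSuccEquiv_X_succ, finSuccEquiv_X_zero, add_comm]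
    simp only [this, one_pow, Finset.prod_const_one, mul_one]
  exact fun i ↦ pow_zero _

lemma T_leadingcoeff_isUnit (fne : f ≠ 0) :
    IsUnit (finSuccEquiv k n (T f f)).leadingCoeff := by
  obtain ⟨v, vin, vs⟩ := Finset.exists_max_image f.support
    (fun v ↦ (T f ((monomial v) (coeff v f))).degreeOf 0) (support_nonempty.mpr fne)
  set h := fun w ↦ (MvPolynomial.monomial w) (coeff w f)
  simp only [← natDegree_finSuccEquiv] at vs
  replace vs : ∀ x ∈ f.support \ {v}, (finSuccEquiv k n ((T f) (h x))).degree <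
      (finSuccEquiv k n ((T f) (h v))).degree := by
    intro x hx
    obtain ⟨h1, h2⟩ := Finset.mem_sdiff.mp hx
    apply degree_lt_degree <| lt_of_le_of_ne (vs x h1) ?_
    simpa only [natDegree_finSuccEquiv]
      using degreeOf_t_ne_of_ne f _ _ h1 vin <| ne_of_not_mem_cons h2
  have coeff : (finSuccEquiv k n ((T f) (h v + ∑ x ∈ f.support \ {v}, h x))).leadingCoeff =
      (finSuccEquiv k n ((T f) (h v))).leadingCoeff := by
    simp only [map_add, map_sum]
    rw [add_comm]
    apply leadingCoeff_add_of_degree_lt <| (lt_of_le_of_lt <| degree_sum_le _ _) ?_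
    have h2 : h v ≠ 0 := by simpa [h] using mem_support_iff.mp vin
    replace h2 : (finSuccEquiv k n ((T f) (h v))) ≠ 0 := fun eq ↦ h2 <|
      by simpa only [map_eq_zero_iff _ (AlgEquiv.injective _)] using eq
    exact (Finset.sup_lt_iff <| Ne.bot_lt (fun x ↦ h2 <| degree_eq_bot.mp x)).mpr vs
  nth_rw 2 [← f.support_sum_monomial_coeff]
  rw [Finset.sum_eq_add_sum_sdiff_singleton_of_mem vin h]
  rw [leadingCoeff_finSuccEquiv_t] at coeff
  simpa only [coeff, algebraMap_eq] using (mem_support_iff.mp vin).isUnit.map MvPolynomial.C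

theorem exists_equiv_isUnit_leadingCoeff (hf : f ≠ 0) :
    ∃ e : MvPolynomial (Fin (n + 1)) k ≃+* (MvPolynomial (Fin n) k)[X],
      IsUnit (e f).leadingCoeff :=
  ⟨((T f).trans (finSuccEquiv k n)).toRingEquiv, T_leadingcoeff_isUnit f hf⟩

end

end Nagata

namespace ResInt

open Koszul RingTheory.Sequence

/-- Every prime over `I` has height at least `t`. -/
def HtGE {R : Type*} [CommRing R] (I : Ideal R) (t : ℕ) : Prop :=
  ∀ P : Ideal R, P.IsPrime → I ≤ P → (t : ℕ∞) ≤ P.height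

/-- There is a weakly regular sequence of length `t` inside `I`. -/
def WGrade {R : Type*} [CommRing R] (I : Ideal R) (t : ℕ) : Prop :=
  ∃ rs : List R, rs.length = t ∧ (∀ r ∈ rs, r ∈ I) ∧ IsWeaklyRegular R rs

section

variable {R R' : Type*} [CommRing R] [CommRing R']

theorem HtGE.comap_equiv (e : R ≃+* R') {I : Ideal R} {t : ℕ} (h : HtGE I t) :
    HtGE (I.comap (e.symm : R' →+* R)) t := by
  intro P hP hIP
  have h1 : (P.comap e).IsPrime := Ideal.IsPrime.comap e
  have := h (P.comap e) h1 (fun x hx => hIP (by simpa using hx))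
  rwa [RingEquiv.height_comap] at this

theorem WGrade.of_comap_equiv (e : R ≃+* R') {I : Ideal R} {t : ℕ}
    (h : WGrade (I.comap (e.symm : R' →+* R)) t) : WGrade I t := by
  obtain ⟨rs, h1, h2, h3⟩ := h
  refine ⟨rs.map e.symm, by simpa using h1, ?_, ?_⟩
  · intro r hr
    obtain ⟨s, hs, rfl⟩ := List.mem_map.1 hr
    simpa using h2 s hs
  · refine (e.symm.toAddEquiv.isWeaklyRegular_congr ?_).1 h3
    exact List.forall₂_map_right_iff.mpr <| List.forall₂_same.mpr fun r _ x => by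
      simp

theorem isWeaklyRegular_replicate_one (M : Type*) [AddCommGroup M] [Module R M] (t : ℕ) :
    IsWeaklyRegular M (List.replicate t (1 : R)) := by
  induction t generalizing M with
  | zero => simp
  | succ t ih =>
    rw [List.replicate_succ, isWeaklyRegular_cons_iff]
    exact ⟨fun a b h => by simpa using h, ih _⟩

theorem height_le_height_comap [Algebra R R'] [Algebra.IsIntegral R R'] (Q : Ideal R')
    [Q.IsPrime] : Q.height ≤ (Q.comap (algebraMap R R')).height := by
  have h : StrictMono (PrimeSpectrum.comap (algebraMap R R')) := by
    intro P1 P2 hlt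
    exact Ideal.IsIntegral.comap_lt_comap (R := R) hlt
  have := Order.height_le_height_apply_of_strictMono _ h ⟨Q, ‹_›⟩
  rwa [← PrimeSpectrum.height_eq_orderHeight, ← PrimeSpectrum.height_eq_orderHeight] at this

open Polynomial in
theorem wgrade_polynomial [IsNoetherianRing R] (g : R[X]) (hg : g.Monic) (I : Ideal R[X])
    (hgI : g ∈ I) (s : ℕ) (h : HtGE I (s + 1))
    (ih : ∀ I' : Ideal R, HtGE I' s → WGrade I' s) : WGrade I (s + 1) := by
  set Q := R[X] ⧸ Ideal.span {g} with hQ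
  have hfree : Module.Free R Q := hg.free_quotient
  have hfin : Module.Finite R Q := hg.finite_quotient
  let IB : Ideal Q := I.map (Ideal.Quotient.mk _)
  have hker : Ideal.span {g} ≤ I := by
    rw [Ideal.span_singleton_le_iff_mem]; exact hgI
  obtain ⟨rs, hl, hrs, hreg⟩ := ih (IB.comap (algebraMap R Q)) (by
    intro P hP hIP
    obtain ⟨B, hB, hBp, rfl⟩ := Ideal.exists_ideal_over_prime_of_isIntegral P IB hIP
    refine le_trans ?_ (height_le_height_comap (R := R) B)
    have hp1 : (B.comap (Ideal.Quotient.mk (Ideal.span {g}))).IsPrime := Ideal.IsPrime.comap _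
    have h1 := h (B.comap (Ideal.Quotient.mk _)) hp1 (Ideal.map_le_iff_le_comap.1 hB)
    have hmem : g ∈ B.comap (Ideal.Quotient.mk (Ideal.span {g})) := by
      rw [Ideal.mem_comap, Ideal.Quotient.eq_zero_iff_mem.2 (Ideal.mem_span_singleton_self g)]
      exact B.zero_mem
    have h2 := h1.trans (Ideal.height_le_height_add_one_of_mem hmem)
    rw [Ideal.map_comap_of_surjective _ Ideal.Quotient.mk_surjective] at h2
    push_cast at h2
    exact (ENat.add_le_add_iff_right ENat.one_ne_top).1 h2)
  refine ⟨g :: rs.map (algebraMap R R[X]), by simp [hl], ?_, ?_⟩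
  · intro r hr
    rcases List.mem_cons.1 hr with rfl | hr
    · exact hgI
    obtain ⟨a, ha, rfl⟩ := List.mem_map.1 hr
    have := hrs a ha
    rw [Ideal.mem_comap] at this
    have h3 : algebraMap R R[X] a ∈ IB.comap (Ideal.Quotient.mk (Ideal.span {g})) := this
    rw [Ideal.comap_map_of_surjective _ Ideal.Quotient.mk_surjective, ← RingHom.ker_eq_comap_bot,
      Ideal.mk_ker, sup_eq_left.2 hker] at h3
    exact h3
  · rw [isWeaklyRegular_cons_iff]
    constructor
    · intro a b hab
      exact hg.isRegular.left hab
    · have h4 := IsWeaklyRegular.of_flat (S := Q) hreg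
      have h5 : IsWeaklyRegular Q (rs.map (algebraMap R R[X])) := by
        rw [isWeaklyRegular_map_algebraMap_iff] at h4 ⊢
        exact h4
      refine (LinearEquiv.isWeaklyRegular_congr (R := R[X]) ?_ _).1 h5
      refine Submodule.quotEquivOfEq _ _ ?_
      rw [← Submodule.ideal_span_singleton_smul, smul_eq_mul, Ideal.mul_top]

end

theorem wgrade_of_htGE_fin (k : Type*) [Field k] (N : ℕ) (t : ℕ)
    (I : Ideal (MvPolynomial (Fin N) k)) (h : HtGE I t) : WGrade I t := by
  induction N generalizing t with
  | zero =>
    rcases t with _ | t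
    · exact ⟨[], rfl, by simp, by simp⟩
    have hf : IsField (MvPolynomial (Fin 0) k) :=
      (MvPolynomial.isEmptyAlgEquiv k (Fin 0)).toMulEquiv.isField (Field.toIsField k)
    have hI : I = ⊤ := by
      by_contra hI
      have := h ⊥ Ideal.isPrime_bot (by
        rw [le_bot_iff]
        letI := hf.toField
        exact (Ideal.eq_bot_or_top I).resolve_right hI)
      simp at this
    exact ⟨List.replicate (t + 1) 1, by simp, by simp [hI], isWeaklyRegular_replicate_one _ _⟩
  | succ N ih =>
    rcases t with _ | s
    · exact ⟨[], rfl, by simp, by simp⟩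
    obtain ⟨f, hfI, hf0⟩ : ∃ f ∈ I, f ≠ 0 := by
      by_contra! hc
      have := h ⊥ Ideal.isPrime_bot (fun x hx => by simpa using hc x hx)
      simp at this
    obtain ⟨e, he⟩ := Nagata.exists_equiv_isUnit_leadingCoeff f hf0
    refine WGrade.of_comap_equiv e ?_
    obtain ⟨u, hu⟩ := he
    refine wgrade_polynomial (Polynomial.C (↑u⁻¹ : MvPolynomial (Fin N) k) * e f) ?_ _ ?_ s
      (h.comap_equiv e) (fun I' hI' => ih s I' hI')
    · rw [Polynomial.Monic, Polynomial.leadingCoeff_mul, Polynomial.leadingCoeff_C, ← hu,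
        Units.inv_mul]
    · rw [Ideal.mem_comap, map_mul]
      exact Ideal.mul_mem_left _ _ (by simpa using hfI)

theorem wgrade_of_htGE {k : Type*} [Field k] {σ : Type*} [Finite σ] {t : ℕ}
    {I : Ideal (MvPolynomial σ k)} (h : HtGE I t) : WGrade I t := by
  obtain ⟨N, ⟨e⟩⟩ := Finite.exists_equiv_fin σ
  have e' := (MvPolynomial.renameEquiv k e).toRingEquiv
  exact WGrade.of_comap_equiv e' (wgrade_of_htGE_fin k N t _ (h.comap_equiv e'))

theorem wgrade_of_le_idealHeight {k : Type} [Field k] {n p t : ℕ} {I : Ideal (PolyS k n p)}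
    (h : (t : ℕ∞) ≤ idealHeight I) : WGrade I t := by
  refine wgrade_of_htGE fun P hP hIP => h.trans ?_
  have := iInf₂_le (f := fun (P : PrimeSpectrum (PolyS k n p)) (_ : I ≤ P.asIdeal) =>
    Order.height P) ⟨P, hP⟩ hIP
  rwa [← PrimeSpectrum.height_eq_orderHeight] at this

end ResInt

namespace ResInt

open Koszul RingTheory.Sequence

section

variable {R α : Type*} [CommRing R] [LinearOrder α] [Fintype α]

/-- Scalar multiplications as a family of endomorphisms. -/
def smulOp (M : Type*) [AddCommGroup M] [Module R M] (z : α → R) (i : α) : Module.End R M :=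
  algebraMap R _ (z i)

lemma smulOp_apply (M : Type*) [AddCommGroup M] [Module R M] (z : α → R) (i : α) (x : M) :
    smulOp M z i x = z i • x := rfl

/-- Elements of the ideal `(z)` annihilate Koszul homology. -/
theorem exists_kd_eq_smul {M : Type*} [AddCommGroup M] [Module R M] (z : α → R) {s : R}
    (hs : s ∈ Ideal.span (Set.range z)) {j : ℕ} {c : Finset α → M}
    (hc : ∀ T, T.card ≠ j → c T = 0) (hk : kd (smulOp M z) c = 0) :
    ∃ b : Finset α → M, (∀ T, T.card ≠ j + 1 → b T = 0) ∧ kd (smulOp M z) b = s • c := by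
  obtain ⟨a, rfl⟩ := (Ideal.mem_span_range_iff_exists_fun).1 hs
  refine ⟨∑ i, wedge R M i (coef (algebraMap R (Module.End R M) (a i)) c), ?_, ?_⟩
  · intro T hT
    rw [Finset.sum_apply]
    refine Finset.sum_eq_zero fun i _ => ?_
    rw [wedge_apply]
    split_ifs with hi
    · rw [coef_apply, hc _ (by have := Finset.card_erase_add_one hi; omega), map_zero, smul_zero]
    · rfl
  · rw [map_sum, Finset.sum_smul]
    refine Finset.sum_congr rfl fun i _ => ?_
    funext T
    have h := kd_wedge_add (smulOp M z) i (algebraMap R (Module.End R M) (a i))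
      (fun j _ => (Algebra.commutes (a i) (smulOp M z j)).symm) c T
    rw [hk, map_zero, map_zero, Pi.zero_apply, add_zero] at h
    rw [h, Pi.smul_apply]
    simp only [smulOp_apply, Module.algebraMap_end_apply]
    split_ifs
    · rw [smul_smul]
    · rw [smul_smul, mul_comm]

/-- Depth sensitivity of the Koszul complex, up to powers of `x`. -/
theorem exists_kd_eq_pow_smul (z : α → R) (x : R) (rs : List R)
    (M : Type*) [AddCommGroup M] [Module R M] (hrs : IsWeaklyRegular M rs)
    (hx : ∀ r ∈ rs, x * r ∈ Ideal.span (Set.range z)) {j : ℕ}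
    (hj : Fintype.card α < j + rs.length) {c : Finset α → M}
    (hc : ∀ T, T.card ≠ j → c T = 0) (hk : kd (smulOp M z) c = 0) :
    ∃ b : Finset α → M, (∀ T, T.card ≠ j + 1 → b T = 0) ∧
      kd (smulOp M z) b = x ^ rs.length • c := by
  induction rs generalizing M j with
  | nil =>
    refine ⟨0, fun _ _ => rfl, ?_⟩
    have : c = 0 := by
      funext T
      refine hc T fun h => ?_
      have := Finset.card_le_univ T
      simp at hj
      omega
    simp [this]
  | cons r rs ih =>
    rw [isWeaklyRegular_cons_iff] at hrs
    obtain ⟨hr, hrs⟩ := hrs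
    have hcomm : ∀ i j, Commute (smulOp M z i) (smulOp M z j) :=
      fun i j => LinearMap.ext fun y => smul_comm (z i) (z j) y
    have hinj : ∀ u v : Finset α → M, r • u = r • v → u = v :=
      fun u v h => funext fun T => hr (congrFun h T)
    obtain ⟨b', hb', hbk⟩ := exists_kd_eq_smul z (hx r (by simp)) hc hk
    let π : M →ₗ[R] QuotSMulTop r M := Submodule.mkQ _
    have hπk : ∀ u, coef π (kd (smulOp M z) u) = kd (smulOp (QuotSMulTop r M) z) (coef π u) :=
      fun u => coef_kd _ _ π (fun i y => map_smul π (z i) y) u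
    have hπr : ∀ u : M, π (r • u) = 0 := fun u =>
      (Submodule.Quotient.mk_eq_zero _).2 (Submodule.smul_mem_pointwise_smul _ _ _ trivial)
    obtain ⟨b2, hb2, hbk2⟩ := ih (QuotSMulTop r M) hrs (fun r hr => hx r (by simp [hr]))
      (j := j + 1) (c := coef π b') (by simp at hj ⊢; omega)
      (fun T hT => by rw [coef_apply, hb' T hT, map_zero])
      (by
        rw [← hπk, hbk]
        funext T
        rw [coef_apply, Pi.smul_apply, mul_comm, mul_smul, hπr]; rfl)
    have hsurj : ∀ T, ∃ y : M, π y = b2 T := fun T => Submodule.mkQ_surjective _ _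
    choose b3 hb3 using hsurj
    classical
    let b4 : Finset α → M := fun T => if T.card = j + 2 then b3 T else 0
    have hb4 : coef π b4 = b2 := by
      funext T
      by_cases hT : T.card = j + 2
      · simp [b4, hT, coef_apply, hb3]
      · simp [b4, hT, coef_apply, hb2 T hT]
    have hdiff : ∀ T, ∃ y : M, (x ^ rs.length • b' T - kd (smulOp M z) b4 T = r • y) ∧
        (T.card ≠ j + 1 → y = 0) := by
      intro T
      by_cases hT : T.card = j + 1
      · have h0 : π (x ^ rs.length • b' T - kd (smulOp M z) b4 T) = 0 := by
          rw [map_sub, map_smul]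
          have h1 := congrFun (hπk b4) T
          rw [coef_apply] at h1
          rw [h1, hb4, hbk2]
          simp [coef_apply]
        have h2 := (Submodule.Quotient.mk_eq_zero _).1 h0
        obtain ⟨y, -, hy⟩ := Submodule.mem_smul_pointwise_iff_exists _ _ _ |>.1 h2
        exact ⟨y, hy.symm, fun h => absurd hT h⟩
      · refine ⟨0, ?_, fun _ => rfl⟩
        rw [hb' T hT, smul_zero, smul_zero, kd_apply', Finset.sum_eq_zero, sub_zero]
        intro i hi
        have hi : i ∉ T := by simpa using hi
        have : (insert i T).card ≠ j + 2 := by rw [Finset.card_insert_of_notMem hi]; omega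
        simp [b4, this]
    choose y hy hy0 using hdiff
    refine ⟨y, hy0, hinj _ _ ?_⟩
    have he : r • y = x ^ rs.length • b' - kd (smulOp M z) b4 := funext fun T => (hy T).symm
    rw [← map_smul, he, map_sub, kd_kd _ hcomm, sub_zero, map_smul, hbk, List.length_cons,
      smul_smul, smul_smul]
    congr 1
    ring

end

variable {k : Type} [Field k] {n m p : ℕ}

/-- The homogeneous component of bidegree `d`. -/
def hproj (k : Type) [Field k] {n p : ℕ} (d : ℤ × ℤ) : PolyS k n p →ₗ[k] PolyS k n p :=
  weightedHomogeneousComponent (bideg n p) d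

lemma coeff_hproj (d : ℤ × ℤ) (f : PolyS k n p) (μ : Fin n ⊕ Fin p →₀ ℕ) :
    coeff μ (hproj k d f) = if mdeg μ = d then coeff μ f else 0 := by
  classical
  rw [hproj, coeff_weightedHomogeneousComponent, weight_bideg]

lemma hproj_mem (d : ℤ × ℤ) (f : PolyS k n p) : hproj k d f ∈ piece k n p d :=
  weightedHomogeneousComponent_isWeightedHomogeneous (w := bideg n p) d f

lemma hproj_of_mem {d : ℤ × ℤ} {f : PolyS k n p} (hf : f ∈ piece k n p d) : hproj k d f = f :=
  weightedHomogeneousComponent_of_mem hf |>.trans (if_pos rfl)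

lemma hproj_of_mem_ne {d e : ℤ × ℤ} {f : PolyS k n p} (hf : f ∈ piece k n p d) (h : e ≠ d) :
    hproj k e f = 0 := by
  ext μ
  rw [coeff_hproj, coeff_zero]
  split_ifs with h1
  · by_contra h2
    exact h (h1.symm.trans (mem_piece.1 hf μ h2))
  · rfl

lemma hproj_mul {e : ℤ × ℤ} {g : PolyS k n p} (hg : g ∈ piece k n p e) (d : ℤ × ℤ)
    (f : PolyS k n p) : hproj k d (g * f) = g * hproj k (d - e) f := by
  classical
  induction f using MvPolynomial.induction_on' with
  | monomial u a =>
    have hm : (monomial u a : PolyS k n p) ∈ piece k n p (mdeg u) := by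
      rw [mem_piece]
      intro μ hμ
      rw [coeff_monomial] at hμ
      split_ifs at hμ with h
      · rw [h]
      · exact absurd rfl hμ
    by_cases h : d - e = mdeg u
    · rw [h, hproj_of_mem hm, hproj_of_mem]
      have := mul_mem_piece hg hm
      rwa [← h, add_sub_cancel] at this
    · rw [hproj_of_mem_ne hm h, mul_zero, hproj_of_mem_ne (mul_mem_piece hg hm)]
      rintro rfl
      exact h (by abel)
  | add f g' hf hg' => rw [mul_add, map_add, map_add, mul_add, hf, hg']

lemma mem_xIdeal_pow {d : ℤ × ℤ} {f : PolyS k n p} (hf : f ∈ piece k n p d) {N : ℕ}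
    (hN : (N : ℤ) ≤ d.1) : f ∈ xIdeal k n p ^ N := by
  have key : ∀ (N : ℕ) (μ : Fin n ⊕ Fin p →₀ ℕ) (a : k), N ≤ ∑ i, μ (Sum.inl i) →
      (monomial μ a : PolyS k n p) ∈ xIdeal k n p ^ N := by
    intro N
    induction N with
    | zero => simp
    | succ N ih =>
      intro μ a h
      obtain ⟨i, -, hi⟩ : ∃ i ∈ Finset.univ, μ (Sum.inl i) ≠ 0 := by
        by_contra! hc
        rw [Finset.sum_eq_zero hc] at h
        omega
      have hle : Finsupp.single (Sum.inl i) 1 ≤ μ := by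
        rw [Finsupp.single_le_iff]; omega
      have he : (monomial μ a : PolyS k n p) =
          monomial (μ - Finsupp.single (Sum.inl i) 1) a * X (Sum.inl i) := by
        rw [X, monomial_mul, tsub_add_cancel_of_le hle, mul_one]
      rw [he, pow_succ]
      refine Ideal.mul_mem_mul (ih _ _ ?_) (Ideal.subset_span ⟨i, rfl⟩)
      have h3 : ∑ j, μ (Sum.inl j) =
          ∑ j, (μ - Finsupp.single (Sum.inl i) 1 : Fin n ⊕ Fin p →₀ ℕ) (Sum.inl j) + 1 := by
        conv_lhs => rw [← tsub_add_cancel_of_le hle]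
        simp only [Finsupp.add_apply, Finset.sum_add_distrib]
        congr 1
        simp [Finsupp.single_apply]
      omega
  rw [f.as_sum]
  refine Ideal.sum_mem _ fun μ hμ => key _ _ _ ?_
  have := mem_piece.1 hf μ (mem_support_iff.1 hμ)
  have h2 := congrArg Prod.fst this
  simp only [mdeg] at h2
  omega

/-- Cramer's rule. -/
lemma X_mul_mem_span (φ : Matrix (Fin n) (Fin m) (PolyS k n p)) (i : Fin n) {f : PolyS k n p}
    (hf : f ∈ resJ k n m p φ) :
    X (Sum.inl i) * f ∈ Ideal.span (Set.range (zseq k n m p φ)) := by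
  have key : resJ k n m p φ ≤ (Ideal.span (Set.range (zseq k n m p φ))).colon
      {(X (Sum.inl i) : PolyS k n p)} := by
    refine sup_le (fun g hg => ?_) ?_
    · rw [Submodule.mem_colon_singleton]
      exact Ideal.mul_mem_right _ _ hg
    · rw [minorsIdeal, Ideal.span_le]
      rintro _ ⟨r, c, rfl⟩
      rw [SetLike.mem_coe, Submodule.mem_colon_singleton, smul_eq_mul]
      set A := φ.submatrix r c
      let x : Fin n → PolyS k n p := fun j => X (Sum.inl (r j))
      have hb : Function.Bijective r := Finite.injective_iff_bijective.1 r.injective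
      obtain ⟨i', rfl⟩ := hb.2 i
      have h1 : Matrix.vecMul x A = fun j => zseq k n m p φ (c j) := by
        funext j
        simp only [Matrix.vecMul, dotProduct, zseq, x, A, Matrix.submatrix_apply]
        exact hb.sum_comp (fun i => X (Sum.inl i) * φ i (c j))
      have h2 : Matrix.vecMul (Matrix.vecMul x A) A.adjugate i' = x i' * A.det := by
        rw [Matrix.vecMul_vecMul, Matrix.mul_adjugate, Matrix.vecMul_smul, Matrix.vecMul_one]
        simp [mul_comm]
      rw [mul_comm]
      change x i' * A.det ∈ _
      rw [← h2, h1]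
      simp only [Matrix.vecMul, dotProduct]
      exact Ideal.sum_mem _ fun j _ => Ideal.mul_mem_right _ _ (Ideal.subset_span ⟨_, rfl⟩)
  have := key hf
  rwa [Submodule.mem_colon_singleton, smul_eq_mul, mul_comm] at this

/-- The `z`'s acting on `S`. -/
def zop (φ : Matrix (Fin n) (Fin m) (PolyS k n p)) (l : Fin m) : Module.End k (PolyS k n p) :=
  op k (zseq k n m p φ l)

/-- Degrees of the Koszul generators for the `z`'s. -/
def zdeg (m : ℕ) (_ : Fin m) : ℤ × ℤ := (1, 1)

lemma sum_zdeg (T : Finset (Fin m)) : ∑ i ∈ T, zdeg m i = ((T.card : ℤ), (T.card : ℤ)) := by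
  simp [zdeg]

lemma zseq_mem {φ : Matrix (Fin n) (Fin m) (PolyS k n p)} (hφ : ∀ i j, φ i j ∈ piece k n p (0, 1))
    (l : Fin m) : zseq k n m p φ l ∈ piece k n p (1, 1) := by
  refine Submodule.sum_mem _ fun i _ => ?_
  have := mul_mem_piece (X_mem_piece (k := k) (Sum.inl i : Fin n ⊕ Fin p)) (hφ i l)
  simpa [bideg] using this

lemma zop_mem {φ : Matrix (Fin n) (Fin m) (PolyS k n p)} (hφ : ∀ i j, φ i j ∈ piece k n p (0, 1))
    (l : Fin m) (e : ℤ × ℤ) (x : PolyS k n p) (hx : x ∈ piece k n p e) :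
    zop φ l x ∈ piece k n p (e + zdeg m l) := by
  rw [add_comm]
  exact mul_mem_piece (zseq_mem hφ l) hx

/-- The Koszul complex of `z` is exact in positive degrees for large `x`-degrees. -/
theorem exists_kex_z {φ : Matrix (Fin n) (Fin m) (PolyS k n p)}
    (hφ : ∀ i j, φ i j ∈ piece k n p (0, 1)) (hJ : (m : ℕ∞) ≤ idealHeight (resJ k n m p φ)) :
    ∃ N0 : ℕ, ∀ (q : ℕ) (d : ℤ × ℤ), 1 ≤ q → (N0 : ℤ) ≤ d.1 →
      KEx (zop φ) (zdeg m) (piece k n p) q d := by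
  classical
  obtain ⟨rs, hl, hrs, hreg⟩ := wgrade_of_le_idealHeight hJ
  set F := smulOp (PolyS k n p) (zseq k n m p φ) with hF
  have hkd : ∀ c, kd (zop φ) c = kd F c := by
    intro c
    funext T
    rw [kd_apply', kd_apply']
    rfl
  let Z : ℕ → Submodule (PolyS k n p) (Finset (Fin m) → PolyS k n p) := fun q =>
    LinearMap.ker (kd F) ⊓ Submodule.pi Set.univ (fun T => if T.card = q then ⊤ else ⊥)
  have hZ : ∀ q c, c ∈ Z q ↔ kd F c = 0 ∧ ∀ T, T.card ≠ q → c T = 0 := by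
    intro q c
    simp only [Z, Submodule.mem_inf, LinearMap.mem_ker, Submodule.mem_pi]
    refine and_congr Iff.rfl (forall_congr' fun T => ?_)
    by_cases h : T.card = q <;> simp [h]
  obtain ⟨e, he⟩ : ∃ e, xIdeal k n p ^ e ≤
      Ideal.span (Set.range fun i : Fin n => (X (Sum.inl i) : PolyS k n p) ^ m) := by
    refine Ideal.exists_pow_le_of_le_radical_of_fg ?_ ?_
    · rw [xIdeal, Ideal.span_le]
      rintro _ ⟨i, rfl⟩
      exact ⟨m, Ideal.subset_span ⟨i, rfl⟩⟩
    · exact (isNoetherianRing_iff_ideal_fg _).1 inferInstance _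
  have hB : ∀ q, 1 ≤ q → (xIdeal k n p ^ e) • Z q ≤ LinearMap.range (kd F) := by
    intro q hq
    refine Submodule.smul_le.2 fun r hr c hc => ?_
    obtain ⟨a, rfl⟩ := Ideal.mem_span_range_iff_exists_fun.1 (he hr)
    rw [Finset.sum_smul]
    refine Submodule.sum_mem _ fun i _ => ?_
    rw [mul_smul]
    refine Submodule.smul_mem _ _ ?_
    obtain ⟨h1, h2⟩ := (hZ q c).1 hc
    obtain ⟨b, -, hb⟩ := exists_kd_eq_pow_smul (zseq k n m p φ) (X (Sum.inl i)) rs _ hreg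
      (fun r hr => X_mul_mem_span φ i (hrs r hr)) (j := q) (by simp; omega) h2 h1
    exact ⟨b, by rw [hl] at hb; exact hb⟩
  choose K hK using fun q => Ideal.exists_pow_inf_eq_pow_smul (xIdeal k n p) (Z q)
  let Kmax := (Finset.range (m + 1)).sup K
  refine ⟨e + Kmax + m, fun q d hq hd c hc hk => ?_⟩
  by_cases hqm : m < q
  · refine ⟨0, zero_mem _, ?_⟩
    rw [map_zero]
    funext T
    refine ((hc T).2 fun h => ?_).symm
    have := Finset.card_le_univ T
    simp at this
    omega
  have hKq : K q ≤ Kmax := Finset.le_sup (f := K) (Finset.mem_range.2 (by omega))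
  have hcZ : c ∈ Z q := (hZ q c).2 ⟨by rw [← hkd]; exact hk, fun T => (hc T).2⟩
  have hcI : c ∈ (xIdeal k n p ^ (e + K q)) • (⊤ : Submodule (PolyS k n p)
      (Finset (Fin m) → PolyS k n p)) := by
    rw [← Finset.univ_sum_single c]
    refine Submodule.sum_mem _ fun T _ => ?_
    have hT : c T ∈ xIdeal k n p ^ (e + K q) := by
      by_cases h : T.card = q
      · refine mem_xIdeal_pow ((hc T).1 h) ?_
        rw [sum_zdeg, h, Prod.fst_sub]
        push_cast at hd ⊢
        omega
      · rw [(hc T).2 h]; exact zero_mem _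
    have : Pi.single T (c T) = c T • (Pi.single T 1 : Finset (Fin m) → PolyS k n p) := by
      rw [← Pi.single_smul, smul_eq_mul, mul_one]
    rw [this]
    exact Submodule.smul_mem_smul hT trivial
  have hmem : c ∈ (xIdeal k n p ^ e) • Z q := by
    have h1 := hK q (e + K q) (by omega)
    have h2 : c ∈ xIdeal k n p ^ (e + K q) • ⊤ ⊓ Z q := ⟨hcI, hcZ⟩
    rw [h1, Nat.add_sub_cancel] at h2
    exact Submodule.smul_mono le_rfl inf_le_right h2
  obtain ⟨b, hb⟩ := hB q hq hmem
  refine ⟨fun T => if T.card = q + 1 then hproj k (d - ∑ i ∈ T, zdeg m i) (b T) else 0, ?_, ?_⟩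
  · intro T
    refine ⟨fun h => ?_, fun h => if_neg h⟩
    simp only [if_pos h]
    exact hproj_mem _ _
  · funext T
    rw [kd_apply']
    by_cases hT : T.card = q
    · have h1 := congrFun hb T
      rw [kd_apply'] at h1
      have h2 := congrArg (hproj k (d - ∑ i ∈ T, zdeg m i)) h1
      rw [hproj_of_mem ((hc T).1 hT), map_sum] at h2
      rw [← h2]
      refine Finset.sum_congr rfl fun i hi => ?_
      have hi : i ∉ T := by simpa using hi
      rw [if_pos (by rw [Finset.card_insert_of_notMem hi, hT]), map_zsmul]
      congr 1
      change zseq k n m p φ i * _ = hproj k _ (zseq k n m p φ i * b (insert i T))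
      rw [hproj_mul (zseq_mem hφ i), Finset.sum_insert hi]
      congr 3
      simp only [zdeg]
      abel
    · rw [(hc T).2 hT]
      refine Finset.sum_eq_zero fun i hi => ?_
      have hi : i ∉ T := by simpa using hi
      rw [if_neg (by rw [Finset.card_insert_of_notMem hi]; omega), map_zero, smul_zero]

end ResInt

namespace ResInt

open Koszul

variable {k : Type} [Field k] {n m p : ℕ}

lemma kex_of_card_lt {M α Δ : Type*} [AddCommGroup M] [Module k M] [LinearOrder α] [Fintype α]
    [AddCommGroup Δ] {F : α → Module.End k M} {deg : α → Δ} {G : Δ → Submodule k M} {q : ℕ} {d : Δ}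
    (h : Fintype.card α < q) : KEx F deg G q d := by
  intro c hc _
  refine ⟨0, zero_mem _, ?_⟩
  rw [map_zero]
  funext T
  refine ((hc T).2 fun hT => ?_).symm
  have := Finset.card_le_univ T
  omega

lemma kex_of_forall_eq_bot {M α Δ : Type*} [AddCommGroup M] [Module k M] [LinearOrder α]
    [Fintype α]
    [AddCommGroup Δ] {F : α → Module.End k M} {deg : α → Δ} {G : Δ → Submodule k M} {q : ℕ} {d : Δ}
    (h : ∀ T : Finset α, T.card = q → ∀ y ∈ G (d - ∑ i ∈ T, deg i), y = 0) :
    KEx F deg G q d := by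
  intro c hc _
  refine ⟨0, zero_mem _, ?_⟩
  rw [map_zero]
  funext T
  by_cases hT : T.card = q
  · exact (h T hT _ ((hc T).1 hT)).symm
  · exact ((hc T).2 hT).symm

lemma minor_mem {φ : Matrix (Fin n) (Fin m) (PolyS k n p)} (hφ : ∀ i j, φ i j ∈ piece k n p (0, 1))
    {t : ℕ} (r : Fin t → Fin n) (c : Fin t → Fin m) :
    (φ.submatrix r c).det ∈ piece k n p (0, t) := by
  rw [Matrix.det_apply]
  refine Submodule.sum_mem _ fun σ _ => ?_
  have key : ∀ s : Finset (Fin t), ∏ i ∈ s, φ.submatrix r c (σ i) i ∈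
      piece k n p (0, s.card) := by
    intro s
    induction s using Finset.induction_on with
    | empty =>
      rw [Finset.prod_empty, ← C_1]
      exact C_mem_piece 1
    | insert a s ha ih =>
      rw [Finset.prod_insert ha, Finset.card_insert_of_notMem ha]
      have := mul_mem_piece (hφ (r (σ a)) (c a)) ih
      simpa [add_comm] using this
  have := key Finset.univ
  rw [Finset.card_univ, Fintype.card_fin] at this
  rcases Int.units_eq_one_or (Equiv.Perm.sign σ) with h | h
  · rw [h, one_smul]; exact this
  · rw [h, Units.neg_smul, one_smul]; exact neg_mem this

lemma mem_homogeneous_span {A : Set (PolyS k n p)} {P : Ideal (PolyS k n p)} {d : ℤ × ℤ}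
    (h : ∀ g ∈ A, ∀ a, hproj k d (a * g) ∈ P) {f : PolyS k n p} (hf : f ∈ Ideal.span A) :
    hproj k d f ∈ P := by
  suffices key : ∀ a, hproj k d (a * f) ∈ P by simpa using key 1
  refine Submodule.span_induction (p := fun f _ => ∀ a, hproj k d (a * f) ∈ P) h ?_ ?_ ?_ hf
  · simp
  · intro x y _ _ hx hy a
    rw [mul_add, map_add]
    exact add_mem (hx a) (hy a)
  · intro b x _ hx a
    rw [smul_eq_mul, ← mul_assoc]
    exact hx _

lemma resJ_eq_span (φ : Matrix (Fin n) (Fin m) (PolyS k n p)) :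
    resJ k n m p φ = Ideal.span (Set.range (zseq k n m p φ) ∪
      {d | ∃ (r : Fin n ↪ Fin n) (c : Fin n ↪ Fin m), d = (φ.submatrix r c).det}) := by
  rw [resJ, minorsIdeal, Ideal.span_union]

lemma hproj_mem_resJ {φ : Matrix (Fin n) (Fin m) (PolyS k n p)}
    (hφ : ∀ i j, φ i j ∈ piece k n p (0, 1)) (d : ℤ × ℤ) {f : PolyS k n p}
    (hf : f ∈ resJ k n m p φ) : hproj k d f ∈ resJ k n m p φ := by
  rw [resJ_eq_span] at hf ⊢
  refine mem_homogeneous_span (fun g hg a => ?_) hf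
  have hg' := hg
  rw [mul_comm]
  rcases hg with ⟨j, rfl⟩ | ⟨r, c, rfl⟩
  · rw [hproj_mul (zseq_mem hφ j)]
    exact Ideal.mul_mem_right _ _ (Ideal.subset_span hg')
  · rw [hproj_mul (minor_mem hφ r c)]
    exact Ideal.mul_mem_right _ _ (Ideal.subset_span hg')

/-- In positive `x`-degree, or in small `y`-degree, the ideal `J` agrees with `(z)`. -/
lemma mem_span_of_mem_resJ {φ : Matrix (Fin n) (Fin m) (PolyS k n p)}
    (hφ : ∀ i j, φ i j ∈ piece k n p (0, 1)) {d : ℤ × ℤ} (hd : 1 ≤ d.1 ∨ d.2 < n) {f : PolyS k n p}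
    (hf : f ∈ resJ k n m p φ) (hfd : f ∈ piece k n p d) :
    f ∈ Ideal.span (Set.range (zseq k n m p φ)) := by
  rw [← hproj_of_mem hfd]
  have hle : minorsIdeal n φ ≤ resJ k n m p φ := le_sup_right
  rw [resJ_eq_span] at hf
  refine mem_homogeneous_span (fun g hg a => ?_) hf
  rcases hg with ⟨j, rfl⟩ | ⟨r, c, rfl⟩
  · rw [mul_comm, hproj_mul (zseq_mem hφ j)]
    exact Ideal.mul_mem_right _ _ (Ideal.subset_span ⟨j, rfl⟩)
  · rw [mul_comm, hproj_mul (minor_mem hφ r c)]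
    have hx := hproj_mem (k := k) (d - (0, (n : ℤ))) a
    rcases hd with hd | hd
    · have h1 := mem_xIdeal_pow hx (N := 1) (by simpa using hd)
      rw [pow_one, xIdeal] at h1
      have hdet : (φ.submatrix r c).det ∈ resJ k n m p φ :=
        hle (Ideal.subset_span ⟨r, c, rfl⟩)
      refine Submodule.span_induction (p := fun u _ => (φ.submatrix r c).det * u ∈ _)
        ?_ ?_ ?_ ?_ h1
      · rintro _ ⟨i, rfl⟩
        rw [mul_comm]
        exact X_mul_mem_span φ i hdet
      · simp
      · intro x y _ _ hx hy
        rw [mul_add]; exact add_mem hx hy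
      · intro a x _ hx
        rw [smul_eq_mul, mul_left_comm]
        exact Ideal.mul_mem_left _ _ hx
    · rw [piece_eq_bot (Or.inr (by simpa using hd)) hx, mul_zero]
      exact zero_mem _

lemma exists_kd_zop_one {φ : Matrix (Fin n) (Fin m) (PolyS k n p)}
    (hφ : ∀ i j, φ i j ∈ piece k n p (0, 1)) {d : ℤ × ℤ} {y : PolyS k n p}
    (hy : y ∈ piece k n p d) (hz : y ∈ Ideal.span (Set.range (zseq k n m p φ))) :
    ∃ b ∈ KP (zdeg m) (piece k n p) 1 d, kd (zop φ) b ∅ = y := by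
  obtain ⟨a, ha⟩ := Ideal.mem_span_range_iff_exists_fun.1 hz
  refine ⟨fun T => if T.card = 1 then hproj k (d - ∑ i ∈ T, zdeg m i) (∑ i ∈ T, a i) else 0,
    fun T => ⟨fun h => by simp only [if_pos h]; exact hproj_mem _ _, fun h => if_neg h⟩, ?_⟩
  rw [kd_apply']
  have h2 := congrArg (hproj k d) ha
  rw [hproj_of_mem hy, map_sum] at h2
  rw [← h2]
  simp only [Finset.notMem_empty, not_false_eq_true, Finset.filter_true]
  refine Finset.sum_congr rfl fun i _ => ?_
  rw [mul_comm, hproj_mul (zseq_mem hφ i)]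
  simp [sgn, zop, zdeg, op_apply]

section quotient

variable (φ : Matrix (Fin n) (Fin m) (PolyS k n p))

/-- The quotient `S/J`. -/
abbrev QS : Type := PolyS k n p ⧸ resJ k n m p φ

/-- The projection `S → S/J`. -/
def qpi : PolyS k n p →ₗ[k] QS φ := (Ideal.Quotient.mkₐ k (resJ k n m p φ)).toLinearMap

/-- The graded pieces of `S/J`. -/
def qpiece (d : ℤ × ℤ) : Submodule k (QS φ) := (piece k n p d).map (qpi φ)

/-- The `N`-th powers of the `x`-variables acting on `S/J`. -/
def xopQ (N : ℕ) (i : Fin n) : Module.End k (QS φ) := op k (qpi φ (X (Sum.inl i) ^ N))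

/-- The variables acting on `S/J`. -/
def vopQ (i : Vars n p) : Module.End k (QS φ) := op k (qpi φ (X (ofLex i)))

lemma qpi_surjective : Function.Surjective (qpi φ) := Ideal.Quotient.mk_surjective

lemma qpi_mul (f g : PolyS k n p) : qpi φ (f * g) = qpi φ f * qpi φ g :=
  map_mul (Ideal.Quotient.mkₐ k (resJ k n m p φ)) f g

lemma qpi_eq_zero {f : PolyS k n p} : qpi φ f = 0 ↔ f ∈ resJ k n m p φ :=
  Ideal.Quotient.eq_zero_iff_mem

lemma qpi_mem {d : ℤ × ℤ} {f : PolyS k n p} (hf : f ∈ piece k n p d) : qpi φ f ∈ qpiece φ d :=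
  Submodule.mem_map_of_mem hf

lemma qpi_zop (j : Fin m) (f : PolyS k n p) : qpi φ (zop φ j f) = 0 := by
  rw [qpi_eq_zero]
  exact Ideal.mul_mem_right _ _ (Submodule.mem_sup_left (Ideal.subset_span ⟨j, rfl⟩))

lemma xopQ_mem (N : ℕ) (i : Fin n) (e : ℤ × ℤ) (x : QS φ) (hx : x ∈ qpiece φ e) :
    xopQ φ N i x ∈ qpiece φ (e + xdeg n N i) := by
  obtain ⟨f, hf, rfl⟩ := hx
  exact ⟨_, xop_mem N i e f hf, qpi_mul φ _ _⟩

lemma vopQ_mem (i : Vars n p) (e : ℤ × ℤ) (x : QS φ) (hx : x ∈ qpiece φ e) :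
    vopQ φ i x ∈ qpiece φ (e + vdeg n p i) := by
  obtain ⟨f, hf, rfl⟩ := hx
  exact ⟨_, vop_mem i e f hf, qpi_mul φ _ _⟩

lemma qpiece_eq_zero {d : ℤ × ℤ} (hd : d.1 < 0 ∨ d.2 < 0) {x : QS φ} (hx : x ∈ qpiece φ d) :
    x = 0 := by
  obtain ⟨f, hf, rfl⟩ := hx
  rw [piece_eq_bot hd hf, map_zero]

end quotient

end ResInt

namespace ResInt

open Koszul

section contraction

variable {R α : Type*} [CommRing R] [LinearOrder α] [Fintype α]

/-- Contraction by a linear form, as an endomorphism of the exterior algebra of `R ^ α`. -/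
def iota (R α : Type*) [CommRing R] [LinearOrder α] [Fintype α] :
    (α → R) →ₗ[R] Module.End R (Finset α → R) where
  toFun v := kd (smulOp R v)
  map_add' v w := by
    refine LinearMap.ext fun c => funext fun T => ?_
    rw [LinearMap.add_apply, Pi.add_apply, kd_apply', kd_apply', kd_apply',
      ← Finset.sum_add_distrib]
    refine Finset.sum_congr rfl fun i _ => ?_
    rw [← smul_add]
    simp only [smulOp_apply, Pi.add_apply, add_smul]
  map_smul' r v := by
    refine LinearMap.ext fun c => funext fun T => ?_
    rw [LinearMap.smul_apply, Pi.smul_apply, kd_apply', kd_apply', Finset.smul_sum]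
    refine Finset.sum_congr rfl fun i _ => ?_
    rw [RingHom.id_apply, smul_comm r]
    simp only [smulOp_apply, Pi.smul_apply, smul_assoc]

lemma iota_apply (v : α → R) (c : Finset α → R) (T : Finset α) :
    iota R α v c T = ∑ i ∈ Finset.univ.filter (· ∉ T), sgn i T • (v i * c (insert i T)) :=
  kd_apply' _ _ _

lemma iota_mul_self (v : α → R) : iota R α v * iota R α v = 0 :=
  LinearMap.ext fun c => kd_kd _ (fun i j => LinearMap.ext fun y => smul_comm (v i) (v j) y) c

lemma iota_mul_iota (v w : α → R) : iota R α v * iota R α w = (-1 : ℤ) • (iota R α w * iota R α v) := by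
  have h := iota_mul_self (v + w)
  rw [map_add, mul_add, add_mul, add_mul, iota_mul_self, iota_mul_self, zero_add, add_zero] at h
  rw [neg_one_smul]
  exact eq_neg_of_add_eq_zero_right h

variable {n : ℕ} (v : Fin n → α → R)

lemma iota_mul_prod_eq_zero (i : Fin n) (l : List (Fin n)) (hi : i ∈ l) :
    iota R α (v i) * (l.map fun j => iota R α (v j)).prod = 0 := by
  induction l with
  | nil => simp at hi
  | cons j l ih =>
    rw [List.map_cons, List.prod_cons, ← mul_assoc]
    rcases List.mem_cons.1 hi with rfl | h
    · rw [iota_mul_self, zero_mul]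
    · rw [iota_mul_iota, smul_mul_assoc, mul_assoc, ih h, mul_zero, smul_zero]

lemma iota_mul_prod (i : Fin n) (l : List (Fin n)) (hl : l.Pairwise (· < ·)) (hi : i ∉ l) :
    iota R α (v i) * (l.map fun j => iota R α (v j)).prod =
      ((-1) ^ (l.filter (· < i)).length : ℤ) •
        ((l.orderedInsert (· ≤ ·) i).map fun j => iota R α (v j)).prod := by
  induction l with
  | nil => simp
  | cons j l ih =>
    rw [List.pairwise_cons] at hl
    rw [List.mem_cons, not_or] at hi
    rcases lt_or_gt_of_ne hi.1 with h | h
    · rw [List.orderedInsert_cons, if_pos h.le]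
      have : (j :: l).filter (· < i) = [] := by
        rw [List.filter_eq_nil_iff]
        intro x hx
        rcases List.mem_cons.1 hx with rfl | hx
        · simpa using h.le
        · simpa using (h.trans (hl.1 _ hx)).le
      rw [this]
      simp
    · rw [List.orderedInsert_cons, if_neg (not_le.2 h), List.map_cons, List.prod_cons, ← mul_assoc,
        iota_mul_iota, smul_mul_assoc, mul_assoc, ih hl.2 hi.2,
        List.filter_cons_of_pos (by simpa using h), List.length_cons, pow_succ', mul_smul,
        mul_smul_comm, List.map_cons, List.prod_cons]

/-- Contraction by the wedge of the forms `v i`, `i ∈ V`. -/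
def iotaSet (V : Finset (Fin n)) : Module.End R (Finset α → R) :=
  ((V.sort (· ≤ ·)).map fun j => iota R α (v j)).prod

lemma iota_mul_iotaSet_of_mem {i : Fin n} {V : Finset (Fin n)} (hi : i ∈ V) :
    iota R α (v i) * iotaSet v V = 0 :=
  iota_mul_prod_eq_zero v i _ ((Finset.mem_sort _).2 hi)

lemma iota_mul_iotaSet {i : Fin n} {V : Finset (Fin n)} (hi : i ∉ V) :
    iota R α (v i) * iotaSet v V = sgn i V • iotaSet v (insert i V) := by
  have h1 : (insert i V).sort (· ≤ ·) = (V.sort (· ≤ ·)).orderedInsert (· ≤ ·) i := by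
    refine List.Perm.eq_of_pairwise (le := (· ≤ ·)) (fun a b _ _ => le_antisymm) (Finset.pairwise_sort _ _)
      ((Finset.pairwise_sort _ _).orderedInsert _ _) ?_
    rw [← Multiset.coe_eq_coe, Finset.sort_eq, Finset.insert_val_of_notMem hi,
      Multiset.coe_eq_coe.2 (List.perm_orderedInsert _ _ _), ← Multiset.cons_coe, Finset.sort_eq]
  have h2 : ((V.sort (· ≤ ·)).filter (· < i)).length = (V.filter (· < i)).card := by
    rw [Finset.card_def, Finset.filter_val, ← Finset.sort_eq V (· ≤ ·), Multiset.filter_coe,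
      Multiset.coe_card]
  rw [iotaSet, iota_mul_prod v i _ (Finset.sortedLT_sort V).pairwise
    (by simpa using hi), h2, iotaSet, h1]
  rfl

lemma iotaSet_empty : iotaSet v (∅ : Finset (Fin n)) = 1 := by
  simp [iotaSet]

lemma iotaSet_univ : iotaSet v Finset.univ = (List.ofFn fun i => iota R α (v i)).prod := by
  rw [iotaSet, Fin.sort_univ, List.ofFn_eq_map]

lemma iota_congr {L : Finset α} {v w : α → R} (h : ∀ i ∈ L, v i = w i) {c c' : Finset α → R}
    (hcc : c = c') (hc : ∀ T, ¬ T ⊆ L → c T = 0) :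
    iota R α v c = iota R α w c' ∧ ∀ T, ¬ T ⊆ L → iota R α v c T = 0 := by
  subst hcc
  refine ⟨funext fun T => ?_, fun T hT => ?_⟩
  · rw [iota_apply, iota_apply]
    refine Finset.sum_congr rfl fun i _ => ?_
    by_cases hi : i ∈ L
    · rw [h i hi]
    · rw [hc _ fun hs => hi (hs (Finset.mem_insert_self _ _)), mul_zero, mul_zero]
  · rw [iota_apply]
    refine Finset.sum_eq_zero fun i _ => ?_
    rw [hc _ fun hs => hT ((Finset.subset_insert _ _).trans hs), mul_zero, smul_zero]

lemma prod_iota_congr {L : Finset α} {v w : Fin n → α → R} (h : ∀ j, ∀ i ∈ L, v j i = w j i)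
    (l : List (Fin n)) {c : Finset α → R} (hc : ∀ T, ¬ T ⊆ L → c T = 0) :
    (l.map fun j => iota R α (v j)).prod c = (l.map fun j => iota R α (w j)).prod c ∧
      ∀ T, ¬ T ⊆ L → (l.map fun j => iota R α (v j)).prod c T = 0 := by
  induction l with
  | nil => exact ⟨rfl, hc⟩
  | cons j l ih =>
    simp only [List.map_cons, List.prod_cons, Module.End.mul_apply]
    exact iota_congr (h j) ih.1 ih.2

/-- The full contraction is a combination of maximal minors. -/
theorem iotaSet_univ_mem {R : Type} [CommRing R] {m : ℕ} (v : Fin n → Fin m → R)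
    {c : Finset (Fin m) → R}
    (hc : ∀ T, T.card ≠ n → c T = 0) : iotaSet v Finset.univ c ∅ ∈ minorsIdeal n (Matrix.of v) := by
  have hsum : c = ∑ L, Pi.single L (c L) := (Finset.univ_sum_single c).symm
  rw [hsum, map_sum, Finset.sum_apply]
  refine Ideal.sum_mem _ fun L _ => ?_
  by_cases hL : L.card = n
  swap
  · rw [hc L hL, Pi.single_zero, map_zero]; exact zero_mem _
  set c' : Finset (Fin m) → R := Pi.single L (c L) with hc'
  let e := L.orderEmbOfFin hL
  let g : (Fin n → R) →ₗ[R] Module.End R (Finset (Fin m) → R) :=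
    iota R (Fin m) ∘ₗ Function.ExtendByZero.linearMap R e
  let G : ExteriorAlgebra R (Fin n → R) →ₐ[R] Module.End R (Finset (Fin m) → R) :=
    ExteriorAlgebra.lift R ⟨g, fun v => iota_mul_self _⟩
  let ev : Module.End R (Finset (Fin m) → R) →ₗ[R] R :=
    LinearMap.proj ∅ ∘ₗ LinearMap.applyₗ c'
  let f : (Fin n → R) [⋀^Fin n]→ₗ[R] R :=
    (ev ∘ₗ G.toLinearMap).compAlternatingMap (ExteriorAlgebra.ιMulti R n)
  have hf : ∀ w, f w = (List.ofFn fun i => g (w i)).prod c' ∅ := by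
    intro w
    simp only [f, LinearMap.compAlternatingMap_apply, ExteriorAlgebra.ιMulti_apply,
      LinearMap.comp_apply, AlgHom.toLinearMap_apply, map_list_prod, List.map_ofFn, ev,
      LinearMap.proj_apply, LinearMap.applyₗ_apply_apply]
    have : (G ∘ fun i => (ExteriorAlgebra.ι R) (w i)) = fun i => g (w i) := by
      funext i
      simp [G]
    rw [this]
  have h1 : iotaSet v Finset.univ c' ∅ = f fun i => v i ∘ e := by
    rw [hf, iotaSet_univ, List.ofFn_eq_map, List.ofFn_eq_map]
    refine congrFun (prod_iota_congr (L := L) (v := v)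
      (w := fun i => Function.extend e (v i ∘ e) 0) ?_ _ ?_).1 ∅
    · intro j i hi
      obtain ⟨i', rfl⟩ : ∃ i', e i' = i := by
        have : i ∈ Set.range e := by rw [Finset.range_orderEmbOfFin]; exact hi
        exact this
      rw [e.injective.extend_apply]
      rfl
    · intro T hT
      rw [hc', Pi.single_apply, if_neg]
      rintro rfl
      exact hT subset_rfl
  rw [h1, f.eq_smul_basis_det (Pi.basisFun R (Fin n)), AlternatingMap.smul_apply, smul_eq_mul,
    Pi.basisFun_det]
  exact Ideal.mul_mem_left _ _
    (Ideal.subset_span ⟨Function.Embedding.refl _, e.toEmbedding, rfl⟩)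

end contraction

end ResInt

namespace ResInt

open Koszul

variable {k : Type} [Field k] {n m p : ℕ}

lemma xop_commute (N : ℕ) (i j : Fin n) : Commute (xop k n p N i) (xop k n p N j) :=
  op_commute _ _

lemma sum_xdeg (N : ℕ) (T : Finset (Fin n)) : ∑ i ∈ T, xdeg n N i = ((T.card : ℤ) * N, 0) := by
  simp [xdeg]

/-- A form of `x`-degree `n (N - 1)` all of whose `x`-exponents are less than `N` is divisible by
`(x₁ ⋯ xₙ) ^ (N - 1)`. -/
lemma exists_eq_prod_mul {N : ℕ} {e : ℤ} {r : PolyS k n p}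
    (hr : r ∈ piece k n p ((n * (N - 1) : ℕ), e)) (hdiv : ∀ i, divX k (Sum.inl i) N r = 0) :
    ∃ g ∈ piece k n p (0, e), r = (∏ i : Fin n, X (Sum.inl i) ^ (N - 1)) * g := by
  classical
  set ν : Fin n ⊕ Fin p →₀ ℕ := ∑ i : Fin n, Finsupp.single (Sum.inl i) (N - 1) with hν
  have hprod : (∏ i : Fin n, X (Sum.inl i) ^ (N - 1) : PolyS k n p) = monomial ν 1 := by
    simp only [X_pow_eq_monomial, hν, ← monomial_sum_one]
  have hνl : ∀ i, ν (Sum.inl i) = N - 1 := by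
    intro i
    simp only [hν, Finsupp.finsetSum_apply, Finsupp.single_apply, Sum.inl.injEq]
    simp
  have hνr : ∀ i, ν (Sum.inr i) = 0 := by
    intro i
    simp [hν, Finsupp.finsetSum_apply]
  have hνd : mdeg ν = (((n * (N - 1) : ℕ) : ℤ), 0) := by
    simp [mdeg, hνl, hνr]
  refine ⟨divMonomial r ν, ?_, ?_⟩
  · rw [mem_piece]
    intro μ hμ
    rw [coeff_divMonomial] at hμ
    have := mem_piece.1 hr _ hμ
    rw [mdeg_add, hνd] at this
    rw [← sub_eq_iff_eq_add'.2 this.symm]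
    ext <;> simp
  · rw [hprod]
    ext μ
    rw [coeff_monomial_mul', one_mul]
    split_ifs with h
    · rw [coeff_divMonomial, add_tsub_cancel_of_le h]
    · by_contra hne
      apply h
      have h1 : ∀ i, μ (Sum.inl i) < N := fun i => lt_of_divX_eq_zero (hdiv i) hne
      have h2 := congrArg Prod.fst (mem_piece.1 hr μ hne)
      simp only [mdeg, Nat.cast_inj] at h2
      have h3 : ∑ i : Fin n, (N - 1) = n * (N - 1) := by simp
      rw [← h3] at h2
      have h4 := (Finset.sum_eq_sum_iff_of_le fun i _ => Nat.le_sub_one_of_lt (h1 i)).1 h2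
      intro s
      rcases s with i | i
      · rw [hνl, h4 i (Finset.mem_univ i)]
      · rw [hνr]; exact Nat.zero_le _

lemma iota_mem {v : Fin m → PolyS k n p} (hv : ∀ j, v j ∈ piece k n p (0, 1)) {q : ℕ} {d : ℤ × ℤ}
    {c : Finset (Fin m) → PolyS k n p} (hc : c ∈ KP (fun _ => ((0, 1) : ℤ × ℤ)) (piece k n p) (q + 1) d) :
    iota _ _ v c ∈ KP (fun _ => ((0, 1) : ℤ × ℤ)) (piece k n p) q d := by
  have h : iota _ _ v c = kd (fun j => op k (v j)) c := by
    funext T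
    rw [iota_apply, kd_apply']
    rfl
  rw [h]
  refine kd_mem (fun i e x hx => ?_) hc
  rw [add_comm]
  exact mul_mem_piece (hv i) hx

lemma prod_iota_mem {φ : Matrix (Fin n) (Fin m) (PolyS k n p)}
    (hφ : ∀ i j, φ i j ∈ piece k n p (0, 1)) (l : List (Fin n)) {q : ℕ} {d : ℤ × ℤ}
    {c : Finset (Fin m) → PolyS k n p}
    (hc : c ∈ KP (fun _ => ((0, 1) : ℤ × ℤ)) (piece k n p) (l.length + q) d) :
    (l.map fun j => iota _ _ (φ j)).prod c ∈ KP (fun _ => ((0, 1) : ℤ × ℤ)) (piece k n p) q d := by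
  induction l generalizing q with
  | nil => simpa using hc
  | cons j l ih =>
    rw [List.map_cons, List.prod_cons, Module.End.mul_apply]
    refine iota_mem (hφ j) (ih ?_)
    rw [List.length_cons] at hc
    rwa [← add_assoc, add_right_comm]

lemma iotaSet_mem {φ : Matrix (Fin n) (Fin m) (PolyS k n p)}
    (hφ : ∀ i j, φ i j ∈ piece k n p (0, 1)) {V : Finset (Fin n)} {q : ℕ} {d : ℤ × ℤ}
    {c : Finset (Fin m) → PolyS k n p}
    (hc : c ∈ KP (fun _ => ((0, 1) : ℤ × ℤ)) (piece k n p) (V.card + q) d) :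
    iotaSet (fun i => φ i) V c ∈ KP (fun _ => ((0, 1) : ℤ × ℤ)) (piece k n p) q d := by
  refine prod_iota_mem hφ _ ?_
  rwa [Finset.length_sort]

lemma kd_zop_eq (φ : Matrix (Fin n) (Fin m) (PolyS k n p)) (c : Finset (Fin m) → PolyS k n p)
    (M : Finset (Fin m)) :
    kd (zop φ) c M = ∑ i : Fin n, X (Sum.inl i) * iota _ _ (φ i) c M := by
  rw [kd_apply']
  simp only [iota_apply, Finset.mul_sum]
  rw [Finset.sum_comm]
  refine Finset.sum_congr rfl fun j _ => ?_
  simp only [zop, op_apply, zseq, Finset.sum_mul, Finset.smul_sum]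
  refine Finset.sum_congr rfl fun i _ => ?_
  rw [mul_smul_comm, mul_assoc]

/-- The total cycle attached to a chain of `y`-forms. -/
def corr (φ : Matrix (Fin n) (Fin m) (PolyS k n p)) (N : ℕ) (g : Finset (Fin m) → PolyS k n p)
    (q : ℕ) (V : Finset (Fin n)) (M : Finset (Fin m)) : PolyS k n p :=
  if V.card = q then (∏ i ∈ Vᶜ, X (Sum.inl i) ^ (N - 1)) * iotaSet (fun i => φ i) V g M else 0

lemma corr_mem {φ : Matrix (Fin n) (Fin m) (PolyS k n p)}
    (hφ : ∀ i j, φ i j ∈ piece k n p (0, 1)) {N : ℕ} (hN : 1 ≤ N) {e : ℤ}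
    {g : Finset (Fin m) → PolyS k n p}
    (hg : g ∈ KP (fun _ => ((0, 1) : ℤ × ℤ)) (piece k n p) n (0, e)) {a b : ℕ} (hab : a + b = n) :
    corr φ N g a ∈ KY (xdeg n N) (zdeg m) (piece k n p) ((n * N : ℕ), e) a b := by
  refine fun V => ⟨fun hV M => ⟨fun hM => ?_, fun hM => ?_⟩, fun hV => ?_⟩
  · simp only [corr, if_pos hV]
    have h1 : (∏ i ∈ Vᶜ, X (Sum.inl i) ^ (N - 1) : PolyS k n p) ∈
        piece k n p ((b * (N - 1) : ℕ), 0) := by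
      have : ∀ s : Finset (Fin n), (∏ i ∈ s, X (Sum.inl i) ^ (N - 1) : PolyS k n p) ∈
          piece k n p ((s.card * (N - 1) : ℕ), 0) := by
        intro s
        induction s using Finset.induction_on with
        | empty =>
          rw [Finset.prod_empty, ← C_1]
          rw [Finset.card_empty, zero_mul]
          exact C_mem_piece (n := n) (p := p) (1 : k)
        | insert a s ha ih =>
          rw [Finset.prod_insert ha, Finset.card_insert_of_notMem ha]
          have := mul_mem_piece (X_pow_mem_piece (k := k) (Sum.inl a : Fin n ⊕ Fin p) (N - 1)) ih
          convert this using 2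
          simp [bideg, Prod.ext_iff]
          ring
      have h2 := this Vᶜ
      have h3 : Vᶜ.card = b := by rw [Finset.card_compl, hV, Fintype.card_fin]; omega
      rwa [h3] at h2
    have h2 := ((iotaSet_mem hφ (V := V) (q := b) (by rwa [hV, hab]) : _) M).1 hM
    convert mul_mem_piece h1 h2 using 2
    rw [sum_xdeg, sum_zdeg, hV, hM]
    simp only [Finset.sum_const, hM, ← hab]
    obtain ⟨N, rfl⟩ := Nat.exists_eq_add_of_le' hN
    ext <;> simp
    ring
  · simp only [corr, if_pos hV]
    rw [((iotaSet_mem hφ (V := V) (q := b) (by rwa [hV, hab]) : _) M).2 hM, mul_zero]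
  · funext M
    exact if_neg hV

lemma dd1_corr (φ : Matrix (Fin n) (Fin m) (PolyS k n p)) {N : ℕ} (hN : 1 ≤ N)
    (g : Finset (Fin m) → PolyS k n p) (a : ℕ) :
    dd1 (Fin m) (xop k n p N) (corr φ N g (a + 1)) = dd2 (Fin n) (zop φ) (corr φ N g a) := by
  funext V M
  rw [dd1_apply, coef_apply, kd_zop_eq, kd_apply']
  by_cases hV : V.card = a
  · have h : ∀ i, iota _ _ (φ i) (corr φ N g a V) M =
        (∏ i ∈ Vᶜ, X (Sum.inl i) ^ (N - 1)) *
          (iota _ _ (φ i) * iotaSet (fun i => φ i) V) g M := by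
      intro i
      have : corr φ N g a V =
          (∏ i ∈ Vᶜ, X (Sum.inl i) ^ (N - 1) : PolyS k n p) • iotaSet (fun i => φ i) V g := by
        funext M
        simp [corr, if_pos hV]
      rw [this, map_smul]
      rfl
    simp only [h]
    rw [Finset.sum_filter]
    refine Finset.sum_congr rfl fun i _ => ?_
    by_cases hi : i ∈ V
    · have := iota_mul_iotaSet_of_mem (fun i => φ i) hi
      rw [this]
      simp [hi]
    · have : iota _ _ (φ i) * iotaSet (fun i => φ i) V =
          sgn i V • iotaSet (fun i => φ i) (insert i V) := iota_mul_iotaSet _ hi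
      rw [this, if_pos hi, corr, if_pos (by rw [Finset.card_insert_of_notMem hi, hV])]
      have hc : Vᶜ = insert i (insert i V)ᶜ := by
        rw [Finset.compl_insert, Finset.insert_erase (by simpa using hi)]
      rw [hc, Finset.prod_insert (by simp)]
      simp only [xop, op_apply, LinearMap.smul_apply, Pi.smul_apply, mul_smul_comm]
      congr 1
      obtain ⟨N, rfl⟩ := Nat.exists_eq_add_of_le' hN
      rw [Nat.add_sub_cancel, pow_succ']
      ring
  · have h : corr φ N g a V = 0 := by
      funext M
      simp [corr, hV]
    rw [h]
    simp only [map_zero, Pi.zero_apply, mul_zero, Finset.sum_const_zero]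
    refine Finset.sum_eq_zero fun i hi => ?_
    have hi : i ∉ V := by simpa using hi
    rw [corr, if_neg (by rw [Finset.card_insert_of_notMem hi]; omega), map_zero, smul_zero]

/-- The Koszul complex of `x ^ N` on `S/J` is exact in large degrees. -/
theorem kex_xopQ {φ : Matrix (Fin n) (Fin m) (PolyS k n p)}
    (hφ : ∀ i j, φ i j ∈ piece k n p (0, 1)) {N : ℕ} (hN : 1 ≤ N)
    (hz : ∀ (q : ℕ) (d : ℤ × ℤ), 1 ≤ q → (N : ℤ) ≤ d.1 →
      KEx (zop φ) (zdeg m) (piece k n p) q d) (r : ℕ) (d : ℤ × ℤ) (hd : (n * N : ℕ) ≤ d.1) :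
    KEx (xopQ φ N) (xdeg n N) (qpiece φ) r d := by
  rcases lt_or_ge n r with hr | hr
  · exact kex_of_card_lt (by simpa using hr)
  have hfst : ∀ T : Finset (Fin n), T.card + 1 ≤ r → (N : ℤ) ≤ (d - ∑ j ∈ T, xdeg n N j).1 := by
    intro T hT
    rw [sum_xdeg, Prod.fst_sub]
    have : ((T.card + 1) * N : ℕ) ≤ n * N := Nat.mul_le_mul_right _ (by omega)
    push_cast [← @Nat.cast_le ℤ] at this hd
    simp only
    linarith
  refine edge_exact' (G := piece k n p) (F := xop k n p N) (H := zop φ) (dβ := zdeg m)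
    (π := qpi φ) (xop_commute N) (fun _ _ => op_commute _ _) (fun _ _ => op_commute _ _)
    (xop_mem N) (zop_mem hφ) (fun e x hx => qpi_mem φ hx)
    (fun i x => qpi_mul φ _ _) (qpi_zop φ) ?_ ?_ ?_ ?_ ?_
  · rintro T - y ⟨z, hz, rfl⟩
    exact ⟨z, hz, rfl⟩
  · intro T hT y hy h0
    refine exists_kd_zop_one hφ hy (mem_span_of_mem_resJ hφ (Or.inl ?_) ((qpi_eq_zero φ).1 h0) hy)
    have := hfst T hT.le
    omega
  · intro T q hq hT
    exact hz q _ hq (hfst T (by omega))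
  · intro U q hq _
    exact kex_x N q _ (Or.inl hq)
  · intro u hu
    by_cases hlt : (n * (N - 1) : ℕ) < d.1 - r
    · obtain ⟨b, hb, e⟩ := dd1_exact (F := xop k n p N) (dβ := zdeg m) (q := r)
        (fun U hU => kex_x N 0 _ (Or.inr (by rw [sum_zdeg, hU]; exact hlt))) u hu (kd_zero hu)
      exact ⟨0, fun _ _ _ => zero_mem _, fun _ _ => by simp, by simp, b, hb, by simp [e]⟩
    obtain ⟨N', rfl⟩ := Nat.exists_eq_add_of_le' hN
    obtain ⟨d, e⟩ := d
    have hN' : n * (N' + 1) = n * N' + n := by ring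
    simp only [Nat.add_sub_cancel] at hlt hd ⊢
    obtain rfl : r = n := by push_cast [hN'] at hd hlt; omega
    obtain rfl : d = ((r * (N' + 1) : ℕ) : ℤ) := by push_cast [hN'] at hd hlt ⊢; linarith
    set D : ℤ × ℤ := (((r * (N' + 1) : ℕ) : ℤ), e) with hD
    have hcyc : ∀ L : Finset (Fin m), L.card = r →
        (fun V => u V L) ∈ KP (xdeg r (N' + 1)) (piece k r p) 0 (D - ∑ j ∈ L, zdeg m j) := by
      intro L hL V
      refine ⟨fun hV => ?_, fun hV => by simp [(hu V).2 hV]⟩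
      rw [sub_right_comm]
      exact ((hu V).1 hV L).1 hL
    have hb : ∀ L : Finset (Fin m), ∃ b : Finset (Fin r) → PolyS k r p,
        (L.card = r → b ∈ KP (xdeg r (N' + 1)) (piece k r p) 1 (D - ∑ j ∈ L, zdeg m j)) ∧
        (L.card ≠ r → b = 0) ∧
        ∀ i, divX k (Sum.inl i) (N' + 1) (u ∅ L - kd (xop k r p (N' + 1)) b ∅) = 0 := by
      intro L
      by_cases hL : L.card = r
      · obtain ⟨b, h1, -, h2⟩ := x_reduced (N' + 1) 0 (hcyc L hL) (kd_zero (hcyc L hL))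
        exact ⟨b, fun _ => h1, fun h => absurd hL h, fun i => h2 i ∅⟩
      · refine ⟨0, fun h => absurd h hL, fun _ => rfl, fun i => ?_⟩
        have h0 : (∅ : Finset (Fin r)).card = 0 := rfl
        rw [((hu ∅).1 h0 L).2 hL]
        simp
    choose b hb1 hb2 hb3 using hb
    have hg : ∀ L : Finset (Fin m), ∃ g : PolyS k r p,
        (L.card = r → g ∈ piece k r p (0, e - r)) ∧ (L.card ≠ r → g = 0) ∧
        u ∅ L - kd (xop k r p (N' + 1)) (b L) ∅ = (∏ i : Fin r, X (Sum.inl i) ^ N') * g := by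
      intro L
      by_cases hL : L.card = r
      · have h1 := sub_mem (hcyc L hL) (kd_mem (xop_mem (N' + 1)) (hb1 L hL))
        have h2 := (h1 ∅).1 rfl
        have h3 : D - ∑ j ∈ L, zdeg m j - ∑ i ∈ (∅ : Finset (Fin r)), xdeg r (N' + 1) i =
            (((r * (N' + 1 - 1) : ℕ) : ℤ), e - r) := by
          rw [sum_zdeg, hL, Finset.sum_empty, sub_zero, hD]
          ext <;> simp
          ring
        rw [h3] at h2
        obtain ⟨g, hg, hr⟩ := exists_eq_prod_mul h2 (hb3 L)
        exact ⟨g, fun _ => hg, fun h => absurd hL h, by simpa using hr⟩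
      · refine ⟨0, fun h => absurd h hL, fun _ => rfl, ?_⟩
        have h0 : (∅ : Finset (Fin r)).card = 0 := rfl
        rw [((hu ∅).1 h0 L).2 hL, hb2 L hL]
        simp
    choose g hg1 hg2 hg3 using hg
    have hgK : g ∈ KP (fun _ => ((0, 1) : ℤ × ℤ)) (piece k r p) r (0, e) := by
      refine fun L => ⟨fun hL => ?_, hg2 L⟩
      convert hg1 L hL using 2
      simp [hL]
    refine ⟨corr φ (N' + 1) g, fun a b hab => corr_mem hφ hN hgK hab,
      fun a _ => dd1_corr φ hN g a, ?_, fun V L => b L V, ?_, ?_⟩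
    · funext V
      rw [aug_apply]
      simp only [corr]
      split_ifs with hV
      · obtain rfl : V = Finset.univ := (Finset.card_eq_iff_eq_univ V).1 (by simpa using hV)
        rw [Finset.compl_univ, Finset.prod_empty, one_mul]
        refine (qpi_eq_zero φ).2 (Submodule.mem_sup_right ?_)
        exact iotaSet_univ_mem (fun i => φ i) hg2
      · exact map_zero _
    · refine fun V => ⟨fun hV L => ⟨fun hL => ?_, fun hL => by simp [hb2 L hL]⟩, fun hV => ?_⟩
      · rw [sub_right_comm]
        exact (hb1 L hL V).1 hV
      · funext L
        by_cases hL : L.card = r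
        · exact (hb1 L hL V).2 hV
        · simp [hb2 L hL]
    · funext V L
      rw [Pi.add_apply, Pi.add_apply, dd1_apply]
      by_cases hV : V = ∅
      · subst hV
        have := hg3 L
        rw [sub_eq_iff_eq_add'] at this
        rw [this]
        simp [corr, iotaSet_empty]
      · have hVc : V.card ≠ 0 := by simpa using hV
        rw [(hu V).2 hVc, corr, if_neg hVc, add_zero]
        by_cases hL : L.card = r
        · exact ((kd_mem (xop_mem (N' + 1)) (hb1 L hL) V).2 hVc).symm
        · have : (fun T => b L T) = 0 := hb2 L hL
          rw [this]
          simp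

end ResInt

namespace ResInt

open Koszul

variable {k : Type} [Field k] {n m p : ℕ}

lemma kex_congr {M α Δ Δ' : Type*} [AddCommGroup M] [Module k M] [LinearOrder α] [Fintype α]
    [AddCommGroup Δ] [AddCommGroup Δ'] {F : α → Module.End k M} {deg : α → Δ} {deg' : α → Δ'}
    {G : Δ → Submodule k M} {G' : Δ' → Submodule k M} {q : ℕ} {d : Δ} {d' : Δ'}
    (h : ∀ T, G (d - ∑ i ∈ T, deg i) = G' (d' - ∑ i ∈ T, deg' i))
    (hK : KEx F deg G q d) : KEx F deg' G' q d' := by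
  have e : ∀ q, KP deg G q d = KP deg' G' q d' := by
    intro q
    ext c
    simp only [mem_KP, h]
  intro c hc h0
  rw [← e] at hc
  obtain ⟨b, hb, h⟩ := hK c hc h0
  exact ⟨b, by rwa [← e], h⟩

/-- The linear strand bound for the Koszul homology of `z`. -/
theorem kex_zop {φ : Matrix (Fin n) (Fin m) (PolyS k n p)}
    (hφ : ∀ i j, φ i j ∈ piece k n p (0, 1)) {N0 : ℕ}
    (hz : ∀ (q : ℕ) (d : ℤ × ℤ), 1 ≤ q → (N0 : ℤ) ≤ d.1 →
      KEx (zop φ) (zdeg m) (piece k n p) q d) {r : ℕ} (hr : 1 ≤ r) {d : ℤ × ℤ}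
    (hd : d.2 < n + r) : KEx (zop φ) (zdeg m) (piece k n p) r d := by
  set N : ℕ := N0 + d.1.natAbs with hN
  refine top_edge_exact (H := xop k n p N) (dβ := xdeg n N) (fun _ _ => op_commute _ _)
    (xop_commute N) (fun _ _ => op_commute _ _) (zop_mem hφ) (xop_mem N) ?_ ?_
  · intro U q hq hU
    rw [Fintype.card_fin] at hq hU
    refine hz q _ (by omega) ?_
    rw [sum_xdeg, sum_xdeg, Finset.card_univ, Fintype.card_fin]
    have : ((U.card + 1) * N : ℕ) ≤ n * N := Nat.mul_le_mul_right _ hU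
    push_cast [← @Nat.cast_le ℤ] at this
    simp only [Prod.fst_sub, Prod.fst_add]
    have h2 : (N : ℤ) = N0 + |d.1| := by rw [hN]; push_cast; rfl
    have := neg_abs_le d.1
    linarith
  · intro T q hq hT
    rw [Fintype.card_fin] at hq
    rcases Nat.eq_zero_or_pos q with rfl | h
    · refine kex_of_forall_eq_bot fun V _ y hy => piece_eq_bot (Or.inr ?_) hy
      rw [sum_xdeg, sum_xdeg, sum_zdeg]
      simp only [Prod.snd_sub, Prod.snd_add]
      omega
    · exact kex_x N q _ (Or.inl h)

lemma qpi_vop (φ : Matrix (Fin n) (Fin m) (PolyS k n p)) (i : Vars n p) (f : PolyS k n p) :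
    qpi φ (vop k n p i f) = vopQ φ i (qpi φ f) := qpi_mul φ _ _

theorem kex_vopQ_of_lt {φ : Matrix (Fin n) (Fin m) (PolyS k n p)}
    (hφ : ∀ i j, φ i j ∈ piece k n p (0, 1)) {N0 : ℕ}
    (hz : ∀ (q : ℕ) (d : ℤ × ℤ), 1 ≤ q → (N0 : ℤ) ≤ d.1 →
      KEx (zop φ) (zdeg m) (piece k n p) q d) {i : ℕ} {a b : ℤ} (h0 : ¬ (a = i ∧ b = i))
    (h : b < n ∨ a + b - n + 1 < i) : KEx (vopQ φ) (vdeg n p) (qpiece φ) i (a, b) := by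
  refine edge_exact (G := piece k n p) (F := vop k n p) (H := zop φ) (dβ := zdeg m)
    (π := qpi φ) (fun _ _ => op_commute _ _) (fun _ _ => op_commute _ _)
    (fun _ _ => op_commute _ _)
    vop_mem (zop_mem hφ) (fun e x hx => qpi_mem φ hx)
    (qpi_vop φ) (qpi_zop φ) ?_ ?_ ?_ ?_
  · rintro T - y ⟨z, hz, rfl⟩
    exact ⟨z, hz, rfl⟩
  · intro T hT y hy hy0
    refine exists_kd_zop_one hφ hy ?_
    have hc := card_left_add T
    rw [sum_vdeg] at hy
    by_cases h1 : (a - ((T.filter fun i => (ofLex i).isLeft).card : ℤ)) < 0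
    · rw [piece_eq_bot (Or.inl h1) hy]
      exact zero_mem _
    · refine mem_span_of_mem_resJ hφ ?_ ((qpi_eq_zero φ).1 hy0) hy
      simp only [Prod.fst_sub, Prod.snd_sub]
      omega
  · intro T q hq hT
    have hc := card_left_add T
    rw [sum_vdeg]
    by_cases h1 : (a - ((T.filter fun i => (ofLex i).isLeft).card : ℤ)) < 0
    · refine kex_of_forall_eq_bot fun V _ y hy => piece_eq_bot (Or.inl ?_) hy
      rw [sum_zdeg]
      simp only [Prod.fst_sub]
      omega
    · refine kex_zop hφ hz hq ?_
      simp only [Prod.snd_sub]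
      omega
  · intro U q hq
    refine kex_v q _ ?_
    rw [sum_zdeg]
    rcases Nat.eq_zero_or_pos q with rfl | hq'
    · right
      intro h3
      have h4 := congrArg Prod.fst h3
      have h5 := congrArg Prod.snd h3
      simp only [Prod.fst_sub, Prod.snd_sub, Prod.fst_zero, Prod.snd_zero] at h4 h5
      omega
    · exact Or.inl hq'

/-- Truncation by an additional grading. -/
def gtrunc {M : Type*} [AddCommGroup M] [Module k M] (G : ℤ × ℤ → Submodule k M)
    (e : ℤ × ℤ × ℤ) : Submodule k M := if 0 ≤ e.1 then G e.2 else ⊥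

lemma gtrunc_map {M N : Type*} [AddCommGroup M] [Module k M] [AddCommGroup N] [Module k N]
    {G : ℤ × ℤ → Submodule k M} {G' : ℤ × ℤ → Submodule k N} (g : M →ₗ[k] N) {e δ : ℤ × ℤ × ℤ}
    (hδ : 0 ≤ δ.1) (h : ∀ x ∈ G e.2, g x ∈ G' (e.2 + δ.2)) (x : M) (hx : x ∈ gtrunc G e) :
    g x ∈ gtrunc G' (e + δ) := by
  unfold gtrunc at hx ⊢
  split_ifs at hx with h1
  · rw [if_pos (by simp only [Prod.fst_add]; omega)]
    exact h x hx
  · rw [(Submodule.mem_bot k).1 hx, map_zero]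
    exact zero_mem _

lemma gtrunc_le {M : Type*} [AddCommGroup M] [Module k M] {G : ℤ × ℤ → Submodule k M}
    {e : ℤ × ℤ × ℤ} {x : M} (hx : x ∈ gtrunc G e) : x ∈ G e.2 := by
  unfold gtrunc at hx
  split_ifs at hx with h1
  · exact hx
  · rw [(Submodule.mem_bot k).1 hx]
    exact zero_mem _

lemma eq_zero_of_gtrunc {M : Type*} [AddCommGroup M] [Module k M] {G : ℤ × ℤ → Submodule k M}
    {e : ℤ × ℤ × ℤ} (he : e.1 < 0) {x : M} (hx : x ∈ gtrunc G e) : x = 0 := by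
  rw [gtrunc, if_neg (not_le.2 he)] at hx
  exact (Submodule.mem_bot k).1 hx

/-- Degrees of the variables in the refined grading. -/
def vdeg' (n p : ℕ) (i : Vars n p) : ℤ × ℤ × ℤ := ((vdeg n p i).1, vdeg n p i)

lemma vdeg'_nonneg (i : Vars n p) : 0 ≤ (vdeg' n p i).1 := by
  unfold vdeg' vdeg
  rcases ofLex i with j | j <;> simp [bideg]

lemma sum_vdeg' (T : Finset (Vars n p)) :
    ∑ i ∈ T, vdeg' n p i = ((∑ i ∈ T, vdeg n p i).1, ∑ i ∈ T, vdeg n p i) := by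
  simp only [vdeg', Prod.ext_iff, Prod.fst_sum, Prod.snd_sum, and_self]

lemma sum_ground {γ : Type*} (T : Finset γ) (f : γ → ℤ × ℤ) :
    ∑ i ∈ T, ((0 : ℤ), f i) = (0, ∑ i ∈ T, f i) := by
  simp only [Prod.ext_iff, Prod.fst_sum, Prod.snd_sum, Finset.sum_const_zero, and_self]

theorem kex_vopQ_gtrunc {φ : Matrix (Fin n) (Fin m) (PolyS k n p)}
    (hφ : ∀ i j, φ i j ∈ piece k n p (0, 1)) {N : ℕ} (hN : 1 ≤ N)
    (hz : ∀ (q : ℕ) (d : ℤ × ℤ), 1 ≤ q → (N : ℤ) ≤ d.1 →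
      KEx (zop φ) (zdeg m) (piece k n p) q d) {i : ℕ} {a b c : ℤ}
    (hc : N ≤ c) (hm : m < a + c)
    (h : (i : ℤ) ≠ a + b ∨ n ≤ a ∨ m < b) :
    KEx (vopQ φ) (vdeg' n p) (gtrunc (qpiece φ)) i (a, a + c, b) := by
  refine edge_exact (G := gtrunc (piece k n p)) (F := vop k n p) (H := zop φ)
    (dβ := fun j => (0, zdeg m j))
    (π := qpi φ) (fun _ _ => op_commute _ _) (fun _ _ => op_commute _ _)
    (fun _ _ => op_commute _ _)
    (fun j e x hx => gtrunc_map _ (vdeg'_nonneg j) (fun x hx => vop_mem j _ x hx) x hx)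
    (fun j e x hx => gtrunc_map _ le_rfl (fun x hx => zop_mem hφ j _ x hx) x hx)
    (fun e x hx => by
      have := gtrunc_map (δ := 0) (G' := qpiece φ) (qpi φ) le_rfl
        (fun x hx => by rw [Prod.snd_zero, add_zero]; exact qpi_mem φ hx) x hx
      rwa [add_zero] at this)
    (qpi_vop φ) (qpi_zop φ) ?_ ?_ ?_ ?_
  · intro T _ y hy
    unfold gtrunc at hy ⊢
    split_ifs at hy ⊢
    · obtain ⟨z, hz, rfl⟩ := hy
      exact ⟨z, hz, rfl⟩
    · exact ⟨0, zero_mem _, by rw [(Submodule.mem_bot k).1 hy, map_zero]⟩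
  · intro T _ y hy hy0
    rw [sum_vdeg'] at hy ⊢
    rcases lt_or_ge (a - (∑ i ∈ T, vdeg n p i).1) 0 with h1 | h1
    · rw [eq_zero_of_gtrunc h1 hy]
      exact ⟨0, zero_mem _, by rw [map_zero]; rfl⟩
    · have hy' := gtrunc_le hy
      obtain ⟨u, hu, e⟩ := exists_kd_zop_one hφ hy' (mem_span_of_mem_resJ hφ (Or.inl (by
        simp only [Prod.snd_sub, Prod.fst_sub]; omega)) ((qpi_eq_zero φ).1 hy0) hy')
      refine ⟨u, fun V => ⟨fun hV => ?_, (hu V).2⟩, e⟩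
      rw [sum_ground, gtrunc, if_pos (by simpa using h1)]
      exact (hu V).1 hV
  · intro T q hq _
    rw [sum_vdeg']
    rcases lt_or_ge (a - (∑ i ∈ T, vdeg n p i).1) 0 with h1 | h1
    · refine kex_of_forall_eq_bot fun V _ y hy => eq_zero_of_gtrunc ?_ hy
      rw [sum_ground]
      simpa using h1
    · refine kex_congr (fun V => ?_) (hz q ((a + c, b) - ∑ i ∈ T, vdeg n p i) hq (by
        simp only [Prod.fst_sub]; omega))
      rw [sum_ground, gtrunc, if_pos (by simpa using h1)]
      rfl
  · intro U q hq
    have hU := Finset.card_le_univ U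
    rw [Fintype.card_fin] at hU
    refine kex_congr (fun V => ?_)
      (kex_v_trunc q (a + c - U.card, b - U.card) a (by simp only; omega) (by
        simp only; omega))
    rw [sum_ground, sum_vdeg', sum_zdeg, gtrunc, trunc]
    simp only [Prod.fst_sub, Prod.mk_sub_mk]
    refine if_congr ?_ rfl rfl
    omega

/-- Vanishing of the Koszul homology of `S/J`. -/
theorem kex_vopQ_of_notMem {φ : Matrix (Fin n) (Fin m) (PolyS k n p)}
    (hφ : ∀ i j, φ i j ∈ piece k n p (0, 1)) {N0 : ℕ}
    (hz : ∀ (q : ℕ) (d : ℤ × ℤ), 1 ≤ q → (N0 : ℤ) ≤ d.1 →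
      KEx (zop φ) (zdeg m) (piece k n p) q d) {i : ℕ} {a b : ℤ}
    (h : n ≤ a ∨ m < b ∨ i < a + b - n + 1 ∨ a + b < i) :
    KEx (vopQ φ) (vdeg n p) (qpiece φ) i (a, b) := by
  obtain ⟨N, hN⟩ : ∃ N : ℕ, N = N0 + 1 + m + a.natAbs := ⟨_, rfl⟩
  have hz' : ∀ (q : ℕ) (d : ℤ × ℤ), 1 ≤ q → (N : ℤ) ≤ d.1 →
      KEx (zop φ) (zdeg m) (piece k n p) q d := fun q d hq hd => hz q d hq (by omega)
  have key : KEx (vopQ φ) (vdeg' n p) (gtrunc (qpiece φ)) i (a, a, b) := by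
    refine top_edge_exact (H := xopQ φ N) (dβ := fun j => (0, xdeg n N j))
      (fun _ _ => op_commute _ _) (fun _ _ => op_commute _ _) (fun _ _ => op_commute _ _)
      (fun j e x hx => gtrunc_map _ (vdeg'_nonneg j) (fun x hx => vopQ_mem φ j _ x hx) x hx)
      (fun j e x hx => gtrunc_map _ le_rfl (fun x hx => xopQ_mem φ N j _ x hx) x hx) ?_ ?_
    · intro U q hq hU
      rw [Fintype.card_fin] at hq hU
      have h1 : ((U.card + 1) * N : ℕ) ≤ n * N := Nat.mul_le_mul_right _ hU
      have h2 := kex_vopQ_gtrunc hφ (by omega) hz' (i := q) (a := a) (b := b)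
        (c := (n * N : ℕ) - (U.card * N : ℕ)) (by
          push_cast [← @Nat.cast_le ℤ] at h1 ⊢; linarith) (by
          rw [add_mul, one_mul] at h1
          omega) (by omega)
      rw [sum_ground, sum_ground, sum_xdeg, sum_xdeg, Finset.card_univ, Fintype.card_fin]
      have e : ((a, a, b) : ℤ × ℤ × ℤ) + (0, ((n * N : ℕ) : ℤ), 0) - (0, ((U.card * N : ℕ) : ℤ), 0) =
          (a, a + (((n * N : ℕ) : ℤ) - ((U.card * N : ℕ) : ℤ)), b) := by
        simp only [Prod.mk_add_mk, Prod.mk_sub_mk, Prod.mk.injEq]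
        refine ⟨?_, ?_, ?_⟩ <;> ring
      exact (congrArg _ e).mpr h2
    · intro T q _ _
      rw [sum_ground, sum_xdeg, Finset.card_univ, Fintype.card_fin, sum_vdeg']
      rcases lt_or_ge (a - (∑ i ∈ T, vdeg n p i).1) 0 with h1 | h1
      · refine kex_of_forall_eq_bot fun V _ y hy => eq_zero_of_gtrunc ?_ hy
        rw [sum_ground]
        simpa using h1
      · refine kex_congr (fun V => ?_) (kex_xopQ hφ (by omega) hz' q
          ((a, b) + ((n : ℤ) * N, 0) - ∑ i ∈ T, vdeg n p i) (by
            simp only [Prod.fst_sub, Prod.fst_add]; push_cast; omega))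
        rw [sum_ground, gtrunc, if_pos (by simpa using h1)]
        rfl
  refine kex_congr (fun V => ?_) key
  rw [sum_vdeg', gtrunc]
  split_ifs with h1
  · rfl
  · symm
    rw [Submodule.eq_bot_iff]
    intro x hx
    exact qpiece_eq_zero φ (Or.inl (by simpa using h1)) hx

theorem kex_vopQ {φ : Matrix (Fin n) (Fin m) (PolyS k n p)}
    (hφ : ∀ i j, φ i j ∈ piece k n p (0, 1)) {N0 : ℕ}
    (hz : ∀ (q : ℕ) (d : ℤ × ℤ), 1 ≤ q → (N0 : ℤ) ≤ d.1 →
      KEx (zop φ) (zdeg m) (piece k n p) q d) {i : ℕ} {a b : ℤ}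
    (h1 : ¬ (a = i ∧ b = i ∧ i < n)) (h2 : ¬ (n ≤ b ∧ b ≤ m ∧ a < n ∧ (i : ℤ) = a + b - n + 1)) :
    KEx (vopQ φ) (vdeg n p) (qpiece φ) i (a, b) := by
  by_cases h : n ≤ a ∨ m < b ∨ i < a + b - n + 1 ∨ a + b < i
  · exact kex_vopQ_of_notMem hφ hz h
  · exact kex_vopQ_of_lt hφ hz (by omega) (by omega)

end ResInt

namespace Koszul

variable {k M M' α Δ : Type*} [Field k] [AddCommGroup M] [Module k M] [AddCommGroup M']
  [Module k M'] [LinearOrder α] [Fintype α] [AddCommGroup Δ]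

/-- Graded Koszul cycles. -/
def KZ (F : α → Module.End k M) (deg : α → Δ) (G : Δ → Submodule k M) (q : ℕ) (d : Δ) :
    Submodule k (Finset α → M) := KP deg G q d ⊓ LinearMap.ker (kd F)

/-- Graded Koszul boundaries. -/
def KB (F : α → Module.End k M) (deg : α → Δ) (G : Δ → Submodule k M) (q : ℕ) (d : Δ) :
    Submodule k (Finset α → M) := (KP deg G (q + 1) d).map (kd F)

lemma mem_KZ {F : α → Module.End k M} {deg : α → Δ} {G : Δ → Submodule k M} {q : ℕ} {d : Δ}
    {c : Finset α → M} : c ∈ KZ F deg G q d ↔ c ∈ KP deg G q d ∧ kd F c = 0 := Iff.rfl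

lemma mem_KB {F : α → Module.End k M} {deg : α → Δ} {G : Δ → Submodule k M} {q : ℕ} {d : Δ}
    {c : Finset α → M} : c ∈ KB F deg G q d ↔ ∃ b ∈ KP deg G (q + 1) d, kd F b = c := Iff.rfl

/-- The dimension of the graded Koszul homology. -/
def hdim (F : α → Module.End k M) (deg : α → Δ) (G : Δ → Submodule k M) (q : ℕ) (d : Δ) : ℕ :=
  Module.finrank k (KZ F deg G q d ⧸ (KB F deg G q d).submoduleOf (KZ F deg G q d))

lemma hdim_eq_finrank {P : Type*} [AddCommGroup P] [Module k P] {F : α → Module.End k M}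
    {deg : α → Δ} {G : Δ → Submodule k M} {q : ℕ} {d : Δ} {W : Type*} [AddCommGroup W]
    [Module k W] (u : P →ₗ[k] Finset α → M) (hu : ∀ x, u x ∈ KZ F deg G q d)
    (hs : ∀ c ∈ KZ F deg G q d, ∃ x, u x = c) (v : P →ₗ[k] W) (hv : Function.Surjective v)
    (h : ∀ x, u x ∈ KB F deg G q d ↔ v x = 0) :
    hdim F deg G q d = Module.finrank k W := by
  set B := (KB F deg G q d).submoduleOf (KZ F deg G q d)
  set u' : P →ₗ[k] (KZ F deg G q d ⧸ B) := B.mkQ ∘ₗ u.codRestrict _ hu with hu'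
  have hs' : Function.Surjective u' := by
    intro y
    obtain ⟨z, rfl⟩ := B.mkQ_surjective y
    obtain ⟨x, hx⟩ := hs z.1 z.2
    exact ⟨x, by rw [hu', LinearMap.comp_apply]; congr 1; exact Subtype.ext hx⟩
  have hk : LinearMap.ker u' = LinearMap.ker v := by
    ext x
    rw [LinearMap.mem_ker, LinearMap.mem_ker, ← h, hu', LinearMap.comp_apply,
      Submodule.mkQ_apply, Submodule.Quotient.mk_eq_zero]
    exact Iff.rfl
  exact ((u'.quotKerEquivOfSurjective hs').symm.trans
    ((Submodule.quotEquivOfEq _ _ hk).trans (v.quotKerEquivOfSurjective hv))).finrank_eq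

lemma hdim_eq_hdim {P : Type*} [AddCommGroup P] [Module k P] {F : α → Module.End k M}
    {F' : α → Module.End k M'} {deg : α → Δ} {G : Δ → Submodule k M} {G' : Δ → Submodule k M'}
    {q q' : ℕ} {d : Δ} (u : P →ₗ[k] Finset α → M) (hu : ∀ x, u x ∈ KZ F deg G q d)
    (hs : ∀ c ∈ KZ F deg G q d, ∃ x, u x = c) (u' : P →ₗ[k] Finset α → M')
    (hu' : ∀ x, u' x ∈ KZ F' deg G' q' d) (hs' : ∀ c ∈ KZ F' deg G' q' d, ∃ x, u' x = c)
    (h : ∀ x, u x ∈ KB F deg G q d ↔ u' x ∈ KB F' deg G' q' d) :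
    hdim F deg G q d = hdim F' deg G' q' d := by
  refine hdim_eq_finrank u hu hs (((KB F' deg G' q' d).submoduleOf _).mkQ ∘ₗ
    u'.codRestrict _ hu') ?_ fun x => ?_
  · intro y
    obtain ⟨z, rfl⟩ := Submodule.mkQ_surjective _ y
    obtain ⟨x, hx⟩ := hs' z.1 z.2
    exact ⟨x, by rw [LinearMap.comp_apply]; congr 1; exact Subtype.ext hx⟩
  · rw [h, LinearMap.comp_apply, Submodule.mkQ_apply, Submodule.Quotient.mk_eq_zero]
    exact Iff.rfl

/-- Chains lift along a graded surjection. -/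
lemma exists_coef_eq {deg : α → Δ} {G : Δ → Submodule k M} {G' : Δ → Submodule k M'}
    {g : M →ₗ[k] M'} (hg : ∀ e x, x ∈ G' e → ∃ y ∈ G e, g y = x) {q : ℕ} {d : Δ}
    {c : Finset α → M'} (hc : c ∈ KP deg G' q d) : ∃ b ∈ KP deg G q d, coef g b = c := by
  have : ∀ T, ∃ y, (T.card = q → y ∈ G (d - ∑ i ∈ T, deg i)) ∧ (T.card ≠ q → y = 0) ∧
      g y = c T := by
    intro T
    by_cases h : T.card = q
    · obtain ⟨y, hy, e⟩ := hg _ _ ((hc T).1 h)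
      exact ⟨y, fun _ => hy, fun h' => absurd h h', e⟩
    · exact ⟨0, fun h' => absurd h' h, fun _ => rfl, by rw [map_zero, (hc T).2 h]⟩
  choose b h1 h2 h3 using this
  exact ⟨b, fun T => ⟨h1 T, h2 T⟩, funext h3⟩

/-- Dimension shift along a short exact sequence `0 → M₁ → M → M' → 0` of graded modules
with `M` acyclic. -/
theorem hdim_shift {F : α → Module.End k M} {F' : α → Module.End k M'} {deg : α → Δ}
    {G G1 : Δ → Submodule k M} {G' : Δ → Submodule k M'} {g : M →ₗ[k] M'}
    (hF : ∀ i j, Commute (F i) (F j)) (hFG : ∀ i e x, x ∈ G e → F i x ∈ G (e + deg i))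
    (hgF : ∀ i x, g (F i x) = F' i (g x)) (hgG : ∀ e x, x ∈ G e → g x ∈ G' e)
    (hg : ∀ e x, x ∈ G' e → ∃ y ∈ G e, g y = x)
    (hG1 : ∀ e x, x ∈ G1 e ↔ x ∈ G e ∧ g x = 0) {j : ℕ} {d : Δ}
    (hK : KEx F deg G (j + 1) d) (hZ : ∀ c ∈ KZ F deg G1 j d, c ∈ KB F deg G j d) :
    hdim F' deg G' (j + 1) d = hdim F deg G1 j d := by
  have hcd := coef_kd F F' g hgF
  have mem1 : ∀ {q : ℕ} {c : Finset α → M}, c ∈ KP deg G1 q d ↔ c ∈ KP deg G q d ∧ coef g c = 0 := by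
    intro q c
    constructor
    · intro hc
      refine ⟨KP_mono (fun e x hx => ((hG1 e x).1 hx).1) _ _ hc, funext fun T => ?_⟩
      by_cases h : T.card = q
      · exact ((hG1 _ _).1 ((hc T).1 h)).2
      · simp [coef_apply, (hc T).2 h]
    · intro hc T
      exact ⟨fun h => (hG1 _ _).2 ⟨(hc.1 T).1 h, congrFun hc.2 T⟩, (hc.1 T).2⟩
  have memg : ∀ {q : ℕ} {c : Finset α → M}, c ∈ KP deg G q d → coef g c ∈ KP deg G' q d := by
    intro q c hc T
    exact ⟨fun h => hgG _ _ ((hc T).1 h), fun h => by simp [coef_apply, (hc T).2 h]⟩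
  set P : Submodule k (Finset α → M) := KP deg G (j + 1) d ⊓ LinearMap.ker (coef g ∘ₗ kd F)
    with hP
  have memP : ∀ c, c ∈ P ↔ c ∈ KP deg G (j + 1) d ∧ coef g (kd F c) = 0 := fun c => Iff.rfl
  refine hdim_eq_hdim (coef g ∘ₗ P.subtype) (fun x => ?_) (fun c hc => ?_)
    (kd F ∘ₗ P.subtype) (fun x => ?_) (fun c hc => ?_) fun x => ?_
  · obtain ⟨x, hx⟩ := x
    rw [memP, hcd] at hx
    exact mem_KZ.2 ⟨memg hx.1, hx.2⟩
  · rw [mem_KZ] at hc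
    obtain ⟨b, hb, rfl⟩ := exists_coef_eq hg hc.1
    refine ⟨⟨b, (memP b).2 ⟨hb, by rw [hcd]; exact hc.2⟩⟩, rfl⟩
  · obtain ⟨x, hx⟩ := x
    rw [memP] at hx
    exact mem_KZ.2 ⟨mem1.2 ⟨kd_mem hFG hx.1, hx.2⟩, kd_kd F hF x⟩
  · obtain ⟨b, hb, rfl⟩ := mem_KB.1 (hZ c hc)
    exact ⟨⟨b, (memP b).2 ⟨hb, (mem1.1 (mem_KZ.1 hc).1).2⟩⟩, rfl⟩
  · obtain ⟨x, hx⟩ := x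
    rw [memP] at hx
    simp only [LinearMap.comp_apply, Submodule.subtype_apply, mem_KB]
    constructor
    · rintro ⟨b, hb, h⟩
      obtain ⟨b', hb', rfl⟩ := exists_coef_eq hg hb
      refine ⟨x - kd F b', mem1.2 ⟨sub_mem hx.1 (kd_mem hFG hb'), ?_⟩, ?_⟩
      · rw [map_sub, hcd, h, sub_self]
      · rw [map_sub, kd_kd F hF, sub_zero]
    · rintro ⟨b, hb, h⟩
      rw [mem1] at hb
      obtain ⟨y, hy, e⟩ := hK (x - b) (sub_mem hx.1 hb.1) (by rw [map_sub, h, sub_self])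
      exact ⟨coef g y, memg hy, by rw [← hcd, e, map_sub, hb.2, sub_zero]⟩

lemma hdim_eq_zero {F : α → Module.End k M} {deg : α → Δ} {G : Δ → Submodule k M} {q : ℕ} {d : Δ}
    (h : KEx F deg G q d) : hdim F deg G q d = 0 := by
  unfold hdim
  have : (KB F deg G q d).submoduleOf (KZ F deg G q d) = ⊤ := by
    rw [Submodule.submoduleOf, Submodule.eq_top_iff']
    exact fun c => h c.1 c.2.1 c.2.2
  rw [this]
  exact Module.finrank_zero_of_subsingleton

/-- Koszul chains as a product of graded pieces. -/
def KPequiv (deg : α → Δ) (G : Δ → Submodule k M) (q : ℕ) (d : Δ) :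
    KP deg G q d ≃ₗ[k] ((T : {T : Finset α // T.card = q}) → G (d - ∑ i ∈ T.1, deg i)) where
  toFun c T := ⟨c.1 T.1, (c.2 T.1).1 T.2⟩
  map_add' _ _ := rfl
  map_smul' _ _ := rfl
  invFun c := ⟨fun T => if h : T.card = q then (c ⟨T, h⟩ : M) else 0, fun T => by
    constructor
    · intro h
      simp only [dif_pos h]
      exact (c ⟨T, h⟩).2
    · intro h
      simp only [dif_neg h]⟩
  left_inv c := by
    ext T
    by_cases h : T.card = q
    · simp [h]
    · simp [h, (c.2 T).2 h]
  right_inv c := by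
    ext T
    simp [T.2]

variable {F : α → Module.End k M} {deg : α → Δ} {G : Δ → Submodule k M}

instance [∀ e, Module.Finite k (G e)] (q : ℕ) (d : Δ) : Module.Finite k (KP deg G q d) :=
  Module.Finite.equiv (KPequiv deg G q d).symm

lemma finrank_KP [∀ e, Module.Finite k (G e)] (q : ℕ) (d : Δ) :
    Module.finrank k (KP deg G q d) =
      ∑ T ∈ (Finset.univ : Finset (Finset α)).filter (·.card = q),
        Module.finrank k (G (d - ∑ i ∈ T, deg i)) := by
  rw [(KPequiv deg G q d).finrank_eq, Module.finrank_pi_fintype]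
  exact (Finset.sum_subtype _ (by simp) fun T =>
    Module.finrank k (G (d - ∑ i ∈ T, deg i))).symm

lemma KB_le_KZ (hF : ∀ i j, Commute (F i) (F j))
    (hFG : ∀ i e x, x ∈ G e → F i x ∈ G (e + deg i)) (q : ℕ) (d : Δ) :
    KB F deg G q d ≤ KZ F deg G q d := by
  rintro _ ⟨b, hb, rfl⟩
  exact ⟨kd_mem hFG hb, kd_kd F hF b⟩

lemma hdim_add_finrank_KB [∀ e, Module.Finite k (G e)] (hF : ∀ i j, Commute (F i) (F j))
    (hFG : ∀ i e x, x ∈ G e → F i x ∈ G (e + deg i)) (q : ℕ) (d : Δ) :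
    hdim F deg G q d + Module.finrank k (KB F deg G q d) = Module.finrank k (KZ F deg G q d) := by
  have : Module.Finite k (KZ F deg G q d) := Submodule.finiteDimensional_inf_left _ _
  rw [hdim, ← Submodule.finrank_quotient_add_finrank
    ((KB F deg G q d).submoduleOf (KZ F deg G q d)),
    (Submodule.submoduleOfEquivOfLe (KB_le_KZ hF hFG q d)).finrank_eq]

lemma finrank_KP_succ [∀ e, Module.Finite k (G e)] (q : ℕ) (d : Δ) :
    Module.finrank k (KB F deg G q d) + Module.finrank k (KZ F deg G (q + 1) d) =
      Module.finrank k (KP deg G (q + 1) d) := by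
  rw [← LinearMap.finrank_range_add_finrank_ker ((kd F).domRestrict (KP deg G (q + 1) d)),
    LinearMap.range_domRestrict, LinearMap.ker_domRestrict]
  congr 1
  have h : KZ F deg G (q + 1) d = ((LinearMap.ker (kd F)).submoduleOf _).map
      (KP deg G (q + 1) d).subtype := (Submodule.map_comap_subtype _ _).symm
  rw [h]
  exact (Submodule.equivMapOfInjective _ (Submodule.injective_subtype _) _).symm.finrank_eq

lemma finrank_KZ_zero (d : Δ) :
    Module.finrank k (KZ F deg G 0 d) = Module.finrank k (KP deg G 0 d) := by
  rw [show KZ F deg G 0 d = KP deg G 0 d from inf_eq_left.2 fun c hc => kd_zero hc]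

/-- The Euler characteristic of a graded Koszul complex. -/
theorem sum_hdim [∀ e, Module.Finite k (G e)] (hF : ∀ i j, Commute (F i) (F j))
    (hFG : ∀ i e x, x ∈ G e → F i x ∈ G (e + deg i)) (d : Δ) :
    ∑ q ∈ Finset.range (Fintype.card α + 1), (-1 : ℤ) ^ q * (hdim F deg G q d : ℤ) =
      ∑ T : Finset α, (-1 : ℤ) ^ T.card * (Module.finrank k (G (d - ∑ i ∈ T, deg i)) : ℤ) := by
  have h1 : ∀ N : ℕ, ∑ q ∈ Finset.range (N + 1), (-1 : ℤ) ^ q * (hdim F deg G q d : ℤ) =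
      ∑ q ∈ Finset.range (N + 1), (-1 : ℤ) ^ q * (Module.finrank k (KP deg G q d) : ℤ) -
        (-1) ^ N * (Module.finrank k (KB F deg G N d) : ℤ) := by
    intro N
    induction N with
    | zero =>
      have := hdim_add_finrank_KB hF hFG 0 d
      rw [finrank_KZ_zero] at this
      simp [← this]
    | succ N ih =>
      have h2 := hdim_add_finrank_KB hF hFG (N + 1) d
      have h3 := finrank_KP_succ (F := F) (deg := deg) (G := G) N d
      rw [Finset.sum_range_succ, ih, Finset.sum_range_succ _ (N + 1), ← h3, ← h2]
      push_cast
      ring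
  have h2 : KB F deg G (Fintype.card α) d = ⊥ := by
    rw [eq_bot_iff]
    rintro _ ⟨b, hb, rfl⟩
    have : b = 0 := funext fun T => (hb T).2 (by have := Finset.card_le_univ T; omega)
    rw [this, map_zero]
    exact zero_mem _
  rw [h1, h2, finrank_bot]
  simp only [finrank_KP, Nat.cast_zero, mul_zero, sub_zero, Nat.cast_sum, Finset.mul_sum]
  rw [← Finset.sum_fiberwise_of_maps_to (s := Finset.univ)
    (t := Finset.range (Fintype.card α + 1)) (g := Finset.card)
    (fun T _ => Finset.mem_range.2 (Nat.lt_succ_of_le (Finset.card_le_univ T)))]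
  refine Finset.sum_congr rfl fun q _ => Finset.sum_congr rfl fun T hT => ?_
  rw [(Finset.mem_filter.1 hT).2]

end Koszul

namespace ResInt

open Koszul

variable {k : Type} [Field k] {n m p : ℕ} {ι : Type} {δ : ι → ℤ × ℤ}

variable (k n p) in
/-- The graded pieces of the free module with generators in degrees `δ`. -/
def fpiece (δ : ι → ℤ × ℤ) (d : ℤ × ℤ) : Submodule k (ι →₀ PolyS k n p) where
  carrier := {v | ∀ r, v r ∈ piece k n p (d - δ r)}
  add_mem' h h' r := add_mem (h r) (h' r)
  zero_mem' _ := zero_mem _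
  smul_mem' a _ h r := Submodule.smul_mem _ a (h r)

lemma mem_fpiece {d : ℤ × ℤ} {v : ι →₀ PolyS k n p} :
    v ∈ fpiece k n p δ d ↔ ∀ r, v r ∈ piece k n p (d - δ r) := Iff.rfl

variable (k n p ι) in
/-- Multiplication by the variables on a free module. -/
def fop (i : Vars n p) : Module.End k (ι →₀ PolyS k n p) :=
  Algebra.lsmul k k (ι →₀ PolyS k n p) (X (ofLex i) : PolyS k n p)

lemma fop_apply (i : Vars n p) (v : ι →₀ PolyS k n p) :
    fop k n p ι i v = (X (ofLex i) : PolyS k n p) • v := rfl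

lemma fop_commute (i j : Vars n p) : Commute (fop k n p ι i) (fop k n p ι j) :=
  LinearMap.ext fun v =>
    smul_comm (X (ofLex i) : PolyS k n p) (X (ofLex j) : PolyS k n p) v

lemma lapply_fop (r : ι) (i : Vars n p) (v : ι →₀ PolyS k n p) :
    Finsupp.lapply (R := k) r (fop k n p ι i v) = vop k n p i (Finsupp.lapply (R := k) r v) := rfl

lemma fop_mem (i : Vars n p) (e : ℤ × ℤ) (v : ι →₀ PolyS k n p) (hv : v ∈ fpiece k n p δ e) :
    fop k n p ι i v ∈ fpiece k n p δ (e + vdeg n p i) := by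
  intro r
  rw [add_sub_right_comm]
  exact vop_mem i _ _ (hv r)

lemma coef_lapply_mem {q : ℕ} {d : ℤ × ℤ} {c : Finset (Vars n p) → ι →₀ PolyS k n p}
    (hc : c ∈ KP (vdeg n p) (fpiece k n p δ) q d) (r : ι) :
    coef (Finsupp.lapply (R := k) r) c ∈ KP (vdeg n p) (piece k n p) q (d - δ r) := by
  intro T
  refine ⟨fun h => ?_, fun h => ?_⟩
  · rw [sub_right_comm]
    exact (hc T).1 h r
  · rw [coef_apply, (hc T).2 h, map_zero]

lemma mem_KB_of_coef {q : ℕ} {d : ℤ × ℤ} {c : Finset (Vars n p) → ι →₀ PolyS k n p}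
    (h : ∀ r, coef (Finsupp.lapply (R := k) r) c ∈
      KB (vop k n p) (vdeg n p) (piece k n p) q (d - δ r)) :
    c ∈ KB (fop k n p ι) (vdeg n p) (fpiece k n p δ) q d := by
  classical
  have h' : ∀ r, ∃ b ∈ KP (vdeg n p) (piece k n p) (q + 1) (d - δ r),
      kd (vop k n p) b = coef (Finsupp.lapply (R := k) r) c ∧
        (coef (Finsupp.lapply (R := k) r) c = 0 → b = 0) := by
    intro r
    by_cases h0 : coef (Finsupp.lapply (R := k) r) c = 0
    · exact ⟨0, zero_mem _, by rw [map_zero, h0], fun _ => rfl⟩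
    · obtain ⟨b, hb, e⟩ := h r
      exact ⟨b, hb, e, fun h => absurd h h0⟩
  choose b hb e h0 using h'
  let B : Finset (Vars n p) → ι →₀ PolyS k n p := fun T =>
    Finsupp.onFinset (Finset.univ.biUnion fun V => (c V).support) (fun r => b r T) (by
      intro r hr
      by_contra hcon
      refine hr (congrFun (h0 r (funext fun V => ?_)) T)
      by_contra hV
      exact hcon (Finset.mem_biUnion.2 ⟨V, Finset.mem_univ _, Finsupp.mem_support_iff.2 hV⟩))
  have hB : ∀ r, coef (Finsupp.lapply (R := k) r) B = b r := fun r => rfl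
  refine ⟨B, fun T => ⟨fun h r => ?_, fun h => Finsupp.ext fun r => (hb r T).2 h⟩, ?_⟩
  · rw [sub_right_comm]
    exact (hb r T).1 h
  · funext T
    ext1 r
    have h1 := coef_kd (fop k n p ι) (vop k n p) (Finsupp.lapply (R := k) r) (lapply_fop r) B
    rw [hB, e] at h1
    exact congrFun h1 T

lemma kex_fop {q : ℕ} (hq : 1 ≤ q) (d : ℤ × ℤ) :
    KEx (fop k n p ι) (vdeg n p) (fpiece k n p δ) q d := by
  intro c hc h0
  refine mem_KB_of_coef fun r => kex_v q _ (Or.inl hq) _ (coef_lapply_mem hc r) ?_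
  rw [← coef_kd (fop k n p ι) (vop k n p) _ (lapply_fop r), h0, map_zero]

lemma eq_zero_of_mem_piece_zero {f : PolyS k n p} (hf : f ∈ piece k n p 0)
    (h : coeff 0 f = 0) : f = 0 := by
  ext μ
  by_contra hμ
  have h1 := mem_piece.1 hf μ hμ
  have h2 : μ = 0 := by
    ext i
    have h3 := congrArg Prod.fst h1
    have h4 := congrArg Prod.snd h1
    simp only [mdeg, Prod.fst_zero, Prod.snd_zero, Nat.cast_eq_zero, Finset.sum_eq_zero_iff,
      Finset.mem_univ, true_imp_iff] at h3 h4
    rcases i with i | i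
    · exact h3 i
    · exact h4 i
  exact hμ (by rw [h2, h, coeff_zero])

lemma mem_KB_zero_iff {d : ℤ × ℤ} {c : Finset (Vars n p) → ι →₀ PolyS k n p}
    (hc : c ∈ KP (vdeg n p) (fpiece k n p δ) 0 d) :
    c ∈ KB (fop k n p ι) (vdeg n p) (fpiece k n p δ) 0 d ↔
      ∀ r, δ r = d → coeff 0 (c ∅ r) = 0 := by
  constructor
  · rintro ⟨b, -, rfl⟩ r -
    rw [kd_apply', Finsupp.finsetSum_apply, coeff_sum]
    refine Finset.sum_eq_zero fun i _ => ?_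
    rw [Finsupp.smul_apply, fop_apply, Finsupp.smul_apply, smul_eq_mul, ← constantCoeff_eq,
      map_zsmul, map_mul, constantCoeff_X, zero_mul, smul_zero]
  · intro h
    refine mem_KB_of_coef fun r => ?_
    have hcr := coef_lapply_mem hc r
    by_cases hd : d - δ r = 0
    · have h2 : coef (Finsupp.lapply (R := k) r) c = 0 := by
        funext T
        by_cases hT : T.card = 0
        · rw [Finset.card_eq_zero] at hT
          subst hT
          have h3 := (hcr ∅).1 rfl
          rw [hd, Finset.sum_empty, sub_zero] at h3
          exact eq_zero_of_mem_piece_zero h3 (h r (sub_eq_zero.1 hd).symm)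
        · exact (hcr T).2 hT
      rw [h2]
      exact zero_mem _
    · exact kex_v 0 _ (Or.inr hd) _ hcr (kd_zero hcr)

variable (k n p) in
/-- The projection of a free module onto a graded piece. -/
def fproj (δ : ι → ℤ × ℤ) (d : ℤ × ℤ) : (ι →₀ PolyS k n p) →ₗ[k] (ι →₀ PolyS k n p) where
  toFun v := Finsupp.onFinset v.support (fun r => hproj k (d - δ r) (v r)) (by
    intro r hr
    rw [Finsupp.mem_support_iff]
    intro h
    exact hr (by rw [h, map_zero]))
  map_add' v w := by
    ext1 r
    simp
  map_smul' a v := by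
    ext1 r
    simp

lemma fproj_apply (d : ℤ × ℤ) (v : ι →₀ PolyS k n p) (r : ι) :
    fproj k n p δ d v r = hproj k (d - δ r) (v r) := rfl

lemma fproj_mem (d : ℤ × ℤ) (v : ι →₀ PolyS k n p) : fproj k n p δ d v ∈ fpiece k n p δ d :=
  fun _ => hproj_mem _ _

lemma fproj_of_mem {d : ℤ × ℤ} {v : ι →₀ PolyS k n p} (hv : v ∈ fpiece k n p δ d) :
    fproj k n p δ d v = v :=
  Finsupp.ext fun r => hproj_of_mem (hv r)

lemma fproj_of_mem_ne {d e : ℤ × ℤ} {v : ι →₀ PolyS k n p} (hv : v ∈ fpiece k n p δ e)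
    (h : e ≠ d) : fproj k n p δ d v = 0 :=
  Finsupp.ext fun r => hproj_of_mem_ne (hv r) fun h' => h (sub_left_inj.1 h').symm

open Classical in
lemma induction_homogeneous {P : (ι →₀ PolyS k n p) → Prop} (hadd : ∀ v w, P v → P w → P (v + w))
    (h0 : P 0) (h : ∀ e v, v ∈ fpiece k n p δ e → P v) (v : ι →₀ PolyS k n p) : P v := by
  induction v using Finsupp.induction_linear with
  | zero => exact h0
  | add v w hv hw => exact hadd v w hv hw
  | single r f =>
    induction f using MvPolynomial.induction_on' with
    | monomial μ a =>
      refine h (mdeg μ + δ r) _ fun r' => ?_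
      rw [Finsupp.single_apply]
      split_ifs with hr
      · rw [← hr, add_sub_cancel_right, mem_piece]
        intro ν hν
        rw [coeff_monomial] at hν
        split_ifs at hν with hμ
        · rw [hμ]
        · exact absurd rfl hν
      · exact zero_mem _
    | add f g hf hg =>
      rw [Finsupp.single_add]
      exact hadd _ _ hf hg

lemma map_fproj {κ : Type} {ε : κ → ℤ × ℤ} (f : (ι →₀ PolyS k n p) →ₗ[k] (κ →₀ PolyS k n p))
    (hf : ∀ d v, v ∈ fpiece k n p δ d → f v ∈ fpiece k n p ε d) (d : ℤ × ℤ)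
    (v : ι →₀ PolyS k n p) : f (fproj k n p δ d v) = fproj k n p ε d (f v) := by
  induction v using induction_homogeneous (δ := δ) with
  | hadd v w hv hw => simp only [map_add, hv, hw]
  | h0 => simp only [map_zero]
  | h e v hv =>
    rcases eq_or_ne e d with rfl | h
    · rw [fproj_of_mem hv, fproj_of_mem (hf _ _ hv)]
    · rw [fproj_of_mem_ne hv h, fproj_of_mem_ne (hf _ _ hv) h, map_zero]

lemma map_fproj_quotient {φ : Matrix (Fin n) (Fin m) (PolyS k n p)}
    (hφ : ∀ i j, φ i j ∈ piece k n p (0, 1)) (f : (ι →₀ PolyS k n p) →ₗ[k] QS φ)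
    (hf : ∀ d v, v ∈ fpiece k n p δ d → f v ∈ qpiece φ d) (d : ℤ × ℤ)
    (v : ι →₀ PolyS k n p) :
    ∀ g, f v = qpi φ g → f (fproj k n p δ d v) = qpi φ (hproj k d g) := by
  have key : ∀ g g', qpi φ g = qpi φ g' → qpi φ (hproj k d g) = qpi φ (hproj k d g') := by
    intro g g' h
    rw [← sub_eq_zero, ← map_sub, qpi_eq_zero] at h ⊢
    rw [← map_sub]
    exact hproj_mem_resJ hφ d h
  induction v using induction_homogeneous (δ := δ) with
  | hadd v w hv hw =>
    intro g hg
    obtain ⟨g1, h1⟩ := qpi_surjective φ (f v)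
    obtain ⟨g2, h2⟩ := qpi_surjective φ (f w)
    rw [map_add, ← h1, ← h2, ← map_add] at hg
    rw [map_add, map_add, hv g1 h1.symm, hw g2 h2.symm, ← map_add, ← map_add]
    exact key _ _ hg
  | h0 =>
    intro g hg
    rw [map_zero, ← map_zero (qpi φ)] at hg
    rw [← key _ _ hg]
    simp only [map_zero]
  | h e v hv =>
    intro g hg
    obtain ⟨g', hg', h1⟩ := hf e v hv
    rw [← key g' g (h1.trans hg)]
    rcases eq_or_ne e d with rfl | h
    · rw [fproj_of_mem hv, hproj_of_mem hg', ← h1]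
    · rw [fproj_of_mem_ne hv h, hproj_of_mem_ne hg' h.symm, map_zero, map_zero]

/-- Chains concentrated on the empty set. -/
lemma single_mem_KP {M α : Type*} [AddCommGroup M] [Module k M] [LinearOrder α] [Fintype α]
    {deg : α → ℤ × ℤ} {G : ℤ × ℤ → Submodule k M} {d : ℤ × ℤ} {x : M} (hx : x ∈ G d) :
    Pi.single (∅ : Finset α) x ∈ KP deg G 0 d := by
  intro T
  constructor
  · intro hT
    rw [Finset.card_eq_zero] at hT
    subst hT
    rwa [Pi.single_eq_same, Finset.sum_empty, sub_zero]
  · intro hT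
    exact Pi.single_eq_of_ne (by rintro rfl; exact hT rfl) _

/-- The zeroth homology of a graded module with a minimal graded cover. -/
theorem hdim_zero_eq {M' : Type*} [AddCommGroup M'] [Module k M'] {F' : Vars n p → Module.End k M'}
    {G' : ℤ × ℤ → Submodule k M'} {g : (ι →₀ PolyS k n p) →ₗ[k] M'}
    (hgF : ∀ i x, g (fop k n p ι i x) = F' i (g x))
    (hgG : ∀ e x, x ∈ fpiece k n p δ e → g x ∈ G' e)
    (hg : ∀ e x, x ∈ G' e → ∃ y ∈ fpiece k n p δ e, g y = x)
    (hmin : ∀ x r, g x = 0 → coeff 0 (x r) = 0) (d : ℤ × ℤ) [Fintype {r // δ r = d}] :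
    hdim F' (vdeg n p) G' 0 d = Fintype.card {r // δ r = d} := by
  classical
  have hcd := coef_kd (fop k n p ι) F' g hgF
  have memg : ∀ {q : ℕ} {c}, c ∈ KP (vdeg n p) (fpiece k n p δ) q d →
      coef g c ∈ KP (vdeg n p) G' q d := fun {q c} hc T =>
    ⟨fun h => hgG _ _ ((hc T).1 h), fun h => by rw [coef_apply, (hc T).2 h, map_zero]⟩
  let v : KP (vdeg n p) (fpiece k n p δ) 0 d →ₗ[k] ({r // δ r = d} → k) :=
    LinearMap.pi fun r => lcoeff k 0 ∘ₗ Finsupp.lapply (R := k) r.1 ∘ₗ LinearMap.proj ∅ ∘ₗ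
      Submodule.subtype _
  have hv : ∀ c r, v c r = coeff 0 (c.1 ∅ r.1) := fun _ _ => rfl
  rw [← Module.finrank_fintype_fun_eq_card k]
  refine hdim_eq_finrank (P := KP (vdeg n p) (fpiece k n p δ) 0 d) (coef g ∘ₗ Submodule.subtype _) (fun c => ?_) (fun c hc => ?_) v
    (fun w => ?_) fun c => ?_
  · exact mem_KZ.2 ⟨memg c.2, kd_zero (memg c.2)⟩
  · obtain ⟨b, hb, rfl⟩ := exists_coef_eq hg (mem_KZ.1 hc).1
    exact ⟨⟨b, hb⟩, rfl⟩
  · have hw : ∑ r : {r // δ r = d}, Finsupp.single r.1 (C (w r)) ∈ fpiece k n p δ d := by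
      refine sum_mem fun r _ => mem_fpiece.2 fun r' => ?_
      rw [Finsupp.single_apply]
      split_ifs with h
      · rw [← h, r.2, sub_self]
        exact C_mem_piece _
      · exact zero_mem _
    refine ⟨⟨_, single_mem_KP hw⟩, funext fun r => ?_⟩
    · rw [hv]
      simp only [Pi.single_eq_same]
      rw [Finsupp.finsetSum_apply, coeff_sum,
        Finset.sum_eq_single r]
      · rw [Finsupp.single_eq_same, coeff_zero_C]
      · intro r' _ h
        rw [Finsupp.single_eq_of_ne (fun h' => h (Subtype.ext h'.symm)), coeff_zero]
      · exact fun h => absurd (Finset.mem_univ _) h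
  · have h1 : v c = 0 ↔ c.1 ∈ KB (fop k n p ι) (vdeg n p) (fpiece k n p δ) 0 d := by
      rw [mem_KB_zero_iff c.2, _root_.funext_iff]
      exact ⟨fun h r hr => h ⟨r, hr⟩, fun h r => h r.1 r.2⟩
    rw [h1]
    constructor
    · rintro ⟨b, hb, h⟩
      obtain ⟨b, hb', rfl⟩ := exists_coef_eq hg hb
      rw [mem_KB_zero_iff c.2]
      intro r hr
      have h2 := (mem_KB_zero_iff (kd_mem fop_mem hb')).1 ⟨b, hb', rfl⟩ r hr
      have h3 := hmin (c.1 ∅ - kd (fop k n p ι) b ∅) r (by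
        have := congrFun ((hcd b).trans h) ∅
        rw [map_sub, sub_eq_zero]
        exact this.symm)
      rw [Finsupp.sub_apply, coeff_sub, h2, sub_zero] at h3
      exact h3
    · rintro ⟨b, hb, h⟩
      exact ⟨coef g b, memg hb, by rw [← hcd, h]; rfl⟩

end ResInt

namespace ResInt

open Koszul

variable {k : Type} [Field k] {n m p : ℕ}

/-- The degree of a generator. -/
def rdeg (β : ℕ → ℤ × ℤ → ℕ) (i : ℕ) (r : RIdx β i) : ℤ × ℤ := r.1.1

/-- The generators of a given degree. -/
def ridxEquiv (β : ℕ → ℤ × ℤ → ℕ) (i : ℕ) (d : ℤ × ℤ) : Fin (β i d) ≃ {r // rdeg β i r = d} where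
  toFun j := ⟨⟨(d, j), j.2⟩, rfl⟩
  invFun r := ⟨r.1.1.2, by
    obtain ⟨⟨⟨d', j⟩, hj⟩, rfl⟩ := r
    exact hj⟩
  left_inv _ := rfl
  right_inv r := by
    obtain ⟨⟨⟨d', j⟩, hj⟩, rfl⟩ := r
    rfl

instance (β : ℕ → ℤ × ℤ → ℕ) (i : ℕ) (d : ℤ × ℤ) : Fintype {r // rdeg β i r = d} :=
  Fintype.ofEquiv _ (ridxEquiv β i d)

lemma card_rdeg (β : ℕ → ℤ × ℤ → ℕ) (i : ℕ) (d : ℤ × ℤ) :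
    Fintype.card {r // rdeg β i r = d} = β i d := by
  rw [← Fintype.card_congr (ridxEquiv β i d), Fintype.card_fin]

lemma coeff_zero_of_mem_smul {ι : Type} {v : ι →₀ PolyS k n p}
    (hv : v ∈ varIdeal k n p • (⊤ : Submodule (PolyS k n p) (ι →₀ PolyS k n p))) (r : ι) :
    coeff 0 (v r) = 0 := by
  have h1 : varIdeal k n p ≤ RingHom.ker (constantCoeff (R := k) (σ := Fin n ⊕ Fin p)) := by
    rw [varIdeal, Ideal.span_le]
    rintro _ ⟨i, rfl⟩
    exact (MvPolynomial.constantCoeff_X (R := k) i)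
  rw [← constantCoeff_eq]
  induction hv using Submodule.smul_induction_on' with
  | smul a ha w _ =>
    rw [Finsupp.smul_apply, smul_eq_mul, map_mul, RingHom.mem_ker.1 (h1 ha), zero_mul]
  | add v _ w _ hv hw => rw [Finsupp.add_apply, map_add, hv, hw, add_zero]

/-- The multiplicities of a minimal resolution are the dimensions of the Koszul homology. -/
theorem betti_eq_hdim {φ : Matrix (Fin n) (Fin m) (PolyS k n p)}
    (hφ : ∀ i j, φ i j ∈ piece k n p (0, 1)) {β : ℕ → ℤ × ℤ → ℕ}
    (h : IsMinBigradedFreeRes k n p (resJ k n m p φ) β) (i : ℕ) (d : ℤ × ℤ) :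
    β i d = hdim (vopQ φ) (vdeg n p) (qpiece φ) i d := by
  obtain ⟨f, π, hsurj, hex0, hex, hfdeg, hπdeg, hmin⟩ := h
  have hfdeg' : ∀ i d v, v ∈ fpiece k n p (rdeg β (i + 1)) d →
      (f i).restrictScalars k v ∈ fpiece k n p (rdeg β i) d := hfdeg
  have hπdeg' : ∀ d v, v ∈ fpiece k n p (rdeg β 0) d → π.restrictScalars k v ∈ qpiece φ d := hπdeg
  let G' : ∀ i, ℤ × ℤ → Submodule k (FMod k n p β i) := fun i e =>
    fpiece k n p (rdeg β i) e ⊓ LinearMap.range ((f i).restrictScalars k)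
  have hcoef : ∀ i v r, coeff 0 (f i v r) = 0 := fun i v r =>
    coeff_zero_of_mem_smul (hmin i ⟨v, rfl⟩) r
  have hfF : ∀ i s x, (f i).restrictScalars k (fop k n p _ s x) =
      fop k n p _ s ((f i).restrictScalars k x) := fun i s x => (f i).map_smul _ _
  have hπF : ∀ s x, π.restrictScalars k (fop k n p _ s x) = vopQ φ s (π.restrictScalars k x) :=
    fun s x => (π.map_smul _ _).trans (by
      change _ = Ideal.Quotient.mk (resJ k n m p φ) (X (ofLex s)) * π x
      obtain ⟨g, hg⟩ := Ideal.Quotient.mk_surjective (π x)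
      rw [← hg]
      rfl)
  have hlift : ∀ i e x, x ∈ G' i e →
      ∃ y ∈ fpiece k n p (rdeg β (i + 1)) e, (f i).restrictScalars k y = x := by
    rintro i e x ⟨hx, v, rfl⟩
    exact ⟨_, fproj_mem e v, by rw [map_fproj _ (hfdeg' i), fproj_of_mem hx]⟩
  have hliftπ : ∀ e x, x ∈ qpiece φ e →
      ∃ y ∈ fpiece k n p (rdeg β 0) e, π.restrictScalars k y = x := by
    rintro e x ⟨g, hg, rfl⟩
    obtain ⟨v, hv⟩ := hsurj (qpi φ g)
    exact ⟨_, fproj_mem e v, by rw [map_fproj_quotient hφ _ hπdeg' e v g hv, hproj_of_mem hg]⟩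
  have hZ : ∀ i j d, ∀ c ∈ KZ (fop k n p _) (vdeg n p) (G' i) j d,
      c ∈ KB (fop k n p _) (vdeg n p) (fpiece k n p (rdeg β i)) j d := by
    intro i j d c hc
    have hc' := KP_mono (fun e => (inf_le_left : G' i e ≤ _)) _ _ hc.1
    rcases Nat.eq_zero_or_pos j with rfl | hj
    · refine (mem_KB_zero_iff hc').2 fun r _ => ?_
      obtain ⟨v, hv⟩ := ((hc.1 ∅).1 rfl).2
      rw [← hv]
      exact hcoef i v r
    · exact kex_fop hj d c hc' hc.2
  have hsucc : ∀ j i d, β (i + 1 + j) d = hdim (fop k n p _) (vdeg n p) (G' i) j d := by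
    intro j
    induction j with
    | zero =>
      intro i d
      rw [hdim_zero_eq (G' := G' i) (hfF i) (fun e x hx => ⟨hfdeg' i e x hx, x, rfl⟩) (hlift i)
        (fun x r hx => ?_), card_rdeg, add_zero]
      obtain ⟨v, rfl⟩ := (hex i x).1 hx
      exact hcoef _ v r
    | succ j ih =>
      intro i d
      rw [hdim_shift (G' := G' i) (G1 := G' (i + 1)) fop_commute fop_mem (hfF i)
        (fun e x hx => ⟨hfdeg' i e x hx, x, rfl⟩) (hlift i) (fun e x => ?_)
        (kex_fop (by omega) d) (hZ (i + 1) j d), ← ih (i + 1) d]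
      · congr 1
        omega
      · exact and_congr_right fun _ => (hex i x).symm
  rcases i with _ | i
  · rw [hdim_zero_eq hπF hπdeg' hliftπ (fun x r hx => ?_), card_rdeg]
    obtain ⟨v, rfl⟩ := (hex0 x).1 hx
    exact hcoef _ v r
  · rw [hdim_shift (G1 := G' 0) fop_commute fop_mem hπF hπdeg' hliftπ (fun e x => ?_)
      (kex_fop (by omega) d) (hZ 0 i d), ← hsucc i 0 d]
    · congr 1
      omega
    · exact and_congr_right fun _ => (hex0 x).symm

end ResInt

namespace Hilb

/-- The shift of a function on `ℤ × ℤ`. -/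
def shift (g : ℤ × ℤ) : Module.End ℤ (ℤ × ℤ → ℤ) := LinearMap.funLeft ℤ ℤ (· - g)

/-- The group ring acting on functions by shifts. -/
def act : AddMonoidAlgebra ℤ (ℤ × ℤ) →ₐ[ℤ] Module.End ℤ (ℤ × ℤ → ℤ) :=
  AddMonoidAlgebra.lift ℤ _ (ℤ × ℤ)
    { toFun := fun g => shift g.toAdd
      map_one' := by
        ext h d
        simp [shift, LinearMap.funLeft]
      map_mul' := fun g g' => by
        refine LinearMap.ext fun h => funext fun d => ?_
        change h (d - (g.toAdd + g'.toAdd)) = h (d - g.toAdd - g'.toAdd)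
        rw [sub_sub] }

/-- The group element `t ^ g`. -/
def tt (g : ℤ × ℤ) : AddMonoidAlgebra ℤ (ℤ × ℤ) := AddMonoidAlgebra.single g 1

lemma act_tt (g : ℤ × ℤ) (h : ℤ × ℤ → ℤ) (d : ℤ × ℤ) : act (tt g) h d = h (d - g) := by
  unfold act tt
  rw [AddMonoidAlgebra.lift_single, one_smul]
  rfl

lemma act_one_sub (g : ℤ × ℤ) (h : ℤ × ℤ → ℤ) (d : ℤ × ℤ) :
    act (1 - tt g) h d = h d - h (d - g) := by
  rw [map_sub, map_one]
  change h d - act (tt g) h d = _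
  rw [act_tt]

lemma tt_zero : tt 0 = 1 := rfl

lemma tt_add (g g' : ℤ × ℤ) : tt (g + g') = tt g * tt g' := by
  simp [tt, AddMonoidAlgebra.single_mul_single]

lemma tt_sum {α : Type*} (T : Finset α) (f : α → ℤ × ℤ) :
    tt (∑ i ∈ T, f i) = ∏ i ∈ T, tt (f i) := by
  classical
  induction T using Finset.induction_on with
  | empty => simp [tt_zero]
  | insert i T hi ih => rw [Finset.sum_insert hi, Finset.prod_insert hi, tt_add, ih]

lemma tt_nsmul (l : ℕ) (g : ℤ × ℤ) : tt (l • g) = tt g ^ l := by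
  have := tt_sum (Finset.range l) fun _ => g
  simpa using this

lemma act_mul (a b : AddMonoidAlgebra ℤ (ℤ × ℤ)) (h : ℤ × ℤ → ℤ) :
    act (a * b) h = act a (act b h) := by
  rw [map_mul]
  rfl

lemma act_comm (a b : AddMonoidAlgebra ℤ (ℤ × ℤ)) (h : ℤ × ℤ → ℤ) :
    act a (act b h) = act b (act a h) := by
  rw [← act_mul, mul_comm, act_mul]

lemma act_prod {α : Type*} [Fintype α] (deg : α → ℤ × ℤ) (h : ℤ × ℤ → ℤ) (d : ℤ × ℤ) :
    act (∏ i, (1 - tt (deg i))) h d = ∑ T : Finset α, (-1) ^ T.card * h (d - ∑ i ∈ T, deg i) := by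
  classical
  have : ∏ i, (1 - tt (deg i)) = ∑ T : Finset α, ((-1 : ℤ) ^ T.card) • tt (∑ i ∈ T, deg i) := by
    simp_rw [sub_eq_neg_add]
    rw [Finset.prod_add, Finset.powerset_univ]
    refine Finset.sum_congr rfl fun T _ => ?_
    rw [Finset.prod_const_one, mul_one, Finset.prod_neg, tt_sum, zsmul_eq_mul]
    simp
  rw [this, map_sum, LinearMap.sum_apply, Finset.sum_apply]
  refine Finset.sum_congr rfl fun T _ => ?_
  rw [map_smul, LinearMap.smul_apply, Pi.smul_apply, act_tt, smul_eq_mul]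

lemma act_pow (g : ℤ × ℤ) (m : ℕ) (h : ℤ × ℤ → ℤ) (d : ℤ × ℤ) :
    act ((1 - tt g) ^ m) h d =
      ∑ l ∈ Finset.range (m + 1), (-1) ^ l * (m.choose l : ℤ) * h (d - l • g) := by
  have : (1 - tt g) ^ m = ∑ l ∈ Finset.range (m + 1),
      ((-1 : ℤ) ^ l * (m.choose l : ℤ)) • tt (l • g) := by
    rw [sub_eq_neg_add, add_pow]
    refine Finset.sum_congr rfl fun l _ => ?_
    rw [one_pow, mul_one, neg_pow, tt_nsmul, zsmul_eq_mul]
    push_cast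
    ring
  rw [this, map_sum, LinearMap.sum_apply, Finset.sum_apply]
  refine Finset.sum_congr rfl fun T _ => ?_
  rw [map_smul, LinearMap.smul_apply, Pi.smul_apply, act_tt, smul_eq_mul]

/-- The first variable. -/
def tx : AddMonoidAlgebra ℤ (ℤ × ℤ) := tt (1, 0)

/-- The second variable. -/
def ty : AddMonoidAlgebra ℤ (ℤ × ℤ) := tt (0, 1)

lemma act_tx (h : ℤ × ℤ → ℤ) (a b : ℤ) : act (1 - tx) h (a, b) = h (a, b) - h (a - 1, b) := by
  rw [tx, act_one_sub]
  simp

lemma act_ty_pow_eq_zero {P : ℤ → Prop} {h : ℤ × ℤ → ℤ} (hh : ∀ d, P d.1 → h d = 0) (p : ℕ)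
    (d : ℤ × ℤ) (hd : P d.1) : act ((1 - ty) ^ p) h d = 0 := by
  rw [ty, act_pow]
  refine Finset.sum_eq_zero fun l _ => ?_
  rw [hh _ (by simpa using hd), mul_zero]

lemma eq_zero_of_act_tx {u : ℤ × ℤ → ℤ} (hu : ∀ d : ℤ × ℤ, d.1 < 0 → u d = 0)
    (h : act (1 - tx) u = 0) : u = 0 := by
  have key : ∀ (c : ℕ) (b : ℤ), u (c, b) = 0 := by
    intro c b
    induction c with
    | zero =>
      have := congrFun h (0, b)
      rw [act_tx, hu (0 - 1, b) (by simp)] at this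
      simpa using this
    | succ c ih =>
      have := congrFun h ((c + 1 : ℕ), b)
      rw [act_tx] at this
      push_cast at this
      rw [add_sub_cancel_right, ih] at this
      simpa using this
  funext ⟨a, b⟩
  rcases lt_or_ge a 0 with ha | ha
  · exact hu _ ha
  · lift a to ℕ using ha
    exact key a b

lemma eq_zero_of_act_tx_pow {u : ℤ × ℤ → ℤ} (hu : ∀ d : ℤ × ℤ, d.1 < 0 → u d = 0) (n : ℕ)
    (h : act ((1 - tx) ^ n) u = 0) : u = 0 := by
  induction n generalizing u with
  | zero => simpa using h
  | succ n ih =>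
    rw [pow_succ, act_mul] at h
    refine eq_zero_of_act_tx hu (ih (fun d hd => ?_) h)
    obtain ⟨a, b⟩ := d
    simp only at hd
    rw [act_tx, hu _ hd, hu (a - 1, b) (by simp only; omega), sub_zero]

/-- The polynomial `c ↦ binomial (c + j) j`. -/
def ff (j : ℕ) : ℤ → ℤ
  | Int.ofNat c => ((c + j).choose j : ℕ)
  | Int.negSucc e => (-1) ^ j * (e.choose j : ℕ)

lemma ff_natCast (j c : ℕ) : ff j c = ((c + j).choose j : ℕ) := rfl

lemma ff_neg (j e : ℕ) : ff j (-1 - e) = (-1) ^ j * (e.choose j : ℕ) := by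
  rw [show (-1 - e : ℤ) = Int.negSucc e by rw [Int.negSucc_eq]; ring]
  rfl

lemma ff_zero (c : ℤ) : ff 0 c = 1 := by
  rcases c with c | c <;> simp [ff]

lemma ff_zero_right (j : ℕ) : ff j 0 = 1 := by
  have := ff_natCast j 0
  simpa using this

lemma ff_sub (j : ℕ) (c : ℤ) : ff (j + 1) c - ff (j + 1) (c - 1) = ff j c := by
  rcases lt_or_ge c 0 with hc | hc
  · obtain ⟨e, rfl⟩ : ∃ e : ℕ, c = -1 - e := ⟨(-1 - c).toNat, by omega⟩
    rw [show (-1 - e - 1 : ℤ) = -1 - (e + 1 : ℕ) by push_cast; ring, ff_neg, ff_neg, ff_neg,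
      Nat.choose_succ_succ]
    push_cast
    ring
  · lift c to ℕ using hc
    rcases c with _ | c
    · have := ff_neg (j + 1) 0
      simp only [Nat.cast_zero, sub_zero, Nat.choose_zero_succ, mul_zero] at this
      simp [ff_zero_right, this]
    · rw [show ((c + 1 : ℕ) : ℤ) - 1 = (c : ℕ) by push_cast; ring, ff_natCast, ff_natCast,
        ff_natCast, show c + 1 + (j + 1) = c + 1 + j + 1 by ring, Nat.choose_succ_succ,
        show c + (j + 1) = c + 1 + j by ring]
      push_cast
      ring

/-- The delta function at the origin. -/
def del (d : ℤ × ℤ) : ℤ := if d = 0 then 1 else 0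

/-- The bigraded Hilbert function of `k[x₀,…,x_j]`. -/
def FF (j : ℕ) (d : ℤ × ℤ) : ℤ := if d.2 = 0 ∧ 0 ≤ d.1 then ff j d.1 else 0

lemma act_FF (j : ℕ) : act ((1 - tx) ^ (j + 1)) (FF j) = del := by
  induction j with
  | zero =>
    funext ⟨a, b⟩
    rw [zero_add, pow_one, act_tx]
    simp only [FF, ff_zero, del, Prod.mk_eq_zero]
    split_ifs <;> omega
  | succ j ih =>
    rw [pow_succ, act_mul, ← ih]
    congr 1
    funext ⟨a, b⟩
    rw [act_tx]
    simp only [FF]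
    by_cases hb : b = 0
    · rcases lt_trichotomy a 0 with ha | rfl | ha
      · simp [hb, not_le.2 ha, show ¬ (1 ≤ a) by omega]
      · simp [hb, ff_zero_right]
      · rw [if_pos ⟨hb, by omega⟩, if_pos ⟨hb, by omega⟩, if_pos ⟨hb, by omega⟩, ff_sub]
    · simp [hb]

/-- The truncated function `c ↦ binomial (c - e + j) j`. -/
def PhiT (j : ℕ) (d : ℤ × ℤ) : ℤ := if 0 ≤ d.1 then ff j (d.1 - d.2) else 0

lemma act_PhiT (j a e : ℕ) : act ((1 - tx) ^ (j + 1)) (PhiT j) (a, e) =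
    ∑ i ∈ Finset.range (j + 1), (-1 : ℤ) ^ a * (-1) ^ i * (i.choose a * e.choose i : ℕ) := by
  have h0 : ∀ j : ℕ, act ((1 - tx) ^ j)
      (fun d : ℤ × ℤ => if d.1 = 0 then ff j (-1 - d.2) else 0) ((a : ℤ), (e : ℤ)) =
      (-1 : ℤ) ^ a * (-1) ^ j * (j.choose a * e.choose j : ℕ) := by
    intro j
    rw [tx, act_pow]
    have h1 : ∀ l : ℕ, ((a : ℤ), (e : ℤ)) - l • ((1 : ℤ), (0 : ℤ)) = ((a : ℤ) - l, (e : ℤ)) := by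
      intro l
      simp
    simp only [h1, ff_neg]
    by_cases haj : a ≤ j
    · rw [Finset.sum_eq_single a]
      · simp
        ring
      · intro l _ hl
        rw [if_neg (by omega), mul_zero]
      · intro h
        exact absurd (Finset.mem_range.2 (by omega)) h
    · rw [Nat.choose_eq_zero_of_lt (show j < a by omega), zero_mul, Nat.cast_zero, mul_zero]
      refine Finset.sum_eq_zero fun l hl => ?_
      rw [Finset.mem_range] at hl
      rw [if_neg (by omega), mul_zero]
  induction j with
  | zero =>
    rw [Finset.sum_range_one, ← h0, zero_add, pow_one, pow_zero, map_one]
    rw [act_tx]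
    simp only [PhiT, ff_zero, Module.End.one_apply]
    split_ifs <;> omega
  | succ j ih =>
    rw [Finset.sum_range_succ, ← ih, ← h0, pow_succ _ (j + 1), act_mul, ← Pi.add_apply, ← map_add]
    refine congrFun (congrArg _ ?_) _
    funext ⟨a, b⟩
    rw [act_tx, Pi.add_apply]
    simp only [PhiT]
    rcases lt_trichotomy a 0 with ha | rfl | ha
    · rw [if_neg (by omega), if_neg (by omega), if_neg (by omega), if_neg (by omega)]
      rfl
    · have := ff_sub j (0 - b)
      rw [if_pos le_rfl, if_neg (by omega), if_pos le_rfl, if_pos rfl, ← this]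
      rw [show (0 - b - 1 : ℤ) = -1 - b by ring]
      ring
    · rw [if_pos (by omega), if_pos (by omega), if_pos (by omega), if_neg (by omega),
        ← ff_sub j (a - b), sub_right_comm, add_zero]

lemma sum_choose_mul_choose {a e n : ℕ} (hn : a < n) (he : a < e) :
    ∑ i ∈ Finset.range n, (-1 : ℤ) ^ i * (i.choose a * e.choose i : ℕ) =
      (-1) ^ (n - 1) * (e.choose a * (e - a - 1).choose (n - 1 - a) : ℕ) := by
  induction n, hn using Nat.le_induction with
  | base =>
    rw [Finset.sum_range_succ, Finset.sum_eq_zero]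
    · simp
    · intro i hi
      rw [Nat.choose_eq_zero_of_lt (Finset.mem_range.1 hi)]
      simp
  | succ n hn ih =>
    obtain ⟨M, rfl⟩ : ∃ M, e = a + M + 1 := ⟨e - a - 1, by omega⟩
    obtain ⟨t, rfl⟩ : ∃ t, n = a + t + 1 := ⟨n - a - 1, by omega⟩
    rw [Finset.sum_range_succ, ih]
    have h1 : (a + t + 1).choose a * (a + M + 1).choose (a + t + 1) =
        (a + M + 1).choose a * (M + 1).choose (t + 1) := by
      rcases lt_or_ge M t with h | h
      · rw [Nat.choose_eq_zero_of_lt (show a + M + 1 < a + t + 1 by omega),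
          Nat.choose_eq_zero_of_lt (show M + 1 < t + 1 by omega), mul_zero, mul_zero]
      · rw [mul_comm, Nat.choose_mul]
        · congr 2 <;> omega
        · omega
    rw [h1, show a + M + 1 - a - 1 = M by omega, show a + t + 1 - 1 - a = t by omega,
      show a + t + 1 + 1 - 1 - a = t + 1 by omega, Nat.choose_succ_succ,
      show a + t + 1 - 1 = a + t by omega, show a + t + 1 + 1 - 1 = a + t + 1 by omega]
    push_cast
    ring

lemma sum_choose_mul_choose_self {a n : ℕ} (hn : a < n) :
    ∑ i ∈ Finset.range n, (-1 : ℤ) ^ i * (i.choose a * a.choose i : ℕ) = (-1) ^ a := by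
  rw [Finset.sum_eq_single a]
  · simp
  · intro i _ hi
    rcases lt_or_gt_of_ne hi with h | h
    · simp [Nat.choose_eq_zero_of_lt h]
    · simp [Nat.choose_eq_zero_of_lt h]
  · exact fun h => absurd (Finset.mem_range.2 hn) h

end Hilb

namespace Hilb

/-- The bigraded quasi-polynomial `(-1)^b * C(m, b) * C(a - b + j, j)`. -/
def VV (m j : ℕ) (d : ℤ × ℤ) : ℤ :=
  if 0 ≤ d.2 then (-1) ^ d.2.toNat * (m.choose d.2.toNat : ℕ) * ff j (d.1 - d.2) else 0

lemma act_VV (m j : ℕ) : act ((1 - tx) ^ (j + 1)) (VV m j) = 0 := by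
  induction j with
  | zero =>
    funext ⟨a, b⟩
    rw [zero_add, pow_one, act_tx]
    simp [VV, ff_zero]
  | succ j ih =>
    rw [pow_succ, act_mul, ← ih]
    congr 1
    funext ⟨a, b⟩
    rw [act_tx]
    simp only [VV]
    split_ifs
    · rw [← ff_sub j (a - b), show a - 1 - b = a - b - 1 by ring]
      ring
    · rfl

lemma act_FF_eq_VV (m j : ℕ) (d : ℤ × ℤ) (hd : (m : ℤ) ≤ d.1) :
    act ((1 - tt (1, 1)) ^ m) (FF j) d = VV m j d := by
  obtain ⟨a, b⟩ := d
  simp only at hd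
  rw [act_pow]
  have h1 : ∀ l : ℕ, (a, b) - l • ((1 : ℤ), (1 : ℤ)) = (a - l, b - l) := by
    intro l
    simp
  simp only [h1, FF, VV]
  split_ifs with hb
  · lift b to ℕ using hb
    rw [Int.toNat_natCast]
    by_cases hbm : b ≤ m
    · rw [Finset.sum_eq_single b]
      · rw [if_pos ⟨by ring, by omega⟩]
      · intro l _ hl
        rw [if_neg (by omega), mul_zero]
      · exact fun h => absurd (Finset.mem_range.2 (by omega)) h
    · rw [Nat.choose_eq_zero_of_lt (show m < b by omega), Nat.cast_zero, mul_zero, zero_mul]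
      refine Finset.sum_eq_zero fun l hl => ?_
      rw [Finset.mem_range] at hl
      rw [if_neg (by omega), mul_zero]
  · refine Finset.sum_eq_zero fun l hl => ?_
    rw [if_neg (by omega), mul_zero]

lemma act_ty_pow_eq {s : ℤ × ℤ → ℤ} (hs : ∀ d : ℤ × ℤ, d.1 < 0 → s d = 0) (j p : ℕ)
    (h : act ((1 - tx) ^ (j + 1)) (act ((1 - ty) ^ p) s) = del) :
    act ((1 - ty) ^ p) s = FF j := by
  rw [← sub_eq_zero]
  refine eq_zero_of_act_tx_pow (fun d hd => ?_) (j + 1) ?_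
  · rw [Pi.sub_apply, act_ty_pow_eq_zero (P := (· < 0)) hs p d hd, FF, if_neg (by omega), sub_zero]
  · rw [map_sub, h, act_FF, sub_self]

lemma act_tt_pow_VV (m j N : ℕ) : act ((1 - tt ((N : ℤ), 0)) ^ (j + 1)) (VV m j) = 0 := by
  have h1 : tt ((N : ℤ), 0) = tx ^ N := by
    rw [tx, ← tt_nsmul]
    simp
  have h2 : (1 - tx) ∣ 1 - tx ^ N := by
    simpa using sub_dvd_pow_sub_pow 1 tx N
  obtain ⟨c, hc⟩ := pow_dvd_pow_of_dvd h2 (j + 1)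
  rw [h1, hc, mul_comm, act_mul, act_VV, map_zero]

lemma eq_zero_of_act_tt_pow {u : ℤ × ℤ → ℤ} {n N : ℕ} (h1 : ∀ d : ℤ × ℤ, (N : ℤ) ≤ d.1 → u d = 0)
    (h2 : ∀ d : ℤ × ℤ, ((n * N : ℕ) : ℤ) ≤ d.1 → act ((1 - tt ((N : ℤ), 0)) ^ n) u d = 0)
    (d : ℤ × ℤ) (hd : 0 ≤ d.1) : u d = 0 := by
  have h := h2 (d + n • ((N : ℤ), (0 : ℤ))) (by simpa using hd)
  rw [act_pow, Finset.sum_range_succ, Finset.sum_eq_zero] at h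
  · simpa using h
  · intro l hl
    rw [Finset.mem_range] at hl
    rw [h1, mul_zero]
    simp only [nsmul_eq_mul, Prod.fst_sub, Prod.fst_add, Prod.fst_mul, Prod.fst_natCast]
    obtain ⟨t, rfl⟩ : ∃ t, n = l + t + 1 := ⟨n - l - 1, by omega⟩
    push_cast
    have : (0 : ℤ) ≤ t * N := by positivity
    linarith

section

variable {s h : ℤ × ℤ → ℤ} {j m p N : ℕ}

lemma act_ty_pow_hilb (hmN : m ≤ N) (hs : ∀ d : ℤ × ℤ, d.1 < 0 → s d = 0)
    (h1 : ∀ d : ℤ × ℤ, (N : ℤ) ≤ d.1 → act ((1 - tt (1, 1)) ^ m) s d = h d)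
    (h2 : ∀ d : ℤ × ℤ, (((j + 1) * N : ℕ) : ℤ) ≤ d.1 →
      act ((1 - tt ((N : ℤ), 0)) ^ (j + 1)) h d = 0)
    (h3 : act ((1 - tx) ^ (j + 1)) (act ((1 - ty) ^ p) s) = del)
    (d : ℤ × ℤ) (hd : 0 ≤ d.1) : act ((1 - ty) ^ p) h d = VV m j d := by
  have hw := act_ty_pow_eq hs j p h3
  rw [← sub_eq_zero]
  refine eq_zero_of_act_tt_pow (u := act ((1 - ty) ^ p) h - VV m j) (N := N) (n := j + 1)
    (fun d hd => ?_) (fun d hd => ?_) d hd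
  · rw [Pi.sub_apply, ← act_FF_eq_VV m j d (by omega), ← hw, act_comm, ← Pi.sub_apply, ← map_sub]
    refine act_ty_pow_eq_zero (P := fun a => (N : ℤ) ≤ a) (fun d hd => ?_) p d hd
    rw [Pi.sub_apply, h1 d hd, sub_self]
  · rw [map_sub, act_tt_pow_VV, sub_zero, act_comm]
    exact act_ty_pow_eq_zero (P := fun a => (((j + 1) * N : ℕ) : ℤ) ≤ a) h2 p d hd

end

lemma act_hilb {s h : ℤ × ℤ → ℤ} {j m p N : ℕ} (hmN : m ≤ N)
    (hs : ∀ d : ℤ × ℤ, d.1 < 0 → s d = 0) (hh : ∀ d : ℤ × ℤ, d.1 < 0 → h d = 0)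
    (h1 : ∀ d : ℤ × ℤ, (N : ℤ) ≤ d.1 → act ((1 - tt (1, 1)) ^ m) s d = h d)
    (h2 : ∀ d : ℤ × ℤ, (((j + 1) * N : ℕ) : ℤ) ≤ d.1 →
      act ((1 - tt ((N : ℤ), 0)) ^ (j + 1)) h d = 0)
    (h3 : act ((1 - tx) ^ (j + 1)) (act ((1 - ty) ^ p) s) = del) (a b : ℕ) :
    act ((1 - tx) ^ (j + 1)) (act ((1 - ty) ^ p) h) (a, b) = (-1) ^ b * (m.choose b : ℕ) *
      ∑ i ∈ Finset.range (j + 1), (-1 : ℤ) ^ a * (-1) ^ i * (i.choose a * b.choose i : ℕ) := by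
  rw [← act_PhiT, tx, act_pow, act_pow, Finset.mul_sum]
  refine Finset.sum_congr rfl fun l _ => ?_
  have e : ((a : ℤ), (b : ℤ)) - l • ((1 : ℤ), (0 : ℤ)) = ((a : ℤ) - l, (b : ℤ)) := by simp
  rw [e, PhiT]
  split_ifs with hd
  · rw [act_ty_pow_hilb hmN hs h1 h2 h3 _ hd, VV, if_pos (by simp)]
    simp only [Int.toNat_natCast]
    ring
  · rw [act_ty_pow_eq_zero (P := (· < 0)) hh p _ (not_le.1 hd)]
    simp

lemma act_eq_zero_of_neg {h : ℤ × ℤ → ℤ} (hh : ∀ d : ℤ × ℤ, d.1 < 0 ∨ d.2 < 0 → h d = 0)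
    (n p : ℕ) (d : ℤ × ℤ) (hd : d.1 < 0 ∨ d.2 < 0) :
    act ((1 - tx) ^ n) (act ((1 - ty) ^ p) h) d = 0 := by
  rw [tx, ty, act_pow]
  refine Finset.sum_eq_zero fun l _ => ?_
  rw [act_pow, Finset.sum_eq_zero, mul_zero]
  intro l' _
  rw [hh, mul_zero]
  simp
  omega

end Hilb

namespace ResInt

open Koszul Hilb

variable {k : Type} [Field k] {n m p : ℕ}

lemma mdeg_fst_add_snd (μ : Fin n ⊕ Fin p →₀ ℕ) :
    (mdeg μ).1 + (mdeg μ).2 = ((μ.sum fun _ e => e : ℕ) : ℤ) := by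
  rw [Finsupp.sum_fintype _ _ (fun _ => rfl), Fintype.sum_sum_type]
  simp [mdeg]

instance finite_piece (d : ℤ × ℤ) : Module.Finite k (piece k n p d) := by
  have hle : piece k n p d ≤ restrictSupport k
      {μ : Fin n ⊕ Fin p →₀ ℕ | μ.degree ≤ (d.1 + d.2).toNat} := by
    intro f hf
    rw [mem_restrictSupport_iff]
    intro μ hμ
    have h := mem_piece.1 hf μ (mem_support_iff.1 hμ)
    have h1 := mdeg_fst_add_snd μ
    rw [h] at h1
    change μ.degree ≤ _
    change _ = ((μ.degree : ℕ) : ℤ) at h1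
    omega
  have hfin : Set.Finite {μ : Fin n ⊕ Fin p →₀ ℕ | μ.degree ≤ (d.1 + d.2).toNat} :=
    Finsupp.finite_of_degree_le _
  have := hfin.to_subtype
  have : Module.Finite k (restrictSupport k
      {μ : Fin n ⊕ Fin p →₀ ℕ | μ.degree ≤ (d.1 + d.2).toNat}) :=
    Module.Finite.of_basis (basisRestrictSupport k _)
  exact Submodule.finiteDimensional_of_le hle

instance finite_qpiece (φ : Matrix (Fin n) (Fin m) (PolyS k n p)) (d : ℤ × ℤ) :
    Module.Finite k (qpiece φ d) := by
  unfold qpiece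
  infer_instance

lemma finrank_piece_zero : Module.finrank k (piece k n p 0) = 1 := by
  have h1 : (C 1 : PolyS k n p) ∈ piece k n p 0 := C_mem_piece _
  refine finrank_eq_one (⟨C 1, h1⟩ : piece k n p 0) ?_ ?_
  · intro h
    have := congrArg Subtype.val h
    simp at this
  · rintro ⟨f, hf⟩
    refine ⟨coeff 0 f, Subtype.ext ?_⟩
    have h2 := sub_mem (Submodule.smul_mem _ (coeff 0 f) h1) hf
    exact sub_eq_zero.1 (eq_zero_of_mem_piece_zero h2 (by simp))

variable (k n p) in
/-- The Hilbert function of `S`. -/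
def sdim (d : ℤ × ℤ) : ℤ := Module.finrank k (piece k n p d)

/-- The Hilbert function of `S/J`. -/
def qdim (φ : Matrix (Fin n) (Fin m) (PolyS k n p)) (d : ℤ × ℤ) : ℤ :=
  Module.finrank k (qpiece φ d)

lemma sdim_eq_zero {d : ℤ × ℤ} (hd : d.1 < 0 ∨ d.2 < 0) : sdim k n p d = 0 := by
  have : Subsingleton (piece k n p d) :=
    ⟨fun x y => Subtype.ext (by rw [piece_eq_bot hd x.2, piece_eq_bot hd y.2])⟩
  rw [sdim, Module.finrank_zero_of_subsingleton, Nat.cast_zero]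

lemma qdim_eq_zero {φ : Matrix (Fin n) (Fin m) (PolyS k n p)} {d : ℤ × ℤ}
    (hd : d.1 < 0 ∨ d.2 < 0) : qdim φ d = 0 := by
  have : Subsingleton (qpiece φ d) :=
    ⟨fun x y => Subtype.ext (by rw [qpiece_eq_zero φ hd x.2, qpiece_eq_zero φ hd y.2])⟩
  rw [qdim, Module.finrank_zero_of_subsingleton, Nat.cast_zero]

lemma prod_vdeg : ∏ i : Vars n p, (1 - tt (vdeg n p i)) = (1 - tx) ^ n * (1 - ty) ^ p := by
  rw [show ∏ i : Vars n p, (1 - tt (vdeg n p i)) =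
    ∏ i : Fin n ⊕ Fin p, (1 - tt (bideg n p i)) from
      Equiv.prod_comp ofLex fun i => 1 - tt (bideg n p i)]
  rw [Fintype.prod_sum_type]
  simp [bideg, tx, ty]

lemma act_sdim : act ((1 - tx) ^ n) (act ((1 - ty) ^ p) (sdim k n p)) = del := by
  funext d
  rw [← act_mul, ← prod_vdeg, act_prod]
  by_cases hd : d = 0
  · subst hd
    rw [Finset.sum_eq_single ∅]
    · rw [Finset.sum_empty, sub_zero, sdim, finrank_piece_zero]
      simp [del]
    · intro T _ hT
      have h1 := card_left_add T
      have h2 := Finset.card_pos.2 (Finset.nonempty_iff_ne_empty.2 hT)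
      rw [sdim_eq_zero, mul_zero]
      rw [sum_vdeg]
      simp only [Prod.fst_sub, Prod.snd_sub, Prod.fst_zero, Prod.snd_zero]
      omega
    · simp
  · rw [del, if_neg hd]
    refine (sum_hdim (F := vop k n p) (fun _ _ => op_commute _ _) vop_mem d).symm.trans ?_
    refine Finset.sum_eq_zero fun q _ => ?_
    rw [hdim_eq_zero (kex_v q d (Or.inr hd)), Nat.cast_zero, mul_zero]

variable {φ : Matrix (Fin n) (Fin m) (PolyS k n p)}

lemma hdim_zop_zero (hφ : ∀ i j, φ i j ∈ piece k n p (0, 1)) {d : ℤ × ℤ} (hd : 1 ≤ d.1) :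
    hdim (zop φ) (zdeg m) (piece k n p) 0 d = Module.finrank k (qpiece φ d) := by
  have hmem : ∀ c ∈ KP (zdeg m) (piece k n p) 0 d, c ∅ ∈ piece k n p d := by
    intro c hc
    simpa using (hc ∅).1 (by simp)
  refine hdim_eq_finrank (P := KP (zdeg m) (piece k n p) 0 d) (Submodule.subtype _)
    (fun c => ⟨c.2, kd_zero c.2⟩) (fun c hc => ⟨⟨c, hc.1⟩, rfl⟩)
    ((qpi φ ∘ₗ LinearMap.proj ∅ ∘ₗ Submodule.subtype _).codRestrict (qpiece φ d)
      fun c => qpi_mem φ (hmem c.1 c.2)) ?_ ?_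
  · rintro ⟨_, f, hf, rfl⟩
    refine ⟨⟨_, single_mem_KP hf⟩, Subtype.ext ?_⟩
    simp
  · rintro ⟨c, hc⟩
    rw [mem_KB, ← Subtype.coe_inj]
    change _ ↔ qpi φ (c ∅) = 0
    constructor
    · rintro ⟨b, hb, e⟩
      rw [← show kd (zop φ) b = c from e, kd_apply', map_sum]
      refine Finset.sum_eq_zero fun i _ => ?_
      rw [map_zsmul, qpi_zop, smul_zero]
    · intro h
      obtain ⟨b, hb, e⟩ := exists_kd_zop_one hφ (hmem c hc)
        (mem_span_of_mem_resJ hφ (Or.inl hd) ((qpi_eq_zero φ).1 h) (hmem c hc))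
      refine ⟨b, hb, funext fun T => ?_⟩
      by_cases hT : T = ∅
      · rw [hT, e]
        rfl
      · have hT' : T.card ≠ 0 := by simpa using hT
        rw [(kd_mem (zop_mem hφ) hb T).2 hT']
        exact ((hc T).2 hT').symm

lemma act_zdeg_sdim (hφ : ∀ i j, φ i j ∈ piece k n p (0, 1)) {N : ℕ} (hN : 1 ≤ N)
    (hz : ∀ (q : ℕ) (d : ℤ × ℤ), 1 ≤ q → (N : ℤ) ≤ d.1 →
      KEx (zop φ) (zdeg m) (piece k n p) q d) (d : ℤ × ℤ) (hd : (N : ℤ) ≤ d.1) :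
    act ((1 - tt (1, 1)) ^ m) (sdim k n p) d = qdim φ d := by
  have h := act_prod (zdeg m) (sdim k n p) d
  rw [show ∏ i, (1 - tt (zdeg m i)) = (1 - tt (1, 1)) ^ m by simp [zdeg]] at h
  rw [h]
  refine (sum_hdim (F := zop φ) (fun _ _ => op_commute _ _) (zop_mem hφ) d).symm.trans ?_
  rw [Finset.sum_eq_single 0]
  · rw [hdim_zop_zero hφ (by omega), pow_zero, one_mul]
    rfl
  · intro q _ hq
    rw [hdim_eq_zero (hz q d (Nat.one_le_iff_ne_zero.2 hq) hd), Nat.cast_zero, mul_zero]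
  · simp

lemma act_xdeg_qdim (hφ : ∀ i j, φ i j ∈ piece k n p (0, 1)) {N : ℕ} (hN : 1 ≤ N)
    (hz : ∀ (q : ℕ) (d : ℤ × ℤ), 1 ≤ q → (N : ℤ) ≤ d.1 →
      KEx (zop φ) (zdeg m) (piece k n p) q d) (d : ℤ × ℤ) (hd : ((n * N : ℕ) : ℤ) ≤ d.1) :
    act ((1 - tt ((N : ℤ), 0)) ^ n) (qdim φ) d = 0 := by
  have h := act_prod (xdeg n N) (qdim φ) d
  rw [show ∏ i, (1 - tt (xdeg n N i)) = (1 - tt ((N : ℤ), 0)) ^ n by simp [xdeg]] at h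
  rw [h]
  refine (sum_hdim (F := xopQ φ N) (fun _ _ => op_commute _ _) (xopQ_mem φ N) d).symm.trans ?_
  refine Finset.sum_eq_zero fun q _ => ?_
  rw [hdim_eq_zero (kex_xopQ hφ hN hz q d hd), Nat.cast_zero, mul_zero]

lemma sum_hdim_vopQ (d : ℤ × ℤ) :
    ∑ q ∈ Finset.range (n + p + 1), (-1 : ℤ) ^ q *
      (hdim (vopQ φ) (vdeg n p) (qpiece φ) q d : ℤ) =
      act ((1 - tx) ^ n) (act ((1 - ty) ^ p) (qdim φ)) d := by
  rw [← act_mul, ← prod_vdeg, act_prod]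
  refine .trans ?_ (sum_hdim (F := vopQ φ) (fun _ _ => op_commute _ _) (vopQ_mem φ) d)
  congr 3
  simp [Fintype.card_lex]

end ResInt

namespace ResInt

open Koszul Hilb

variable {k : Type} [Field k] {n m p : ℕ} {φ : Matrix (Fin n) (Fin m) (PolyS k n p)}

lemma hdim_vopQ_euler {i : ℕ} {d : ℤ × ℤ}
    (h : ∀ q, q ≠ i → KEx (vopQ φ) (vdeg n p) (qpiece φ) q d) :
    (hdim (vopQ φ) (vdeg n p) (qpiece φ) i d : ℤ) =
      (-1) ^ i * act ((1 - tx) ^ n) (act ((1 - ty) ^ p) (qdim φ)) d := by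
  rw [← sum_hdim_vopQ, Finset.sum_eq_single i, ← mul_assoc, ← mul_pow]
  · simp
  · intro q _ hq
    rw [hdim_eq_zero (h q hq), Nat.cast_zero, mul_zero]
  · intro hi
    rw [Finset.mem_range] at hi
    rw [hdim_eq_zero (kex_of_card_lt (by simp [Fintype.card_lex]; omega)), Nat.cast_zero, mul_zero]

/-- The Euler characteristic of the Koszul homology of `S/J` in a given bidegree. -/
theorem act_qdim (hn : 0 < n) (hφ : ∀ i j, φ i j ∈ piece k n p (0, 1)) {N0 : ℕ}
    (hz : ∀ (q : ℕ) (d : ℤ × ℤ), 1 ≤ q → (N0 : ℤ) ≤ d.1 →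
      KEx (zop φ) (zdeg m) (piece k n p) q d) (a b : ℕ) :
    act ((1 - tx) ^ n) (act ((1 - ty) ^ p) (qdim φ)) (a, b) = (-1) ^ b * (m.choose b : ℕ) *
      ((-1) ^ a * ∑ i ∈ Finset.range n, (-1 : ℤ) ^ i * (i.choose a * b.choose i : ℕ)) := by
  obtain ⟨j, rfl⟩ := Nat.exists_eq_add_of_le' hn
  have hz' : ∀ (q : ℕ) (d : ℤ × ℤ), 1 ≤ q → ((N0 + m + 1 : ℕ) : ℤ) ≤ d.1 →
      KEx (zop φ) (zdeg m) (piece k (j + 1) p) q d := fun q d hq hd => hz q d hq (by omega)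
  rw [act_hilb (show m ≤ N0 + m + 1 by omega) (fun d hd => sdim_eq_zero (Or.inl hd))
    (fun d hd => qdim_eq_zero (Or.inl hd)) (act_zdeg_sdim hφ (by omega) hz')
    (act_xdeg_qdim hφ (by omega) hz') act_sdim, Finset.mul_sum (a := (-1 : ℤ) ^ a)]
  simp only [mul_assoc]

theorem hdim_vopQ_eq (hn : 0 < n) (hnm : n ≤ m) (hφ : ∀ i j, φ i j ∈ piece k n p (0, 1)) {N0 : ℕ}
    (hz : ∀ (q : ℕ) (d : ℤ × ℤ), 1 ≤ q → (N0 : ℤ) ≤ d.1 →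
      KEx (zop φ) (zdeg m) (piece k n p) q d) (i : ℕ) (a b : ℤ) :
    hdim (vopQ φ) (vdeg n p) (qpiece φ) i (a, b) = bettiFormula n m i (a, b) := by
  by_cases h1 : a = i ∧ b = i ∧ i < n
  · obtain ⟨rfl, rfl, hi⟩ := h1
    rw [bettiFormula, if_pos ⟨by omega, rfl, rfl⟩, ← @Nat.cast_inj ℤ,
      hdim_vopQ_euler (fun q hq => kex_vopQ hφ hz (by omega) (by omega)), act_qdim hn hφ hz,
      sum_choose_mul_choose_self hi]
    rcases neg_one_pow_eq_or ℤ i with h | h <;> rw [h] <;> ring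
  by_cases h2 : n ≤ b ∧ b ≤ m ∧ a < n ∧ (i : ℤ) = a + b - n + 1
  · obtain ⟨hb, hbm, ha, hi⟩ := h2
    have he := hdim_vopQ_euler (i := i) (φ := φ) (d := (a, b))
      fun q hq => kex_vopQ hφ hz (by omega) (by omega)
    rw [bettiFormula, if_neg (by simp only; omega)]
    lift b to ℕ using by omega
    rcases lt_or_ge a 0 with ha0 | ha0
    · rw [act_eq_zero_of_neg (fun d hd => qdim_eq_zero hd) n p _ (Or.inl ha0), mul_zero] at he
      rw [if_neg (by simp only; omega)]
      exact_mod_cast he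
    lift a to ℕ using ha0
    rw [if_pos (by simp only; omega), ← @Nat.cast_inj ℤ, he, act_qdim hn hφ hz,
      sum_choose_mul_choose (by omega) (by omega), rMult, Int.toNat_natCast]
    have e1 : n + i - 1 - a = b := by omega
    have e2 : (n + i - 2 * a - 2).choose (i - 1 - a) = (b - a - 1).choose (n - 1 - a) := by
      rw [show n + i - 2 * a - 2 = b - a - 1 by omega, show i - 1 - a = b - a - 1 - (n - 1 - a) by
        omega, Nat.choose_symm (by omega)]
    have e3 : (-1 : ℤ) ^ i * (-1) ^ b * (-1) ^ a * (-1) ^ (n - 1) = 1 := by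
      rw [← pow_add, ← pow_add, ← pow_add]
      exact Even.neg_one_pow ⟨a + b, by omega⟩
    rw [e1, e2]
    push_cast
    linear_combination ((b - a - 1).choose (n - 1 - a) : ℤ) * (b.choose a : ℤ) *
      (m.choose b : ℤ) * e3
  · rw [hdim_eq_zero (kex_vopQ hφ hz h1 h2), bettiFormula, if_neg (by simp only; omega),
      if_neg (by simp only; omega)]

end ResInt

/-- Under the residual-intersection hypotheses, the bigraded Betti
numbers of `S/J` over `S` (i.e. the multiplicities of any minimal bigraded free
resolution) are: `C(m,i)` if `0 ≤ i ≤ n-1` and `a = b = i`; `r(i,a)` if `1 ≤ i ≤ m`,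
`b = n+i-1-a` and `max{0, i-(m-n+1)} ≤ a ≤ min{i-1, n-1}`; and `0` otherwise. -/
theorem stmt1
    (k : Type) [Field k] (n m p : ℕ)
    (hn : 0 < n) (hp : 0 < p) (hnm : n ≤ m)
    (φ : Matrix (Fin n) (Fin m) (PolyS k n p))
    (hφ : ∀ i j, φ i j ∈ piece k n p (0, 1))
    (hgrade : gradeGE (minorsIdeal n φ) (m - n + 1))
    (hhtJ : (m : ℕ∞) ≤ idealHeight (resJ k n m p φ))
    (hgeom : geomResCond k n m p φ) :
    ∀ β : ℕ → ℤ × ℤ → ℕ, IsMinBigradedFreeRes k n p (resJ k n m p φ) β →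
      ∀ (i : ℕ) (a b : ℤ), β i (a, b) = bettiFormula n m i (a, b) := by
  intro β hβ i a b
  obtain ⟨N0, hz⟩ := ResInt.exists_kex_z hφ hhtJ
  rw [ResInt.betti_eq_hdim hφ hβ, ResInt.hdim_vopQ_eq hn hnm hφ hz]
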